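/- Log-Sobolev inequality for non-reversible dynamics (Corollary 2.3): assume there exists λ > 0 such that ⟨ℜ(x) v, v⟩ ≥ λ ‖v‖² for every x ∈ ℝ^d and every v ∈ ℝ^d. Then for every smooth compactly supported f : ℝ^d → ℝ, the probability density p := π e^f / ∫_{ℝ^d} π e^f dx satisfies D_KL(p‖π) ≤ (1/(2λ)) · I(p‖π), where D_KL(p‖π) = ∫_{ℝ^d} p(x) log(p(x)/π(x)) dx and I(p‖π) = ∫_{ℝ^d} ‖∇ log(p(x)/π(x))‖² p(x) dx. -/

import Mathlib

open MeasureTheory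
open scoped BigOperators

noncomputable section

/-- `i`-th partial derivative of `f` at `x`, in the coordinate direction `i`. -/
def pderiv' {d : ℕ} (f : EuclideanSpace ℝ (Fin d) → ℝ) (i : Fin d)
    (x : EuclideanSpace ℝ (Fin d)) : ℝ :=
  fderiv ℝ f x (EuclideanSpace.single i 1)

/-- second partial derivative `∂_i ∂_j f` at `x`. -/
def pderiv2 {d : ℕ} (f : EuclideanSpace ℝ (Fin d) → ℝ) (i j : Fin d)
    (x : EuclideanSpace ℝ (Fin d)) : ℝ :=
  pderiv' (fun y => pderiv' f j y) i x

/-- Laplacian `Δf`. -/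
def lap {d : ℕ} (f : EuclideanSpace ℝ (Fin d) → ℝ) (x : EuclideanSpace ℝ (Fin d)) : ℝ :=
  ∑ i, pderiv2 f i i x

/-- carré du champ `Γ₁(g,h) = ⟨∇g, ∇h⟩`. -/
def Gamma1 {d : ℕ} (g h : EuclideanSpace ℝ (Fin d) → ℝ) (x : EuclideanSpace ℝ (Fin d)) : ℝ :=
  ∑ i, pderiv' g i x * pderiv' h i x

/-- generator `L̃ h = ⟨∇ log π, ∇h⟩ + Δh`. -/
def genL {d : ℕ} (π h : EuclideanSpace ℝ (Fin d) → ℝ) (x : EuclideanSpace ℝ (Fin d)) : ℝ :=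
  Gamma1 (fun y => Real.log (π y)) h x + lap h x

/-- Gamma two operator `Γ₂(f,f) = ½ L̃ Γ₁(f,f) − Γ₁(L̃f, f)`. -/
def Gamma2 {d : ℕ} (π f : EuclideanSpace ℝ (Fin d) → ℝ) (x : EuclideanSpace ℝ (Fin d)) : ℝ :=
  (1/2 : ℝ) * genL π (fun y => Gamma1 f f y) x - Gamma1 (fun y => genL π f y) f x

/-- information Gamma operator `Γ_I(f,f) = −½⟨γ, ∇Γ₁(f,f)⟩ + (L̃f)·⟨∇f, γ⟩`. -/
def GammaI {d : ℕ} (π : EuclideanSpace ℝ (Fin d) → ℝ)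
    (γ : EuclideanSpace ℝ (Fin d) → EuclideanSpace ℝ (Fin d))
    (f : EuclideanSpace ℝ (Fin d) → ℝ) (x : EuclideanSpace ℝ (Fin d)) : ℝ :=
  -(1/2 : ℝ) * (∑ i, γ x i * pderiv' (fun y => Gamma1 f f y) i x)
    + genL π f x * (∑ i, pderiv' f i x * γ x i)

/-- the tensor `ℜ` of the paper:
`ℜ_{ij} = −∂²_{ij} log π + ((3−2d)/8) γ_i γ_j − (1/8) δ_{ij} Σ_k γ_k²
          + ½(γ_i ∂_j log π + γ_j ∂_i log π)`. -/
def Rtensor {d : ℕ} (π : EuclideanSpace ℝ (Fin d) → ℝ)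
    (γ : EuclideanSpace ℝ (Fin d) → EuclideanSpace ℝ (Fin d))
    (i j : Fin d) (x : EuclideanSpace ℝ (Fin d)) : ℝ :=
  -pderiv2 (fun y => Real.log (π y)) i j x
    + ((3 - 2 * (d : ℝ)) / 8) * γ x i * γ x j
    - (1/8 : ℝ) * (if i = j then ∑ k, (γ x k) ^ 2 else 0)
    + (1/2 : ℝ) * (γ x i * pderiv' (fun y => Real.log (π y)) j x
        + γ x j * pderiv' (fun y => Real.log (π y)) i x)

/-- the modified Hessian matrix `𝔥ess f`. -/
def hessM {d : ℕ} (γ : EuclideanSpace ℝ (Fin d) → EuclideanSpace ℝ (Fin d))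
    (f : EuclideanSpace ℝ (Fin d) → ℝ) (i j : Fin d) (x : EuclideanSpace ℝ (Fin d)) : ℝ :=
  if i = j then
    pderiv2 f i i x + (1/2 : ℝ) * (∑ k, γ x k * pderiv' f k x)
      - (1/2 : ℝ) * γ x i * pderiv' f i x
  else
    pderiv2 f i j x - (1/4 : ℝ) * (γ x i * pderiv' f j x + γ x j * pderiv' f i x)

/-- right-hand side of the Fokker–Planck equation `−∇·(p b) + Δp` with drift
`b = ∇ log π − γ`, evaluated at a density `p`. -/
def FPrhs {d : ℕ} (π : EuclideanSpace ℝ (Fin d) → ℝ)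
    (γ : EuclideanSpace ℝ (Fin d) → EuclideanSpace ℝ (Fin d))
    (p : EuclideanSpace ℝ (Fin d) → ℝ) (x : EuclideanSpace ℝ (Fin d)) : ℝ :=
  -(∑ i, pderiv' (fun y => p y * (pderiv' (fun z => Real.log (π z)) i y - γ y i)) i x)
    + lap p x

/-- `L̃* p = −∇·(p ∇ log π) + Δp`. -/
def Ltilstar {d : ℕ} (π p : EuclideanSpace ℝ (Fin d) → ℝ)
    (x : EuclideanSpace ℝ (Fin d)) : ℝ :=
  -(∑ i, pderiv' (fun y => p y * pderiv' (fun z => Real.log (π z)) i y) i x) + lap p x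

/-- Arnold–Carlen tensor `(ℜ_AC)_{ij} = −∂²_{ij} log π − ½(∂_i γ_j + ∂_j γ_i)`. -/
def RAC {d : ℕ} (π : EuclideanSpace ℝ (Fin d) → ℝ)
    (γ : EuclideanSpace ℝ (Fin d) → EuclideanSpace ℝ (Fin d))
    (i j : Fin d) (x : EuclideanSpace ℝ (Fin d)) : ℝ :=
  -pderiv2 (fun y => Real.log (π y)) i j x
    - (1/2 : ℝ) * (pderiv' (fun y => γ y j) i x + pderiv' (fun y => γ y i) j x)


open scoped InnerProductSpace ENNReal

/-! ### Calculus of partial derivatives -/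

section PartialDerivatives

variable {d : ℕ} {f g : EuclideanSpace ℝ (Fin d) → ℝ} {x : EuclideanSpace ℝ (Fin d)}

theorem pderiv'_add (hf : DifferentiableAt ℝ f x) (hg : DifferentiableAt ℝ g x) (i : Fin d) :
    pderiv' (fun y => f y + g y) i x = pderiv' f i x + pderiv' g i x := by
  simp [pderiv', fderiv_fun_add hf hg]

theorem pderiv'_sub (hf : DifferentiableAt ℝ f x) (hg : DifferentiableAt ℝ g x) (i : Fin d) :
    pderiv' (fun y => f y - g y) i x = pderiv' f i x - pderiv' g i x := by
  simp [pderiv', fderiv_fun_sub hf hg]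

theorem pderiv'_const (c : ℝ) (i : Fin d) :
    pderiv' (fun _ : EuclideanSpace ℝ (Fin d) => c) i x = 0 := by
  simp [pderiv']

theorem pderiv'_mul (hf : DifferentiableAt ℝ f x) (hg : DifferentiableAt ℝ g x) (i : Fin d) :
    pderiv' (fun y => f y * g y) i x = pderiv' f i x * g x + f x * pderiv' g i x := by
  simp [pderiv', fderiv_fun_mul hf hg]; ring

theorem pderiv'_const_mul (hf : DifferentiableAt ℝ f x) (c : ℝ) (i : Fin d) :
    pderiv' (fun y => c * f y) i x = c * pderiv' f i x := by
  rw [pderiv'_mul (differentiableAt_const c) hf, pderiv'_const]; ring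

theorem pderiv'_sum {ι : Type*} {s : Finset ι} {F : ι → EuclideanSpace ℝ (Fin d) → ℝ}
    (hF : ∀ k ∈ s, DifferentiableAt ℝ (F k) x) (i : Fin d) :
    pderiv' (fun y => ∑ k ∈ s, F k y) i x = ∑ k ∈ s, pderiv' (F k) i x := by
  simp [pderiv', fderiv_fun_sum hF]

theorem pderiv'_comp {h : ℝ → ℝ} {h' : ℝ} (hh : HasDerivAt h h' (f x))
    (hf : DifferentiableAt ℝ f x) (i : Fin d) :
    pderiv' (fun y => h (f y)) i x = h' * pderiv' f i x := by
  have := (hh.comp_hasFDerivAt x hf.hasFDerivAt).fderiv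
  simp only [Function.comp_def] at this
  simp [pderiv', this]

theorem pderiv'_pow_two (hf : DifferentiableAt ℝ f x) (i : Fin d) :
    pderiv' (fun y => f y ^ 2) i x = 2 * f x * pderiv' f i x := by
  have := pderiv'_comp (h := fun t => t ^ 2) (by simpa using hasDerivAt_pow 2 (f x)) hf i
  simpa using this

theorem pderiv'_coord (i j : Fin d) :
    pderiv' (fun y : EuclideanSpace ℝ (Fin d) => y j) i x = if j = i then 1 else 0 := by
  have : (fun y : EuclideanSpace ℝ (Fin d) => y j) = EuclideanSpace.proj (𝕜 := ℝ) j := by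
    ext y; simp
  rw [this, pderiv', ContinuousLinearMap.fderiv]
  simp [eq_comm]

theorem contDiff_pderiv' (hf : ContDiff ℝ (⊤ : ℕ∞) f) (i : Fin d) :
    ContDiff ℝ (⊤ : ℕ∞) (pderiv' f i) := by
  unfold pderiv'
  exact (hf.fderiv_right (m := (⊤ : ℕ∞)) (by simp)).clm_apply contDiff_const

theorem pderiv'_comm (hf : ContDiff ℝ (⊤ : ℕ∞) f) (i j : Fin d) :
    pderiv' (pderiv' f j) i x = pderiv' (pderiv' f i) j x := by
  have h1 : DifferentiableAt ℝ (fderiv ℝ f) x :=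
    ((hf.fderiv_right (m := (⊤ : ℕ∞)) (by simp)).differentiable (by simp)) x
  have key : ∀ a b : Fin d, pderiv' (pderiv' f a) b x
      = fderiv ℝ (fderiv ℝ f) x (EuclideanSpace.single b 1) (EuclideanSpace.single a 1) := by
    intro a b
    unfold pderiv'
    rw [fderiv_clm_apply h1 (differentiableAt_const _)]
    simp
  rw [key, key]
  exact (hf.contDiffAt.isSymmSndFDerivAt (by simpa using (WithTop.coe_le_coe.2 le_top : ((2 : ℕ∞) : WithTop ℕ∞) ≤ ((⊤ : ℕ∞) : WithTop ℕ∞)))) _ _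

theorem fderiv_eq_sum_pderiv' (v : EuclideanSpace ℝ (Fin d)) :
    fderiv ℝ f x v = ∑ i, v i * pderiv' f i x := by
  have hv : v = ∑ i, v i • EuclideanSpace.single i (1 : ℝ) := by
    ext j; simp [Finset.sum_apply, Pi.single_apply]
  conv_lhs => rw [hv]
  simp [pderiv']

theorem HasCompactSupport.pderiv' (hf : HasCompactSupport f) (i : Fin d) :
    HasCompactSupport (pderiv' f i) :=
  hf.fderiv_apply (𝕜 := ℝ) (EuclideanSpace.single i 1)

theorem integral_pderiv'_eq_zero (hf : ContDiff ℝ 1 f) (hc : HasCompactSupport f) (i : Fin d) :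
    ∫ y, pderiv' f i y = 0 := by
  have hcont : Continuous (_root_.pderiv' f i) := by
    unfold _root_.pderiv'
    exact (hf.continuous_fderiv (by simp)).clm_apply continuous_const
  have := integral_mul_fderiv_eq_neg_fderiv_mul_of_integrable (𝕜 := ℝ) (μ := volume)
    (f := fun _ : EuclideanSpace ℝ (Fin d) => (1 : ℝ)) (g := f)
    (v := EuclideanSpace.single i 1) (by simp)
    (by simp only [one_mul]; exact hcont.integrable_of_hasCompactSupport (hc.pderiv' i))
    (by simpa using hf.continuous.integrable_of_hasCompactSupport hc)
    (fun _ _ => differentiableAt_const _) (fun y _ => hf.differentiable (by simp) y)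
  simpa [_root_.pderiv'] using this

end PartialDerivatives

/-- The divergence of `Y` with respect to the measure with density `π`. -/
def wdiv {d : ℕ} (π : EuclideanSpace ℝ (Fin d) → ℝ) (Y : Fin d → EuclideanSpace ℝ (Fin d) → ℝ)
    (x : EuclideanSpace ℝ (Fin d)) : ℝ :=
  ∑ i, (pderiv' (Y i) i x + Y i x * pderiv' (fun y => Real.log (π y)) i x)

section WeightedDivergence

variable {d : ℕ} {π : EuclideanSpace ℝ (Fin d) → ℝ}

theorem contDiff_log_density (hπ : ContDiff ℝ (⊤ : ℕ∞) π) (hpos : ∀ x, 0 < π x) :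
    ContDiff ℝ (⊤ : ℕ∞) (fun y => Real.log (π y)) :=
  hπ.log fun x => (hpos x).ne'

theorem pderiv'_density (hπ : ContDiff ℝ (⊤ : ℕ∞) π) (hpos : ∀ x, 0 < π x) (i : Fin d)
    (x : EuclideanSpace ℝ (Fin d)) :
    pderiv' π i x = π x * pderiv' (fun y => Real.log (π y)) i x := by
  rw [pderiv'_comp (Real.hasDerivAt_log (hpos x).ne') (hπ.differentiable (by simp) x)]
  have := (hpos x).ne'
  field_simp

theorem integral_wdiv_mul_eq_zero (hπ : ContDiff ℝ (⊤ : ℕ∞) π) (hpos : ∀ x, 0 < π x)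
    {Y : Fin d → EuclideanSpace ℝ (Fin d) → ℝ} (hY : ∀ i, ContDiff ℝ 1 (Y i))
    (hc : ∀ i, HasCompactSupport (Y i)) :
    ∫ x, wdiv π Y x * π x = 0 := by
  have h1 : ∀ i, ContDiff ℝ 1 (fun x => Y i x * π x) := fun i => (hY i).mul (hπ.of_le (by simp))
  have h2 : ∀ i, HasCompactSupport (fun x => Y i x * π x) := fun i => (hc i).mul_right
  have e : (fun x => wdiv π Y x * π x) = fun x => ∑ i, pderiv' (fun y => Y i y * π y) i x := by
    ext x
    rw [wdiv, Finset.sum_mul]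
    refine Finset.sum_congr rfl fun i _ => ?_
    rw [pderiv'_mul ((hY i).differentiable (by simp) x) (hπ.differentiable (by simp) x),
      pderiv'_density hπ hpos]
    ring
  rw [e, integral_finsetSum]
  · exact Finset.sum_eq_zero fun i _ => integral_pderiv'_eq_zero (h1 i) (h2 i) i
  · intro i _
    refine Continuous.integrable_of_hasCompactSupport ?_ ((h2 i).pderiv' i)
    unfold pderiv'
    exact ((h1 i).continuous_fderiv (by simp)).clm_apply continuous_const

end WeightedDivergence

/-! ### Completion of squares for the modified Hessian -/

/-- The modified Hessian of a positive function with value `t`, gradient `w` and Hessian `H`. -/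
def modHess {d : ℕ} (H : Fin d → Fin d → ℝ) (w c : Fin d → ℝ) (t : ℝ) (i j : Fin d) : ℝ :=
  H i j + (1/2 : ℝ) * (∑ k, c k * w k) * (if i = j then 1 else 0)
    - (1/4 : ℝ) * (c i * w j + w i * c j) - w i * w j / t

section ModHess

variable {d : ℕ} (H : Fin d → Fin d → ℝ) (w c : Fin d → ℝ) (t : ℝ)

theorem sum_sum_mul_mul_ite (a b : Fin d → ℝ) :
    ∑ i, ∑ j, a i * b j * (if i = j then (1 : ℝ) else 0) = ∑ i, a i * b i := by
  simp

theorem sum_modHess_mul (a b : Fin d → ℝ) :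
    ∑ i, ∑ j, modHess H w c t i j * (a i * b j) =
      ∑ i, ∑ j, H i j * (a i * b j) + (1/2) * (∑ k, c k * w k) * (∑ i, a i * b i)
      - (1/4) * ((∑ i, c i * a i) * (∑ j, w j * b j) + (∑ i, w i * a i) * (∑ j, c j * b j))
      - (∑ i, w i * a i) * (∑ j, w j * b j) / t := by
  have h : ∀ i j, modHess H w c t i j * (a i * b j) =
      H i j * (a i * b j)
      + ((1/2) * (∑ k, c k * w k)) * (a i * b j * (if i = j then (1 : ℝ) else 0))
      - (1/4) * ((c i * a i) * (w j * b j)) - (1/4) * ((w i * a i) * (c j * b j))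
      - t⁻¹ * ((w i * a i) * (w j * b j)) := by
    intro i j
    unfold modHess
    ring
  simp only [h, Finset.sum_add_distrib, Finset.sum_sub_distrib, ← Finset.mul_sum, ← Finset.sum_mul]
  simp only [sum_sum_mul_mul_ite]
  ring

/-- The square of the norm of the modified Hessian. -/
theorem sum_modHess_sq :
    ∑ i, ∑ j, modHess H w c t i j ^ 2 =
      ∑ i, ∑ j, H i j ^ 2 + (∑ k, c k * w k) * (∑ i, H i i)
      - (1/2) * (∑ i, ∑ j, H i j * (c i * w j) + ∑ i, ∑ j, H i j * (w i * c j))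
      - 2 / t * (∑ i, ∑ j, H i j * (w i * w j)) + (∑ i, w i ^ 2) ^ 2 / t ^ 2
      + ((2 * (d : ℝ) - 3) / 8 * (∑ k, c k * w k) ^ 2
        + (1/8) * (∑ k, c k ^ 2) * (∑ i, w i ^ 2)) := by
  have h : ∀ i j, modHess H w c t i j ^ 2 =
      H i j ^ 2 + (∑ k, c k * w k) * (H i j * (if i = j then (1 : ℝ) else 0))
      - (1/2) * (H i j * (c i * w j)) - (1/2) * (H i j * (w i * c j))
      - (2 / t) * (H i j * (w i * w j))
      + (1/4) * (∑ k, c k * w k) ^ 2 * (if i = j then (1 : ℝ) else 0)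
      - (1/4) * (∑ k, c k * w k) * (c i * w j * (if i = j then (1 : ℝ) else 0))
      - (1/4) * (∑ k, c k * w k) * (w i * c j * (if i = j then (1 : ℝ) else 0))
      - (∑ k, c k * w k) / t * (w i * w j * (if i = j then (1 : ℝ) else 0))
      + (1/16) * (c i ^ 2 * w j ^ 2) + (1/16) * (w i ^ 2 * c j ^ 2)
      + (1/8) * ((c i * w i) * (c j * w j))
      + (1/(2 * t)) * ((c i * w i) * w j ^ 2) + (1/(2 * t)) * (w i ^ 2 * (c j * w j))
      + (1 / t ^ 2) * (w i ^ 2 * w j ^ 2) := by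
    intro i j
    unfold modHess
    split_ifs with hij
    · subst hij; ring
    · ring
  have e : ∑ i : Fin d, ∑ j : Fin d, (if i = j then (1 : ℝ) else 0) = d := by simp
  have e2 : ∑ i : Fin d, ∑ j : Fin d, (H i j * (if i = j then (1 : ℝ) else 0)) = ∑ i, H i i := by
    simp
  simp only [h, Finset.sum_add_distrib, Finset.sum_sub_distrib, ← Finset.mul_sum, ← Finset.sum_mul]
  simp only [sum_sum_mul_mul_ite, e, e2]
  have e3 : ∑ i, w i * c i = ∑ i, c i * w i := by simp only [mul_comm]
  have e4 : ∑ i, w i * w i = ∑ i, w i ^ 2 := by simp only [pow_two]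
  rw [e3, e4]
  ring

end ModHess

/-! ### Pointwise divergence identities -/

section Bochner

variable {d : ℕ} {π : EuclideanSpace ℝ (Fin d) → ℝ}
  {γ : EuclideanSpace ℝ (Fin d) → EuclideanSpace ℝ (Fin d)}
  {v Θ : EuclideanSpace ℝ (Fin d) → ℝ} {x : EuclideanSpace ℝ (Fin d)}

theorem wdiv_add {X Y : Fin d → EuclideanSpace ℝ (Fin d) → ℝ}
    (hX : ∀ i, DifferentiableAt ℝ (X i) x) (hY : ∀ i, DifferentiableAt ℝ (Y i) x) :
    wdiv π (fun i y => X i y + Y i y) x = wdiv π X x + wdiv π Y x := by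
  simp only [wdiv, ← Finset.sum_add_distrib]
  refine Finset.sum_congr rfl fun i _ => ?_
  rw [pderiv'_add (hX i) (hY i)]
  ring

theorem wdiv_mul {f : EuclideanSpace ℝ (Fin d) → ℝ} {X : Fin d → EuclideanSpace ℝ (Fin d) → ℝ}
    (hf : DifferentiableAt ℝ f x) (hX : ∀ i, DifferentiableAt ℝ (X i) x) :
    wdiv π (fun i y => f y * X i y) x = ∑ i, pderiv' f i x * X i x + f x * wdiv π X x := by
  simp only [wdiv, Finset.mul_sum, ← Finset.sum_add_distrib]
  refine Finset.sum_congr rfl fun i _ => ?_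
  rw [pderiv'_mul hf (hX i)]
  ring

theorem wdiv_pderiv' : wdiv π (fun i => pderiv' v i) x = genL π v x := by
  simp only [wdiv, genL, Gamma1, lap, pderiv2, ← Finset.sum_add_distrib]
  exact Finset.sum_congr rfl fun i _ => by ring

theorem wdiv_drift_eq_zero (hπ : ContDiff ℝ (⊤ : ℕ∞) π) (hpos : ∀ x, 0 < π x)
    (hγ : ∀ i, DifferentiableAt ℝ (fun y => γ y i) x)
    (hstat : ∑ i, pderiv' (fun y => π y * γ y i) i x = 0) :
    wdiv π (fun i y => γ y i) x = 0 := by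
  have h : ∑ i, pderiv' (fun y => π y * γ y i) i x = π x * wdiv π (fun i y => γ y i) x := by
    simp only [wdiv, Finset.mul_sum]
    refine Finset.sum_congr rfl fun i _ => ?_
    rw [pderiv'_mul (hπ.differentiable (by simp) x) (hγ i), pderiv'_density hπ hpos]
    ring
  rw [hstat] at h
  exact (mul_eq_zero.mp h.symm).resolve_left (hpos x).ne'

theorem contDiff_Gamma1 {f g : EuclideanSpace ℝ (Fin d) → ℝ} (hf : ContDiff ℝ (⊤ : ℕ∞) f)
    (hg : ContDiff ℝ (⊤ : ℕ∞) g) : ContDiff ℝ (⊤ : ℕ∞) (fun y => Gamma1 f g y) := by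
  unfold Gamma1
  exact ContDiff.sum fun i _ => (contDiff_pderiv' hf i).mul (contDiff_pderiv' hg i)

theorem contDiff_genL (hπ : ContDiff ℝ (⊤ : ℕ∞) π) (hpos : ∀ x, 0 < π x)
    (hv : ContDiff ℝ (⊤ : ℕ∞) v) : ContDiff ℝ (⊤ : ℕ∞) (fun y => genL π v y) := by
  unfold genL lap pderiv2
  exact (contDiff_Gamma1 (contDiff_log_density hπ hpos) hv).add
    (ContDiff.sum fun i _ => contDiff_pderiv' (contDiff_pderiv' hv i) i)

theorem pderiv'_Gamma1_self (hv : ContDiff ℝ (⊤ : ℕ∞) v) (i : Fin d) :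
    pderiv' (fun y => Gamma1 v v y) i x = 2 * ∑ j, pderiv2 v i j x * pderiv' v j x := by
  have hd : ∀ j, DifferentiableAt ℝ (pderiv' v j) x := fun j =>
    (contDiff_pderiv' hv j).differentiable (by simp) x
  unfold Gamma1
  rw [pderiv'_sum fun j _ => (hd j).fun_mul (hd j), Finset.mul_sum]
  refine Finset.sum_congr rfl fun j _ => ?_
  rw [pderiv'_mul (hd j) (hd j), pderiv2]
  ring

theorem pderiv2_comm (hv : ContDiff ℝ (⊤ : ℕ∞) v) (i j : Fin d) :
    pderiv2 v i j x = pderiv2 v j i x :=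
  pderiv'_comm hv i j

theorem contDiff_pderiv2 (hv : ContDiff ℝ (⊤ : ℕ∞) v) (i j : Fin d) :
    ContDiff ℝ (⊤ : ℕ∞) (pderiv2 v i j) :=
  contDiff_pderiv' (contDiff_pderiv' hv j) i

/-- Bochner's formula for the weighted Laplacian. -/
theorem genL_Gamma1_self (hπ : ContDiff ℝ (⊤ : ℕ∞) π) (hpos : ∀ x, 0 < π x)
    (hv : ContDiff ℝ (⊤ : ℕ∞) v) :
    (1/2) * genL π (fun y => Gamma1 v v y) x =
      ∑ i, ∑ j, pderiv2 v i j x ^ 2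
      + ∑ i, pderiv' (fun y => genL π v y) i x * pderiv' v i x
      - ∑ i, ∑ j, pderiv2 (fun y => Real.log (π y)) i j x * (pderiv' v i x * pderiv' v j x) := by
  have hL := contDiff_log_density hπ hpos
  set L := fun y => Real.log (π y) with hLdef
  have hd : ∀ {f : EuclideanSpace ℝ (Fin d) → ℝ}, ContDiff ℝ (⊤ : ℕ∞) f → ∀ y,
      DifferentiableAt ℝ f y := fun h y => h.differentiable (by simp) y
  have e1 : lap (fun y => Gamma1 v v y) x =
      2 * ∑ i, ∑ j, (pderiv' (pderiv2 v i j) i x * pderiv' v j x + pderiv2 v i j x ^ 2) := by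
    unfold lap
    rw [Finset.mul_sum]
    refine Finset.sum_congr rfl fun i _ => ?_
    rw [pderiv2]
    simp only [pderiv'_Gamma1_self hv]
    rw [pderiv'_const_mul (DifferentiableAt.fun_sum fun j _ =>
      (hd (contDiff_pderiv2 hv i j) x).fun_mul (hd (contDiff_pderiv' hv j) x)),
      pderiv'_sum fun j _ => (hd (contDiff_pderiv2 hv i j) x).fun_mul (hd (contDiff_pderiv' hv j) x)]
    congr 1
    refine Finset.sum_congr rfl fun j _ => ?_
    rw [pderiv'_mul (hd (contDiff_pderiv2 hv i j) x) (hd (contDiff_pderiv' hv j) x)]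
    rw [show pderiv' (pderiv' v j) i x = pderiv2 v i j x from rfl]
    ring
  have e2 : ∀ j, pderiv' (fun y => genL π v y) j x =
      ∑ i, (pderiv2 L j i x * pderiv' v i x + pderiv' L i x * pderiv2 v j i x
        + pderiv' (pderiv2 v i j) i x) := by
    intro j
    change pderiv' (fun y => ∑ i, pderiv' L i y * pderiv' v i y + ∑ i, pderiv2 v i i y) j x = _
    rw [pderiv'_add (DifferentiableAt.fun_sum fun i _ =>
      (hd (contDiff_pderiv' hL i) x).fun_mul (hd (contDiff_pderiv' hv i) x))
      (DifferentiableAt.fun_sum fun i _ => hd (contDiff_pderiv2 hv i i) x),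
      pderiv'_sum fun i _ => (hd (contDiff_pderiv' hL i) x).fun_mul (hd (contDiff_pderiv' hv i) x),
      pderiv'_sum fun i _ => hd (contDiff_pderiv2 hv i i) x, ← Finset.sum_add_distrib]
    refine Finset.sum_congr rfl fun i _ => ?_
    rw [pderiv'_mul (hd (contDiff_pderiv' hL i) x) (hd (contDiff_pderiv' hv i) x)]
    have : pderiv' (pderiv2 v i i) j x = pderiv' (pderiv2 v i j) i x := by
      have h1 : pderiv' (pderiv2 v i i) j x = pderiv' (pderiv' (pderiv' v i) j) i x :=
        pderiv'_comm (contDiff_pderiv' hv i) j i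
      rw [h1]
      congr 1
      ext y
      exact pderiv'_comm hv j i
    rw [this]
    rfl
  have e3 : Gamma1 L (fun y => Gamma1 v v y) x =
      2 * ∑ i, ∑ j, pderiv' L i x * (pderiv2 v i j x * pderiv' v j x) := by
    rw [Gamma1, Finset.mul_sum]
    refine Finset.sum_congr rfl fun i _ => ?_
    rw [pderiv'_Gamma1_self hv, ← Finset.mul_sum]
    ring
  rw [genL, e1]
  change (1/2) * (Gamma1 L (fun y => Gamma1 v v y) x + _) = _
  rw [e3]
  simp only [e2, Finset.sum_mul, add_mul, Finset.sum_add_distrib]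
  have c1 : ∑ j, ∑ i, pderiv' L i x * pderiv2 v j i x * pderiv' v j x
      = ∑ i, ∑ j, pderiv' L i x * (pderiv2 v i j x * pderiv' v j x) := by
    rw [Finset.sum_comm]
    refine Finset.sum_congr rfl fun i _ => Finset.sum_congr rfl fun j _ => ?_
    rw [pderiv2_comm hv]; ring
  have c2 : ∑ j, ∑ i, pderiv' (pderiv2 v i j) i x * pderiv' v j x
      = ∑ i, ∑ j, pderiv' (pderiv2 v i j) i x * pderiv' v j x := Finset.sum_comm
  have c3 : ∑ j, ∑ i, pderiv2 L j i x * pderiv' v i x * pderiv' v j x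
      = ∑ i, ∑ j, pderiv2 L i j x * (pderiv' v i x * pderiv' v j x) := by
    refine Finset.sum_congr rfl fun i _ => Finset.sum_congr rfl fun j _ => ?_
    ring
  rw [c1, c2, c3]
  ring

end Bochner

section CutoffIdentities

variable {d : ℕ} {π : EuclideanSpace ℝ (Fin d) → ℝ}
  {γ : EuclideanSpace ℝ (Fin d) → EuclideanSpace ℝ (Fin d)}
  {v Θ : EuclideanSpace ℝ (Fin d) → ℝ}

theorem sum_Rtensor_mul (x : EuclideanSpace ℝ (Fin d)) (w : Fin d → ℝ) :
    ∑ i, ∑ j, Rtensor π γ i j x * w i * w j =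
      -(∑ i, ∑ j, pderiv2 (fun y => Real.log (π y)) i j x * (w i * w j))
      + ((3 - 2 * (d : ℝ)) / 8) * (∑ k, γ x k * w k) ^ 2
      - (1/8) * (∑ k, γ x k ^ 2) * (∑ k, w k ^ 2)
      + (∑ k, γ x k * w k) * (∑ k, pderiv' (fun y => Real.log (π y)) k x * w k) := by
  have h : ∀ i j, Rtensor π γ i j x * w i * w j =
      -(pderiv2 (fun y => Real.log (π y)) i j x * (w i * w j))
      + ((3 - 2 * (d : ℝ)) / 8) * ((γ x i * w i) * (γ x j * w j))
      - ((1/8) * (∑ k, γ x k ^ 2)) * (w i * w j * (if i = j then (1 : ℝ) else 0))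
      + (1/2) * ((γ x i * w i) * (pderiv' (fun y => Real.log (π y)) j x * w j))
      + (1/2) * ((pderiv' (fun y => Real.log (π y)) i x * w i) * (γ x j * w j)) := by
    intro i j
    unfold Rtensor
    split_ifs <;> ring
  simp only [h, Finset.sum_add_distrib, Finset.sum_sub_distrib, Finset.sum_neg_distrib,
    ← Finset.mul_sum, ← Finset.sum_mul]
  simp only [sum_sum_mul_mul_ite]
  have e4 : ∑ i, w i * w i = ∑ i, w i ^ 2 := by simp only [pow_two]
  rw [e4]
  ring

/-- The vector field producing the cutoff version of the curvature identity. -/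
def curvField (π : EuclideanSpace ℝ (Fin d) → ℝ)
    (γ : EuclideanSpace ℝ (Fin d) → EuclideanSpace ℝ (Fin d))
    (v Θ : EuclideanSpace ℝ (Fin d) → ℝ) (q Q : ℝ → ℝ) (i : Fin d)
    (y : EuclideanSpace ℝ (Fin d)) : ℝ :=
  (Θ y * (q (v y) - genL π v y - Gamma1 v v y * (v y)⁻¹)) * pderiv' v i y
    + (1/2 * Θ y) * pderiv' (fun z => Gamma1 v v z) i y
    + (Θ y * (Q (v y) - 1/2 * Gamma1 v v y)) * γ y i

/-- The vector field used to control the fourth power of the gradient. -/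
def quarticField (v Θ : EuclideanSpace ℝ (Fin d) → ℝ) (i : Fin d)
    (y : EuclideanSpace ℝ (Fin d)) : ℝ :=
  (Θ y * (v y * Gamma1 v v y)) * pderiv' v i y

variable {x : EuclideanSpace ℝ (Fin d)} {q Q : ℝ → ℝ} {q' : ℝ}

theorem curvature_identity (hπ : ContDiff ℝ (⊤ : ℕ∞) π) (hpos : ∀ x, 0 < π x)
    (hγ : ContDiff ℝ (⊤ : ℕ∞) γ)
    (hstat : ∀ x, ∑ i, pderiv' (fun y => π y * γ y i) i x = 0)
    (hv : ContDiff ℝ (⊤ : ℕ∞) v) (hΘ : ContDiff ℝ (⊤ : ℕ∞) Θ) (hvx : v x ≠ 0)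
    (hq : HasDerivAt q q' (v x)) (hQ : HasDerivAt Q (q (v x)) (v x)) :
    Θ x * (∑ i, ∑ j, modHess (fun i j => pderiv2 v i j x) (fun i => pderiv' v i x)
        (fun i => γ x i) (v x) i j ^ 2
      + ∑ i, ∑ j, Rtensor π γ i j x * pderiv' v i x * pderiv' v j x) =
    wdiv π (curvField π γ v Θ q Q) x
      + Θ x * (-q' + q (v x) / v x) * ∑ i, pderiv' v i x ^ 2
      + Θ x * (genL π v x - q (v x)) * (genL π v x + ∑ k, γ x k * pderiv' v k x
          + (∑ i, pderiv' v i x ^ 2) / v x)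
      + (genL π v x - q (v x)) * ∑ i, pderiv' v i x * pderiv' Θ i x
      - Q (v x) * ∑ i, γ x i * pderiv' Θ i x
      - ∑ i, ∑ j, modHess (fun i j => pderiv2 v i j x) (fun i => pderiv' v i x)
        (fun i => γ x i) (v x) i j * (pderiv' v i x * pderiv' Θ j x)
      + (1/4) * ((∑ k, γ x k * pderiv' v k x) * (∑ i, pderiv' v i x * pderiv' Θ i x)
        + (∑ i, pderiv' v i x ^ 2) * (∑ i, γ x i * pderiv' Θ i x)) := by
  have hd : ∀ {f : EuclideanSpace ℝ (Fin d) → ℝ}, ContDiff ℝ (⊤ : ℕ∞) f →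
      DifferentiableAt ℝ f x := fun h => h.differentiable (by simp) x
  have hγi : ∀ i, ContDiff ℝ (⊤ : ℕ∞) (fun y => γ y i) := fun i =>
    (EuclideanSpace.proj (𝕜 := ℝ) i).contDiff.comp hγ
  have hG := contDiff_Gamma1 hv hv
  have hℒ := contDiff_genL hπ hpos hv
  have hqd : DifferentiableAt ℝ (fun y => q (v y)) x :=
    hq.differentiableAt.comp x (hd hv)
  have hQd : DifferentiableAt ℝ (fun y => Q (v y)) x :=
    hQ.differentiableAt.comp x (hd hv)
  have hinv : DifferentiableAt ℝ (fun y => (v y)⁻¹) x := (hd hv).inv hvx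
  have hGv : DifferentiableAt ℝ (fun y => Gamma1 v v y * (v y)⁻¹) x := (hd hG).fun_mul hinv
  have hs1 : DifferentiableAt ℝ (fun y => q (v y) - genL π v y - Gamma1 v v y * (v y)⁻¹) x :=
    (hqd.fun_sub (hd hℒ)).fun_sub hGv
  have hs3 : DifferentiableAt ℝ (fun y => Q (v y) - 1/2 * Gamma1 v v y) x :=
    hQd.fun_sub ((hd hG).const_mul _)
  have hw : ∀ i, DifferentiableAt ℝ (pderiv' v i) x := fun i => hd (contDiff_pderiv' hv i)
  have hGi : ∀ i, DifferentiableAt ℝ (pderiv' (fun z => Gamma1 v v z) i) x :=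
    fun i => hd (contDiff_pderiv' hG i)
  -- the derivatives of the scalar factors
  have d1 : ∀ i, pderiv' (fun y => Θ y * (q (v y) - genL π v y - Gamma1 v v y * (v y)⁻¹)) i x =
      pderiv' Θ i x * (q (v x) - genL π v x - Gamma1 v v x * (v x)⁻¹)
      + Θ x * (q' * pderiv' v i x - pderiv' (fun y => genL π v y) i x
        - (pderiv' (fun y => Gamma1 v v y) i x * (v x)⁻¹
          + Gamma1 v v x * (-(v x ^ 2)⁻¹ * pderiv' v i x))) := by
    intro i
    rw [pderiv'_mul (hd hΘ) hs1, pderiv'_sub (hqd.fun_sub (hd hℒ)) hGv, pderiv'_sub hqd (hd hℒ),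
      pderiv'_comp hq (hd hv), pderiv'_mul (hd hG) hinv, pderiv'_comp (hasDerivAt_inv hvx) (hd hv)]
  have d3 : ∀ i, pderiv' (fun y => Θ y * (Q (v y) - 1/2 * Gamma1 v v y)) i x =
      pderiv' Θ i x * (Q (v x) - 1/2 * Gamma1 v v x)
      + Θ x * (q (v x) * pderiv' v i x - 1/2 * pderiv' (fun y => Gamma1 v v y) i x) := by
    intro i
    rw [pderiv'_mul (hd hΘ) hs3, pderiv'_sub hQd ((hd hG).const_mul _), pderiv'_comp hQ (hd hv),
      pderiv'_const_mul (hd hG)]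
  have d2 : ∀ i, pderiv' (fun y => 1/2 * Θ y) i x = 1/2 * pderiv' Θ i x := fun i =>
    pderiv'_const_mul (hd hΘ) _ i
  have hdiv : wdiv π (curvField π γ v Θ q Q) x =
      ∑ i, pderiv' (fun y => Θ y * (q (v y) - genL π v y - Gamma1 v v y * (v y)⁻¹)) i x
          * pderiv' v i x
        + Θ x * (q (v x) - genL π v x - Gamma1 v v x * (v x)⁻¹) * genL π v x
      + (∑ i, pderiv' (fun y => 1/2 * Θ y) i x * pderiv' (fun z => Gamma1 v v z) i x
        + 1/2 * Θ x * genL π (fun z => Gamma1 v v z) x)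
      + ∑ i, pderiv' (fun y => Θ y * (Q (v y) - 1/2 * Gamma1 v v y)) i x * γ x i := by
    unfold curvField
    rw [wdiv_add (fun i => (((hd hΘ).fun_mul hs1).fun_mul (hw i)).fun_add
        (((hd hΘ).const_mul (1/2)).fun_mul (hGi i)))
        (fun i => ((hd hΘ).fun_mul hs3).fun_mul (hd (hγi i))),
      wdiv_add (fun i => ((hd hΘ).fun_mul hs1).fun_mul (hw i))
        (fun i => ((hd hΘ).const_mul (1/2)).fun_mul (hGi i)),
      wdiv_mul ((hd hΘ).fun_mul hs1) hw, wdiv_mul ((hd hΘ).const_mul (1/2)) hGi,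
      wdiv_mul ((hd hΘ).fun_mul hs3) (fun i => hd (hγi i)), wdiv_pderiv', wdiv_pderiv',
      wdiv_drift_eq_zero hπ hpos (fun i => hd (hγi i)) (hstat x)]
    ring
  rw [hdiv, mul_assoc (1/2 : ℝ) (Θ x), mul_left_comm (1/2 : ℝ) (Θ x),
    genL_Gamma1_self hπ hpos hv]
  simp only [d1, d2, d3]
  rw [sum_modHess_sq, sum_modHess_mul, sum_Rtensor_mul]
  have eW : Gamma1 v v x = ∑ i, pderiv' v i x ^ 2 := by
    simp only [Gamma1, pow_two]
  have eww : ∑ i, pderiv' v i x * pderiv' v i x = ∑ i, pderiv' v i x ^ 2 := by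
    simp only [pow_two]
  have eH : ∀ a : Fin d → ℝ, ∑ i, a i * pderiv' (fun y => Gamma1 v v y) i x =
      2 * ∑ i, ∑ j, pderiv2 v i j x * (pderiv' v i x * a j) := by
    intro a
    rw [Finset.sum_comm, Finset.mul_sum]
    refine Finset.sum_congr rfl fun i _ => ?_
    rw [pderiv'_Gamma1_self hv, Finset.mul_sum, Finset.mul_sum, Finset.mul_sum]
    refine Finset.sum_congr rfl fun j _ => ?_
    rw [pderiv2_comm hv i j]; ring
  have s1 : ∑ i, (pderiv' Θ i x * (q (v x) - genL π v x - Gamma1 v v x * (v x)⁻¹)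
      + Θ x * (q' * pderiv' v i x - pderiv' (fun y => genL π v y) i x
        - (pderiv' (fun y => Gamma1 v v y) i x * (v x)⁻¹
          + Gamma1 v v x * (-(v x ^ 2)⁻¹ * pderiv' v i x)))) * pderiv' v i x =
      (q (v x) - genL π v x - Gamma1 v v x * (v x)⁻¹) * ∑ i, pderiv' v i x * pderiv' Θ i x
      + Θ x * ((q' + Gamma1 v v x * (v x ^ 2)⁻¹) * ∑ i, pderiv' v i x ^ 2
        - ∑ i, pderiv' (fun y => genL π v y) i x * pderiv' v i x
        - (v x)⁻¹ * ∑ i, pderiv' v i x * pderiv' (fun y => Gamma1 v v y) i x) := by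
    simp only [Finset.mul_sum, ← Finset.sum_add_distrib, ← Finset.sum_sub_distrib]
    exact Finset.sum_congr rfl fun i _ => by ring
  have s2 : ∑ i, 1/2 * pderiv' Θ i x * pderiv' (fun z => Gamma1 v v z) i x =
      1/2 * ∑ i, pderiv' Θ i x * pderiv' (fun z => Gamma1 v v z) i x := by
    simp only [Finset.mul_sum]
    exact Finset.sum_congr rfl fun i _ => by ring
  have s3 : ∑ i, (pderiv' Θ i x * (Q (v x) - 1/2 * Gamma1 v v x)
      + Θ x * (q (v x) * pderiv' v i x - 1/2 * pderiv' (fun y => Gamma1 v v y) i x)) * γ x i =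
      (Q (v x) - 1/2 * Gamma1 v v x) * ∑ i, γ x i * pderiv' Θ i x
      + Θ x * (q (v x) * ∑ i, γ x i * pderiv' v i x
        - 1/2 * ∑ i, γ x i * pderiv' (fun y => Gamma1 v v y) i x) := by
    simp only [Finset.mul_sum, ← Finset.sum_add_distrib, ← Finset.sum_sub_distrib]
    exact Finset.sum_congr rfl fun i _ => by ring
  have eHs : ∑ i, ∑ j, pderiv2 v i j x * (γ x i * pderiv' v j x) =
      ∑ i, ∑ j, pderiv2 v i j x * (pderiv' v i x * γ x j) := by
    rw [Finset.sum_comm]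
    refine Finset.sum_congr rfl fun i _ => Finset.sum_congr rfl fun j _ => ?_
    rw [pderiv2_comm hv]; ring
  have eL : genL π v x = ∑ i, pderiv' (fun y => Real.log (π y)) i x * pderiv' v i x
      + ∑ i, pderiv2 v i i x := rfl
  have etr : ∑ i, pderiv2 v i i x = genL π v x
      - ∑ i, pderiv' (fun y => Real.log (π y)) i x * pderiv' v i x := by rw [eL]; ring
  rw [s1, s2, s3, eH, eH, eH, eHs, eW, etr, eww]
  field_simp
  ring

theorem quartic_identity (hv : ContDiff ℝ (⊤ : ℕ∞) v) (hΘ : ContDiff ℝ (⊤ : ℕ∞) Θ)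
    (hvx : v x ≠ 0) :
    3 * Θ x * (∑ i, pderiv' v i x ^ 2) ^ 2 =
      wdiv π (quarticField v Θ) x
      - v x * (Θ x * genL π v x * (∑ i, pderiv' v i x ^ 2)
        + 2 * Θ x * ∑ i, ∑ j, modHess (fun i j => pderiv2 v i j x) (fun i => pderiv' v i x)
          (fun i => γ x i) (v x) i j * (pderiv' v i x * pderiv' v j x)
        + (∑ i, pderiv' v i x ^ 2) * ∑ i, pderiv' v i x * pderiv' Θ i x) := by
  have hd : ∀ {f : EuclideanSpace ℝ (Fin d) → ℝ}, ContDiff ℝ (⊤ : ℕ∞) f →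
      DifferentiableAt ℝ f x := fun h => h.differentiable (by simp) x
  have hG := contDiff_Gamma1 hv hv
  have hvG : DifferentiableAt ℝ (fun y => v y * Gamma1 v v y) x := (hd hv).fun_mul (hd hG)
  have hw : ∀ i, DifferentiableAt ℝ (pderiv' v i) x := fun i => hd (contDiff_pderiv' hv i)
  unfold quarticField
  rw [wdiv_mul ((hd hΘ).fun_mul hvG) hw, wdiv_pderiv', sum_modHess_mul]
  have eW : Gamma1 v v x = ∑ i, pderiv' v i x ^ 2 := by
    simp only [Gamma1, pow_two]
  have eww : ∑ i, pderiv' v i x * pderiv' v i x = ∑ i, pderiv' v i x ^ 2 := by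
    simp only [pow_two]
  have s : ∑ i, pderiv' (fun y => Θ y * (v y * Gamma1 v v y)) i x * pderiv' v i x =
      v x * Gamma1 v v x * ∑ i, pderiv' v i x * pderiv' Θ i x
      + Θ x * (Gamma1 v v x * ∑ i, pderiv' v i x ^ 2
        + v x * (2 * ∑ i, ∑ j, pderiv2 v i j x * (pderiv' v i x * pderiv' v j x))) := by
    have eH : 2 * ∑ i, ∑ j, pderiv2 v i j x * (pderiv' v i x * pderiv' v j x) =
        ∑ i, pderiv' (fun y => Gamma1 v v y) i x * pderiv' v i x := by
      rw [Finset.mul_sum]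
      refine Finset.sum_congr rfl fun i _ => ?_
      rw [pderiv'_Gamma1_self hv, Finset.mul_sum, Finset.mul_sum, Finset.sum_mul]
      exact Finset.sum_congr rfl fun j _ => by ring
    rw [eH]
    simp only [Finset.mul_sum, ← Finset.sum_add_distrib]
    refine Finset.sum_congr rfl fun i _ => ?_
    rw [pderiv'_mul (hd hΘ) hvG, pderiv'_mul (hd hv) (hd hG)]
    ring
  rw [s, eW, eww]
  field_simp
  ring

end CutoffIdentities

/-! ### Gradient estimate with cutoff -/

/-- Absorption of the error terms in the cutoff curvature identity. -/
theorem young_absorb {b y G ρ η m M C₀ A D : ℝ} (hy : 0 ≤ y) (hρ : 0 ≤ ρ) (hη : 0 < η) (hη8 : η ≤ 1/8)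
    (hm : 0 < m) (hηM : 8 * η * M ^ 2 ≤ 1) (hηM' : 16 * M * η ^ 2 ≤ 1)
    (hC : 0 ≤ C₀)
    (h : b ^ 2 + 3 * η * y ^ 4 + A ≤ D + ρ * C₀ + ρ ^ 2 + ρ * G * y + ρ * y ^ 2 / m
      + 4 * η ^ 2 * ρ * y + 4 * η ^ 2 * C₀ * G + 4 * η ^ 2 * b * y + 2 * η ^ 2 * G * y ^ 2
      + η * M * ((C₀ + ρ) * y ^ 2 + 2 * b * y ^ 2 + 4 * η ^ 2 * y ^ 3)) :
    A ≤ D + (3 + 2 * C₀ + M ^ 2 * C₀ ^ 2 + 1 / m ^ 2 + M ^ 2) *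
      (η + η * G ^ 2 + ρ + ρ ^ 2 * (1 + G ^ 2) / η) := by
  have hy2 : y ^ 2 ≤ (y ^ 4 + 1) / 2 := by nlinarith [sq_nonneg (y ^ 2 - 1)]
  have hy3 : y ^ 3 ≤ y ^ 4 + 1 := by nlinarith [sq_nonneg (y ^ 2 - y / 2), sq_nonneg (y - 1)]
  have hy4 : 0 ≤ y ^ 4 := by positivity
  have hb2 : 0 ≤ b ^ 2 := sq_nonneg b
  set X := ρ ^ 2 / η with hX
  have hX0 : 0 ≤ X := by positivity
  have hρX : ρ ^ 2 = X * η := by rw [hX]; field_simp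
  have hρX' : ρ ^ 2 ≤ X := by 
    rw [hρX]
    have := mul_le_mul_of_nonneg_left (hη8.trans (by norm_num : (1/8 : ℝ) ≤ 1)) hX0
    linarith
  have hG2 : 0 ≤ G ^ 2 := sq_nonneg G
  have hηy2 : η * y ^ 2 ≤ η * ((y ^ 4 + 1) / 2) := mul_le_mul_of_nonneg_left hy2 hη.le
  have hηρ : ρ ^ 2 * η ≤ X := by
    have := mul_le_mul_of_nonneg_left (hη8.trans (by norm_num : (1/8 : ℝ) ≤ 1)) (sq_nonneg ρ)
    linarith
  have hη2 : η ^ 2 ≤ η / 8 := by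
    have := mul_le_mul_of_nonneg_left hη8 hη.le
    linarith
  have t3 : ρ * G * y ≤ X * G ^ 2 + η / 8 * (y ^ 4 + 1) := by
    have : X * G ^ 2 + η / 4 * y ^ 2 - ρ * G * y = (ρ * G - η / 2 * y) ^ 2 / η := by
      rw [hX]; field_simp; ring
    have : 0 ≤ (ρ * G - η / 2 * y) ^ 2 / η := by positivity
    linarith
  have t4 : ρ * y ^ 2 / m ≤ X * (1 / m ^ 2) + η / 4 * y ^ 4 := by
    have : X * (1 / m ^ 2) + η / 4 * y ^ 4 - ρ * y ^ 2 / m = (ρ / m - η / 2 * y ^ 2) ^ 2 / η := by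
      rw [hX]; field_simp; ring
    have : 0 ≤ (ρ / m - η / 2 * y ^ 2) ^ 2 / η := by positivity
    linarith
  have t5 : 4 * η ^ 2 * ρ * y ≤ X + η / 8 * (y ^ 4 + 1) := by
    have h1 : 4 * η ^ 2 * ρ * y ≤ 2 * η ^ 2 * (ρ ^ 2 + y ^ 2) := by
      linarith [mul_nonneg (sq_nonneg η) (sq_nonneg (ρ - y))]
    have h2 : 2 * η ^ 2 ≤ η / 4 := by linarith
    have h3 : 2 * η ^ 2 * (ρ ^ 2 + y ^ 2) ≤ η / 4 * (ρ ^ 2 + y ^ 2) :=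
      mul_le_mul_of_nonneg_right h2 (by positivity)
    linarith
  have t6 : 4 * η ^ 2 * C₀ * G ≤ 2 * C₀ * (η + η * G ^ 2) := by
    have h1 : η ^ 2 ≤ η := by linarith
    have h2 : 2 * G ≤ 1 + G ^ 2 := by nlinarith [sq_nonneg (G - 1)]
    have h3 : 2 * η ^ 2 * C₀ * (2 * G) ≤ 2 * η ^ 2 * C₀ * (1 + G ^ 2) :=
      mul_le_mul_of_nonneg_left h2 (by positivity)
    have h4 : η ^ 2 * (2 * C₀ * (1 + G ^ 2)) ≤ η * (2 * C₀ * (1 + G ^ 2)) :=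
      mul_le_mul_of_nonneg_right h1 (by positivity)
    linarith
  have t7 : 4 * η ^ 2 * b * y ≤ b ^ 2 / 4 + η / 8 * (y ^ 4 + 1) := by
    have h1 : 4 * η ^ 2 * b * y ≤ b ^ 2 / 4 + 16 * η ^ 4 * y ^ 2 := by
      linarith [sq_nonneg (b / 2 - 4 * η ^ 2 * y)]
    have h2 : 16 * η ^ 4 ≤ η / 4 := by
      have : η ^ 3 ≤ (1/8 : ℝ) ^ 3 := pow_le_pow_left₀ hη.le hη8 3
      have := mul_le_mul_of_nonneg_left this hη.le
      linarith
    have h3 : 16 * η ^ 4 * y ^ 2 ≤ η / 4 * y ^ 2 := mul_le_mul_of_nonneg_right h2 (by positivity)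
    linarith
  have t8 : 2 * η ^ 2 * G * y ^ 2 ≤ η * G ^ 2 + η / 8 * y ^ 4 := by
    have h1 : 2 * η ^ 2 * G * y ^ 2 ≤ η ^ 2 * (G ^ 2 + y ^ 4) := by
      linarith [sq_nonneg (η * (G - y ^ 2))]
    have h3 : η ^ 2 * (G ^ 2 + y ^ 4) ≤ η / 8 * (G ^ 2 + y ^ 4) :=
      mul_le_mul_of_nonneg_right hη2 (by positivity)
    linarith [mul_nonneg hη.le hG2]
  have t9 : η * M * (C₀ * y ^ 2) ≤ η / 4 * y ^ 4 + M ^ 2 * C₀ ^ 2 * η := by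
    linarith [mul_nonneg hη.le (sq_nonneg (y ^ 2 / 2 - M * C₀))]
  have t10 : η * M * (ρ * y ^ 2) ≤ η / 4 * y ^ 4 + M ^ 2 * X := by
    have h1 : η * M * (ρ * y ^ 2) ≤ η / 4 * y ^ 4 + M ^ 2 * (ρ ^ 2 * η) := by
      linarith [mul_nonneg hη.le (sq_nonneg (y ^ 2 / 2 - M * ρ))]
    have := mul_le_mul_of_nonneg_left hηρ (sq_nonneg M)
    linarith
  have t11 : η * M * (2 * b * y ^ 2) ≤ b ^ 2 / 2 + η / 4 * y ^ 4 := by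
    have h1 : η * M * (2 * b * y ^ 2) ≤ b ^ 2 / 2 + 2 * η ^ 2 * M ^ 2 * y ^ 4 := by
      linarith [sq_nonneg (b - 2 * η * M * y ^ 2)]
    have h2 : 2 * η ^ 2 * M ^ 2 ≤ η / 4 := by
      have := mul_le_mul_of_nonneg_left hηM hη.le
      linarith
    have := mul_le_mul_of_nonneg_right h2 hy4
    linarith
  have t12 : η * M * (4 * η ^ 2 * y ^ 3) ≤ η / 4 * (y ^ 4 + 1) := by
    have h2 : 4 * M * η ^ 3 ≤ η / 4 := by
      have := mul_le_mul_of_nonneg_left hηM' hη.le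
      linarith
    have h3 : η * M * (4 * η ^ 2 * y ^ 3) = 4 * M * η ^ 3 * y ^ 3 := by ring
    have h4 : 4 * M * η ^ 3 * y ^ 3 ≤ η / 4 * y ^ 3 := mul_le_mul_of_nonneg_right h2 (by positivity)
    have h5 := mul_le_mul_of_nonneg_left hy3 hη.le
    linarith
  have hXG : ρ ^ 2 * (1 + G ^ 2) / η = X + X * G ^ 2 := by rw [hX]; ring
  rw [hXG]
  have c1 : 0 ≤ M ^ 2 * C₀ ^ 2 := by positivity
  have c2 : 0 ≤ 1 / m ^ 2 := by positivity
  have c3 : 0 ≤ M ^ 2 := by positivity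
  have e : (3 + 2 * C₀ + M ^ 2 * C₀ ^ 2 + 1 / m ^ 2 + M ^ 2) *
      (η + η * G ^ 2 + ρ + (X + X * G ^ 2)) =
      3 * η + 3 * (η * G ^ 2) + 3 * ρ + 3 * X + 3 * (X * G ^ 2)
      + 2 * C₀ * (η + η * G ^ 2) + 2 * (ρ * C₀) + 2 * C₀ * (X + X * G ^ 2)
      + M ^ 2 * C₀ ^ 2 * η + M ^ 2 * C₀ ^ 2 * (η * G ^ 2 + ρ + (X + X * G ^ 2))
      + X * (1 / m ^ 2) + 1 / m ^ 2 * (η + η * G ^ 2 + ρ + X * G ^ 2)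
      + M ^ 2 * X + M ^ 2 * (η + η * G ^ 2 + ρ + X * G ^ 2) := by ring
  have p1 : 0 ≤ η * G ^ 2 := by positivity
  have p2 : 0 ≤ X * G ^ 2 := by positivity
  have p3 : 0 ≤ 2 * C₀ * (X + X * G ^ 2) := by positivity
  have p4 : 0 ≤ M ^ 2 * C₀ ^ 2 * (η * G ^ 2 + ρ + (X + X * G ^ 2)) := by positivity
  have p5 : 0 ≤ 1 / m ^ 2 * (η + η * G ^ 2 + ρ + X * G ^ 2) := by positivity
  have p6 : 0 ≤ M ^ 2 * (η + η * G ^ 2 + ρ + X * G ^ 2) := by positivity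
  have p7 : 0 ≤ ρ * C₀ := by positivity
  have hηy : 0 ≤ η * y ^ 4 := by positivity
  rw [e]
  linarith

section PointwiseGradient

variable {d : ℕ}

theorem abs_sum_mul_le_sqrt (a b : Fin d → ℝ) :
    |∑ i, a i * b i| ≤ √(∑ i, a i ^ 2) * √(∑ i, b i ^ 2) := by
  rw [← Real.sqrt_mul (Finset.sum_nonneg fun i _ => sq_nonneg _)]
  exact Real.abs_le_sqrt (Finset.sum_mul_sq_le_sq_mul_sq _ _ _)

theorem abs_sum_sum_mul_le_sqrt (B : Fin d → Fin d → ℝ) (a b : Fin d → ℝ) :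
    |∑ i, ∑ j, B i j * (a i * b j)| ≤
      √(∑ i, ∑ j, B i j ^ 2) * (√(∑ i, a i ^ 2) * √(∑ i, b i ^ 2)) := by
  rw [← Real.sqrt_mul (Finset.sum_nonneg fun i _ => sq_nonneg _),
    ← Real.sqrt_mul (Finset.sum_nonneg fun i _ => Finset.sum_nonneg fun j _ => sq_nonneg _)]
  apply Real.abs_le_sqrt
  have := Finset.sum_mul_sq_le_sq_mul_sq (Finset.univ ×ˢ Finset.univ)
    (fun p : Fin d × Fin d => B p.1 p.2) (fun p => a p.1 * b p.2)
  simp only [Finset.sum_product, mul_pow] at this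
  rwa [Finset.sum_mul_sum]

/-- The scalar estimate behind the cutoff gradient bound. -/
theorem cutoff_scalar_bound {z nw nB G nt Bwt Bww wt ct cw R D₁ D₂ r k κ lam s qs Qs m M C₀ η : ℝ}
    (hm : 0 < m) (hsm : m ≤ s) (hsM : s ≤ M) (hk : k ≤ κ) (hqC : |qs| ≤ C₀) (hQC : |Qs| ≤ C₀)
    (hη : 0 < η) (hz0 : 0 ≤ z) (hz1 : z ≤ 1) (hnt : nt ≤ η ^ 2)
    (n1 : 0 ≤ nw) (n2 : 0 ≤ nB) (n3 : 0 ≤ G)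
    (bwt : |wt| ≤ nw * nt) (bct : |ct| ≤ G * nt) (bcw : |cw| ≤ G * nw)
    (bBwt : |Bwt| ≤ nB * (nw * nt)) (bBww : |Bww| ≤ nB * (nw * nw))
    (h1 : z ^ 4 * (nB ^ 2 + R) = D₁ + z ^ 4 * k * nw ^ 2 + z ^ 4 * r * (qs + r + cw + nw ^ 2 / s)
      + r * (4 * z ^ 3 * wt) - Qs * (4 * z ^ 3 * ct) - 4 * z ^ 3 * Bwt
      + 1 / 4 * (cw * (4 * z ^ 3 * wt) + nw ^ 2 * (4 * z ^ 3 * ct)))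
    (h2 : 3 * z ^ 4 * (nw ^ 2) ^ 2 = D₂ - s * (z ^ 4 * (qs + r) * nw ^ 2 + 2 * z ^ 4 * Bww
      + nw ^ 2 * (4 * z ^ 3 * wt)))
    (h3 : lam * nw ^ 2 ≤ R) :
    (z ^ 2 * nB) ^ 2 + 3 * η * (z * nw) ^ 4 + (lam - κ) * (z ^ 4 * nw ^ 2) ≤
      (D₁ + η * D₂) + |r| * C₀ + |r| ^ 2 + |r| * G * (z * nw) + |r| * (z * nw) ^ 2 / m
      + 4 * η ^ 2 * |r| * (z * nw) + 4 * η ^ 2 * C₀ * G + 4 * η ^ 2 * (z ^ 2 * nB) * (z * nw)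
      + 2 * η ^ 2 * G * (z * nw) ^ 2
      + η * M * ((C₀ + |r|) * (z * nw) ^ 2 + 2 * (z ^ 2 * nB) * (z * nw) ^ 2
        + 4 * η ^ 2 * (z * nw) ^ 3) := by
  have hs : 0 < s := hm.trans_le hsm
  have hM : 0 ≤ M := hs.le.trans hsM
  have hC : 0 ≤ C₀ := (abs_nonneg _).trans hqC
  have hr := abs_nonneg r
  have z2 : z ^ 2 ≤ 1 := pow_le_one₀ hz0 hz1
  have z3 : z ^ 3 ≤ 1 := pow_le_one₀ hz0 hz1
  have z4 : z ^ 4 ≤ 1 := pow_le_one₀ hz0 hz1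
  have z41 : z ^ 4 ≤ z := by simpa using pow_le_pow_of_le_one hz0 hz1 (show 1 ≤ 4 by norm_num)
  have z42 : z ^ 4 ≤ z ^ 2 := pow_le_pow_of_le_one hz0 hz1 (by norm_num)
  have z31 : z ^ 3 ≤ z := by simpa using pow_le_pow_of_le_one hz0 hz1 (show 1 ≤ 3 by norm_num)
  have z32 : z ^ 3 ≤ z ^ 2 := pow_le_pow_of_le_one hz0 hz1 (by norm_num)
  have bwt' : |wt| ≤ nw * η ^ 2 := bwt.trans (mul_le_mul_of_nonneg_left hnt n1)
  have bct' : |ct| ≤ G * η ^ 2 := bct.trans (mul_le_mul_of_nonneg_left hnt n3)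
  have bBwt' : |Bwt| ≤ nB * (nw * η ^ 2) := bBwt.trans (by gcongr)
  -- a product of a power of the cutoff with a bounded quantity
  have key : ∀ {p p' a X : ℝ}, 0 ≤ p → p ≤ p' → |a| ≤ X → p * a ≤ p' * X := fun hp hpp ha =>
    (mul_le_mul_of_nonneg_left ((le_abs_self _).trans ha) hp).trans
      (mul_le_mul_of_nonneg_right hpp ((abs_nonneg _).trans ha))
  have e1 : z ^ 4 * k * nw ^ 2 ≤ κ * (z ^ 4 * nw ^ 2) := by
    have := mul_le_mul_of_nonneg_right hk (show 0 ≤ z ^ 4 * nw ^ 2 by positivity)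
    linarith
  have e2 : z ^ 4 * (r * qs) ≤ 1 * (|r| * C₀) :=
    key (by positivity) z4 (by rw [abs_mul]; gcongr)
  have e3 : z ^ 4 * (r * r) ≤ 1 * (|r| * |r|) := key (by positivity) z4 (by rw [abs_mul])
  have e4 : z ^ 4 * (r * cw) ≤ z * (|r| * (G * nw)) :=
    key (by positivity) z41 (by rw [abs_mul]; gcongr)
  have e5 : z ^ 4 * (r * (nw ^ 2 / s)) ≤ z ^ 2 * (|r| * (nw ^ 2 / m)) :=
    key (by positivity) z42 (by rw [abs_mul, abs_of_nonneg (by positivity : 0 ≤ nw ^ 2 / s)]; gcongr)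
  have e6 : z ^ 3 * (r * wt) ≤ z * (|r| * (nw * η ^ 2)) :=
    key (by positivity) z31 (by rw [abs_mul]; gcongr)
  have e7 : z ^ 3 * (-(Qs * ct)) ≤ 1 * (C₀ * (G * η ^ 2)) :=
    key (by positivity) z3 (by rw [abs_neg, abs_mul]; gcongr)
  have e8 : z ^ 3 * (-Bwt) ≤ z ^ 3 * (nB * (nw * η ^ 2)) :=
    key (by positivity) le_rfl (by rwa [abs_neg])
  have e9 : z ^ 3 * (cw * wt) ≤ z ^ 2 * ((G * nw) * (nw * η ^ 2)) :=
    key (by positivity) z32 (by rw [abs_mul]; gcongr)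
  have e10 : z ^ 3 * (nw ^ 2 * ct) ≤ z ^ 2 * (nw ^ 2 * (G * η ^ 2)) :=
    key (by positivity) z32 (by rw [abs_mul, abs_of_nonneg (sq_nonneg nw)]; gcongr)
  have e11 : s * z ^ 4 * (-((qs + r) * nw ^ 2)) ≤ M * z ^ 2 * ((C₀ + |r|) * nw ^ 2) :=
    key (by positivity) (by gcongr) (by
      rw [abs_neg, abs_mul, abs_of_nonneg (sq_nonneg nw)]
      have := (abs_add_le qs r).trans (add_le_add_left hqC |r|)
      gcongr)
  have e12 : s * z ^ 4 * (-Bww) ≤ M * z ^ 4 * (nB * (nw * nw)) :=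
    key (by positivity) (by gcongr) (by rwa [abs_neg])
  have e13 : s * z ^ 3 * (-(nw ^ 2 * wt)) ≤ M * z ^ 3 * (nw ^ 2 * (nw * η ^ 2)) :=
    key (by positivity) (by gcongr) (by
      rw [abs_neg, abs_mul, abs_of_nonneg (sq_nonneg nw)]; gcongr)
  have e14 := mul_le_mul_of_nonneg_left h3 (show 0 ≤ z ^ 4 by positivity)
  have e15 := mul_le_mul_of_nonneg_left e11 hη.le
  have e16 := mul_le_mul_of_nonneg_left e12 hη.le
  have e17 := mul_le_mul_of_nonneg_left e13 hη.le
  have h2' : η * (3 * z ^ 4 * (nw ^ 2) ^ 2) = η * D₂ + η * (s * z ^ 4 * (-((qs + r) * nw ^ 2)))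
      + 2 * (η * (s * z ^ 4 * (-Bww))) + 4 * (η * (s * z ^ 3 * (-(nw ^ 2 * wt)))) := by
    rw [h2]; ring
  have h1' : z ^ 4 * nB ^ 2 + z ^ 4 * R = D₁ + z ^ 4 * k * nw ^ 2 + z ^ 4 * (r * qs)
      + z ^ 4 * (r * r) + z ^ 4 * (r * cw) + z ^ 4 * (r * (nw ^ 2 / s)) + 4 * (z ^ 3 * (r * wt))
      + 4 * (z ^ 3 * (-(Qs * ct))) + 4 * (z ^ 3 * (-Bwt)) + z ^ 3 * (cw * wt)
      + z ^ 3 * (nw ^ 2 * ct) := by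
    rw [← mul_add, h1]; ring
  have f5 : |r| * (z * nw) ^ 2 / m = z ^ 2 * (|r| * (nw ^ 2 / m)) := by ring
  rw [f5]
  linarith

variable {π : EuclideanSpace ℝ (Fin d) → ℝ}
  {γ : EuclideanSpace ℝ (Fin d) → EuclideanSpace ℝ (Fin d)}
  {v ζ : EuclideanSpace ℝ (Fin d) → ℝ} {x : EuclideanSpace ℝ (Fin d)} {q Q : ℝ → ℝ}

theorem cutoff_gradient_pointwise (hπ : ContDiff ℝ (⊤ : ℕ∞) π) (hpos : ∀ x, 0 < π x)
    (hγ : ContDiff ℝ (⊤ : ℕ∞) γ)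
    (hstat : ∀ x, ∑ i, pderiv' (fun y => π y * γ y i) i x = 0)
    {lam κ : ℝ} (hcond : ∀ (x v : EuclideanSpace ℝ (Fin d)),
      lam * ‖v‖ ^ 2 ≤ ∑ i, ∑ j, Rtensor π γ i j x * v i * v j)
    (hv : ContDiff ℝ (⊤ : ℕ∞) v) (hζ : ContDiff ℝ (⊤ : ℕ∞) ζ) {q' m M C₀ η : ℝ}
    (hm : 0 < m) (hvm : m ≤ v x) (hvM : v x ≤ M)
    (hq : HasDerivAt q q' (v x)) (hQ : HasDerivAt Q (q (v x)) (v x))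
    (hκ : -q' + q (v x) / v x ≤ κ) (hqC : |q (v x)| ≤ C₀) (hQC : |Q (v x)| ≤ C₀)
    (hη : 0 < η) (hη8 : η ≤ 1/8) (hηM : 8 * η * M ^ 2 ≤ 1) (hηM' : 16 * M * η ^ 2 ≤ 1)
    (hζ0 : 0 ≤ ζ x) (hζ1 : ζ x ≤ 1) (hgrad : √(∑ i, pderiv' ζ i x ^ 2) ≤ η ^ 2) :
    (lam - κ) * (ζ x ^ 4 * ∑ i, pderiv' v i x ^ 2) ≤
      (wdiv π (curvField π γ v (fun y => ζ y ^ 4) q Q) x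
        + η * wdiv π (quarticField v (fun y => ζ y ^ 4)) x)
      + (3 + 2 * C₀ + M ^ 2 * C₀ ^ 2 + 1 / m ^ 2 + M ^ 2) *
        (η + η * (√(∑ k, γ x k ^ 2)) ^ 2 + |genL π v x - q (v x)|
          + |genL π v x - q (v x)| ^ 2 * (1 + (√(∑ k, γ x k ^ 2)) ^ 2) / η) := by
  have hvx : 0 < v x := hm.trans_le hvm
  have hM : 0 ≤ M := hvx.le.trans hvM
  have hC : 0 ≤ C₀ := (abs_nonneg _).trans hqC
  have hΘ : ContDiff ℝ (⊤ : ℕ∞) (fun y => ζ y ^ 4) := hζ.pow 4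
  have hdΘ : ∀ i, pderiv' (fun y => ζ y ^ 4) i x = 4 * ζ x ^ 3 * pderiv' ζ i x := fun i => by
    rw [pderiv'_comp (h := fun t => t ^ 4) (by simpa using hasDerivAt_pow 4 (ζ x))
      (hζ.differentiable (by simp) x)]
  have h1 := curvature_identity (Θ := fun y => ζ y ^ 4) hπ hpos hγ hstat hv hΘ hvx.ne' hq hQ
  have h2 := quartic_identity (Θ := fun y => ζ y ^ 4) (π := π) (γ := γ) hv hΘ hvx.ne'
  have h3 := hcond x (WithLp.toLp 2 fun i => pderiv' v i x)
  have hn : ‖(WithLp.toLp 2 fun i => pderiv' v i x : EuclideanSpace ℝ (Fin d))‖ ^ 2 =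
      ∑ i, pderiv' v i x ^ 2 := by
    rw [EuclideanSpace.norm_sq_eq]; simp
  rw [hn] at h3
  simp only [hdΘ] at h1 h2
  set B : Fin d → Fin d → ℝ := modHess (fun i j => pderiv2 v i j x) (fun i => pderiv' v i x)
        (fun i => γ x i) (v x) with hB
  set w : Fin d → ℝ := fun i => pderiv' v i x with hw
  set t : Fin d → ℝ := fun i => pderiv' ζ i x with ht
  set c : Fin d → ℝ := fun i => γ x i with hc
  set R := ∑ i, ∑ j, Rtensor π γ i j x * pderiv' v i x * pderiv' v j x with hR
  set D₁ := wdiv π (curvField π γ v (fun y => ζ y ^ 4) q Q) x with hD1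
  set D₂ := wdiv π (quarticField v (fun y => ζ y ^ 4)) x with hD2
  set z := ζ x with hz
  set r := genL π v x - q (v x) with hr
  have hgen : genL π v x = q (v x) + r := by rw [hr]; ring
  rw [hgen] at h1 h2
  have eT : ∀ a : Fin d → ℝ, ∑ i, a i * (4 * z ^ 3 * pderiv' ζ i x) =
      4 * z ^ 3 * ∑ i, a i * t i := by
    intro a
    rw [Finset.mul_sum]
    exact Finset.sum_congr rfl fun i _ => by rw [ht]; ring
  have eBT : ∑ i, ∑ j, B i j * (pderiv' v i x * (4 * z ^ 3 * pderiv' ζ j x)) =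
      4 * z ^ 3 * ∑ i, ∑ j, B i j * (w i * t j) := by
    simp only [Finset.mul_sum]
    exact Finset.sum_congr rfl fun i _ => Finset.sum_congr rfl fun j _ => by rw [ht, hw]; ring
  have ew : ∑ i, pderiv' v i x * (4 * z ^ 3 * pderiv' ζ i x) = 4 * z ^ 3 * ∑ i, w i * t i := eT w
  have ec : ∑ i, γ x i * (4 * z ^ 3 * pderiv' ζ i x) = 4 * z ^ 3 * ∑ i, c i * t i := eT c
  rw [eBT, ew, ec] at h1
  rw [ew] at h2
  change _ = _ + z ^ 4 * (-q' + q (v x) / v x) * (∑ i, w i ^ 2)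
    + z ^ 4 * r * (q (v x) + r + (∑ k, c k * w k) + (∑ i, w i ^ 2) / v x) + _ - _ - _
    + 1 / 4 * ((∑ k, c k * w k) * (4 * z ^ 3 * ∑ i, w i * t i)
      + (∑ i, w i ^ 2) * (4 * z ^ 3 * ∑ i, c i * t i)) at h1
  change z ^ 4 * (∑ i, ∑ j, B i j ^ 2 + R) = _ at h1
  change 3 * z ^ 4 * (∑ i, w i ^ 2) ^ 2 = _ - v x * (z ^ 4 * (q (v x) + r) * (∑ i, w i ^ 2)
    + 2 * z ^ 4 * (∑ i, ∑ j, B i j * (w i * w j))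
    + (∑ i, w i ^ 2) * (4 * z ^ 3 * ∑ i, w i * t i)) at h2
  change lam * (∑ i, w i ^ 2) ≤ R at h3
  change (lam - κ) * (z ^ 4 * ∑ i, w i ^ 2) ≤ _
  have bwt := abs_sum_mul_le_sqrt w t
  have bct := abs_sum_mul_le_sqrt c t
  have bcw := abs_sum_mul_le_sqrt c w
  have bBwt := abs_sum_sum_mul_le_sqrt B w t
  have bBww := abs_sum_sum_mul_le_sqrt B w w
  have sW : √(∑ i, w i ^ 2) ^ 2 = ∑ i, w i ^ 2 :=
    Real.sq_sqrt (Finset.sum_nonneg fun i _ => sq_nonneg _)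
  have sB : √(∑ i, ∑ j, B i j ^ 2) ^ 2 = ∑ i, ∑ j, B i j ^ 2 :=
    Real.sq_sqrt (Finset.sum_nonneg fun i _ => Finset.sum_nonneg fun j _ => sq_nonneg _)
  rw [← sW] at h1 h2 h3 ⊢
  rw [← sB] at h1
  change _ ≤ (D₁ + η * D₂) + _ * (η + η * (√(∑ k, c k ^ 2)) ^ 2 + |r| + _)
  change √(∑ i, t i ^ 2) ≤ η ^ 2 at hgrad
  have n1 := Real.sqrt_nonneg (∑ i, w i ^ 2)
  have n2 := Real.sqrt_nonneg (∑ i, ∑ j, B i j ^ 2)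
  have n3 := Real.sqrt_nonneg (∑ i, c i ^ 2)
  have n4 := Real.sqrt_nonneg (∑ i, t i ^ 2)
  generalize √(∑ i, w i ^ 2) = nw at *
  generalize √(∑ i, ∑ j, B i j ^ 2) = nB at *
  generalize √(∑ i, c i ^ 2) = G at *
  generalize √(∑ i, t i ^ 2) = nt at *
  generalize ∑ i, ∑ j, B i j * (w i * t j) = Bwt at *
  generalize ∑ i, ∑ j, B i j * (w i * w j) = Bww at *
  generalize ∑ i, w i * t i = wt at *
  generalize ∑ i, c i * t i = ct at *
  generalize ∑ i, c i * w i = cw at *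
  generalize genL π v x = gg at *
  clear_value R D₁ D₂ z r
  exact young_absorb (mul_nonneg hζ0 n1) (abs_nonneg r) hη hη8 hm hηM hηM' hC
    (cutoff_scalar_bound hm hvm hvM hκ hqC hQC hη hζ0 hζ1 hgrad n1 n2 n3 bwt bct bcw bBwt bBww
      h1 h2 h3)

end PointwiseGradient

section IntegratedGradient

variable {d : ℕ} {π : EuclideanSpace ℝ (Fin d) → ℝ}
  {γ : EuclideanSpace ℝ (Fin d) → EuclideanSpace ℝ (Fin d)}
  {v ζ : EuclideanSpace ℝ (Fin d) → ℝ} {q Q : ℝ → ℝ}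

theorem continuous_wdiv (hπ : ContDiff ℝ (⊤ : ℕ∞) π) (hpos : ∀ x, 0 < π x)
    {Y : Fin d → EuclideanSpace ℝ (Fin d) → ℝ} (hY : ∀ i, ContDiff ℝ 1 (Y i)) :
    Continuous (wdiv π Y) := by
  unfold wdiv
  refine continuous_finsetSum _ fun i _ => ?_
  have h1 : Continuous (pderiv' (Y i) i) := by
    unfold pderiv'
    exact ((hY i).continuous_fderiv (by simp)).clm_apply continuous_const
  exact h1.add ((hY i).continuous.mul
    (contDiff_pderiv' (contDiff_log_density hπ hpos) i).continuous)

theorem wdiv_eq_zero_of_eventuallyEq {Y : Fin d → EuclideanSpace ℝ (Fin d) → ℝ}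
    {x : EuclideanSpace ℝ (Fin d)} (h : ∀ i, Y i =ᶠ[nhds x] 0) : wdiv π Y x = 0 := by
  unfold wdiv
  refine Finset.sum_eq_zero fun i _ => ?_
  have : pderiv' (Y i) i x = 0 := by
    unfold pderiv'
    rw [(h i).fderiv_eq]
    simp
  rw [this, (h i).eq_of_nhds]
  simp

theorem cutoff_gradient_integral (hπ : ContDiff ℝ (⊤ : ℕ∞) π) (hpos : ∀ x, 0 < π x)
    (hγ : ContDiff ℝ (⊤ : ℕ∞) γ)
    (hstat : ∀ x, ∑ i, pderiv' (fun y => π y * γ y i) i x = 0)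
    {lam κ : ℝ} (hcond : ∀ (x v : EuclideanSpace ℝ (Fin d)),
      lam * ‖v‖ ^ 2 ≤ ∑ i, ∑ j, Rtensor π γ i j x * v i * v j)
    (hv : ContDiff ℝ (⊤ : ℕ∞) v) (hζ : ContDiff ℝ (⊤ : ℕ∞) ζ) (hζc : HasCompactSupport ζ)
    {m M C₀ η : ℝ} (hm : 0 < m) (hvm : ∀ x, m ≤ v x) (hvM : ∀ x, v x ≤ M)
    (hqc : ContDiffOn ℝ 1 q (Set.Ioi 0)) (hQ : ∀ y, 0 < y → HasDerivAt Q (q y) y)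
    (hκ : ∀ y, 0 < y → -deriv q y + q y / y ≤ κ)
    (hqC : ∀ y ∈ Set.Icc m M, |q y| ≤ C₀) (hQC : ∀ y ∈ Set.Icc m M, |Q y| ≤ C₀)
    (hη : 0 < η) (hη8 : η ≤ 1/8) (hηM : 8 * η * M ^ 2 ≤ 1) (hηM' : 16 * M * η ^ 2 ≤ 1)
    (hζ0 : ∀ x, 0 ≤ ζ x) (hζ1 : ∀ x, ζ x ≤ 1)
    (hgrad : ∀ x, √(∑ i, pderiv' ζ i x ^ 2) ≤ η ^ 2) :
    (lam - κ) * ∫ x, ζ x ^ 4 * (∑ i, pderiv' v i x ^ 2) * π x ≤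
      (3 + 2 * C₀ + M ^ 2 * C₀ ^ 2 + 1 / m ^ 2 + M ^ 2) *
        ∫ x in tsupport ζ, (η + η * ‖γ x‖ ^ 2 + |genL π v x - q (v x)|
          + |genL π v x - q (v x)| ^ 2 * (1 + ‖γ x‖ ^ 2) / η) * π x := by
  set C := 3 + 2 * C₀ + M ^ 2 * C₀ ^ 2 + 1 / m ^ 2 + M ^ 2 with hC
  set E : EuclideanSpace ℝ (Fin d) → ℝ := fun x => (η + η * ‖γ x‖ ^ 2 + |genL π v x - q (v x)|
          + |genL π v x - q (v x)| ^ 2 * (1 + ‖γ x‖ ^ 2) / η) * π x with hE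
  have hvpos : ∀ x, v x ∈ Set.Ioi (0 : ℝ) := fun x => hm.trans_le (hvm x)
  have hqd : ∀ y, 0 < y → HasDerivAt q (deriv q y) y := fun y hy =>
    ((hqc.differentiableOn (by simp)).differentiableAt (Ioi_mem_nhds hy)).hasDerivAt
  have hQc : ContDiffOn ℝ 1 Q (Set.Ioi 0) := by
    rw [show (1 : WithTop ℕ∞) = 0 + 1 from rfl,
      contDiffOn_succ_iff_deriv_of_isOpen isOpen_Ioi]
    refine ⟨fun y hy => (hQ y hy).differentiableAt.differentiableWithinAt, by simp, ?_⟩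
    refine contDiffOn_zero.mpr (hqc.continuousOn.congr fun y hy => (hQ y hy).deriv)
  have hqv : ContDiff ℝ 1 (fun y => q (v y)) := hqc.comp_contDiff (hv.of_le (by simp)) hvpos
  have hQv : ContDiff ℝ 1 (fun y => Q (v y)) := hQc.comp_contDiff (hv.of_le (by simp)) hvpos
  have hG := contDiff_Gamma1 hv hv
  have hΘ : ContDiff ℝ (⊤ : ℕ∞) (fun y => ζ y ^ 4) := hζ.pow 4
  have hγi : ∀ i, ContDiff ℝ (⊤ : ℕ∞) (fun y => γ y i) := fun i =>
    (EuclideanSpace.proj (𝕜 := ℝ) i).contDiff.comp hγ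
  have to1 : ∀ {f : EuclideanSpace ℝ (Fin d) → ℝ}, ContDiff ℝ (⊤ : ℕ∞) f → ContDiff ℝ 1 f :=
    fun h => h.of_le (by simp)
  have hcurv : ∀ i, ContDiff ℝ 1 (curvField π γ v (fun y => ζ y ^ 4) q Q i) := by
    intro i
    have hinv : ContDiff ℝ 1 (fun y => (v y)⁻¹) := (to1 hv).inv fun y => (hvpos y).ne'
    exact ((((to1 hΘ).mul ((hqv.sub (to1 (contDiff_genL hπ hpos hv))).sub
      ((to1 hG).mul hinv))).mul (to1 (contDiff_pderiv' hv i))).add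
      ((contDiff_const.mul (to1 hΘ)).mul (to1 (contDiff_pderiv' hG i)))).add
      (((to1 hΘ).mul (hQv.sub (contDiff_const.mul (to1 hG)))).mul (to1 (hγi i)))
  have hquart : ∀ i, ContDiff ℝ 1 (quarticField v (fun y => ζ y ^ 4) i) := fun i =>
    to1 ((hΘ.mul (hv.mul hG)).mul (contDiff_pderiv' hv i))
  have hz : ∀ x, x ∉ tsupport ζ → ∀ᶠ y in nhds x, ζ y = 0 := fun x hx =>
    notMem_tsupport_iff_eventuallyEq.mp hx
  have zcurv : ∀ x, x ∉ tsupport ζ → ∀ i,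
      curvField π γ v (fun y => ζ y ^ 4) q Q i =ᶠ[nhds x] 0 := fun x hx i => by
    filter_upwards [hz x hx] with y hy
    simp [curvField, hy]
  have zquart : ∀ x, x ∉ tsupport ζ → ∀ i,
      quarticField v (fun y => ζ y ^ 4) i =ᶠ[nhds x] 0 := fun x hx i => by
    filter_upwards [hz x hx] with y hy
    simp [quarticField, hy]
  have ccurv : ∀ i, HasCompactSupport (curvField π γ v (fun y => ζ y ^ 4) q Q i) := fun i =>
    HasCompactSupport.intro hζc fun x hx => (zcurv x hx i).eq_of_nhds
  have cquart : ∀ i, HasCompactSupport (quarticField v (fun y => ζ y ^ 4) i) := fun i =>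
    HasCompactSupport.intro hζc fun x hx => (zquart x hx i).eq_of_nhds
  have I1 := integral_wdiv_mul_eq_zero hπ hpos hcurv ccurv
  have I2 := integral_wdiv_mul_eq_zero hπ hpos hquart cquart
  have J1 : Integrable (fun x => wdiv π (curvField π γ v (fun y => ζ y ^ 4) q Q) x * π x) :=
    ((continuous_wdiv hπ hpos hcurv).mul hπ.continuous).integrable_of_hasCompactSupport
      (HasCompactSupport.intro hζc fun x hx => by
        simp [wdiv_eq_zero_of_eventuallyEq (zcurv x hx)])
  have J2 : Integrable (fun x => wdiv π (quarticField v (fun y => ζ y ^ 4)) x * π x) :=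
    ((continuous_wdiv hπ hpos hquart).mul hπ.continuous).integrable_of_hasCompactSupport
      (HasCompactSupport.intro hζc fun x hx => by
        simp [wdiv_eq_zero_of_eventuallyEq (zquart x hx)])
  have hEc : Continuous E := by
    have h1 : Continuous (fun x => |genL π v x - q (v x)|) :=
      ((contDiff_genL hπ hpos hv).continuous.sub hqv.continuous).abs
    have h2 : Continuous (fun x => ‖γ x‖ ^ 2) := hγ.continuous.norm.pow 2
    exact (((continuous_const.add (continuous_const.mul h2)).add h1).add
      (((h1.pow 2).mul (continuous_const.add h2)).div_const η)).mul hπ.continuous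
  have hS : MeasurableSet (tsupport ζ) := (isClosed_tsupport ζ).measurableSet
  have J3 : Integrable ((tsupport ζ).indicator E) :=
    (hEc.continuousOn.integrableOn_compact hζc).integrable_indicator hS
  have hlhs : Integrable (fun x => ζ x ^ 4 * (∑ i, pderiv' v i x ^ 2) * π x) := by
    refine Continuous.integrable_of_hasCompactSupport ?_
      (HasCompactSupport.intro hζc fun x hx => by simp [(hz x hx).self_of_nhds])
    exact (hΘ.continuous.mul (continuous_finsetSum _ fun i _ =>
      (contDiff_pderiv' hv i).continuous.pow 2)).mul hπ.continuous
  have hpt : ∀ x, (lam - κ) * (ζ x ^ 4 * (∑ i, pderiv' v i x ^ 2) * π x) ≤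
      (wdiv π (curvField π γ v (fun y => ζ y ^ 4) q Q) x * π x
        + η * (wdiv π (quarticField v (fun y => ζ y ^ 4)) x * π x))
      + C * (tsupport ζ).indicator E x := by
    intro x
    by_cases hx : x ∈ tsupport ζ
    · rw [Set.indicator_of_mem hx]
      have hb : v x ∈ Set.Icc m M := ⟨hvm x, hvM x⟩
      have := cutoff_gradient_pointwise hπ hpos hγ hstat hcond hv hζ hm (hvm x) (hvM x)
        (hqd _ (hvpos x)) (hQ _ (hvpos x)) (hκ _ (hvpos x)) (hqC _ hb) (hQC _ hb) hη hη8 hηM hηM'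
        (hζ0 x) (hζ1 x) (hgrad x)
      have hn : √(∑ k, γ x k ^ 2) = ‖γ x‖ := by
        rw [EuclideanSpace.norm_eq]; simp
      rw [hn] at this
      have := mul_le_mul_of_nonneg_right this (hpos x).le
      rw [hE]
      linarith
    · rw [Set.indicator_of_notMem hx, wdiv_eq_zero_of_eventuallyEq (zcurv x hx),
        wdiv_eq_zero_of_eventuallyEq (zquart x hx), (hz x hx).self_of_nhds]
      simp
  have J12 : Integrable (fun x => wdiv π (curvField π γ v (fun y => ζ y ^ 4) q Q) x * π x
      + η * (wdiv π (quarticField v (fun y => ζ y ^ 4)) x * π x)) := J1.add (J2.const_mul η)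
  have := integral_mono (hlhs.const_mul (lam - κ)) (J12.add (J3.const_mul C)) hpt
  have e1 : ∫ x, ((wdiv π (curvField π γ v (fun y => ζ y ^ 4) q Q) x * π x
        + η * (wdiv π (quarticField v (fun y => ζ y ^ 4)) x * π x))
      + C * (tsupport ζ).indicator E x) = C * ∫ x in tsupport ζ, E x := by
    rw [integral_add J12 (J3.const_mul C), integral_add J1 (J2.const_mul η), integral_const_mul,
      integral_const_mul, I1, I2, integral_indicator hS]
    ring
  rw [integral_const_mul] at this
  exact this.trans e1.le

end IntegratedGradient

section Cutoff

variable {d : ℕ}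

theorem sqrt_sum_pderiv'_sq_le {f : EuclideanSpace ℝ (Fin d) → ℝ} (x : EuclideanSpace ℝ (Fin d)) :
    √(∑ i, pderiv' f i x ^ 2) ≤ ‖fderiv ℝ f x‖ := by
  set p : EuclideanSpace ℝ (Fin d) := WithLp.toLp 2 (fun i => pderiv' f i x) with hp
  have hn : √(∑ i, pderiv' f i x ^ 2) = ‖p‖ := by
    rw [EuclideanSpace.norm_eq]; simp [hp]
  have h1 : fderiv ℝ f x p = ‖p‖ ^ 2 := by
    rw [fderiv_eq_sum_pderiv', EuclideanSpace.norm_sq_eq]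
    simp [hp, pow_two]
  have h2 := (le_abs_self _).trans ((fderiv ℝ f x).le_opNorm p)
  rw [h1] at h2
  rw [hn]
  rcases (norm_nonneg p).eq_or_lt with h | h
  · rw [← h]; exact norm_nonneg _
  · nlinarith

theorem norm_fderiv_le_sqrt_sum {f : EuclideanSpace ℝ (Fin d) → ℝ}
    (x : EuclideanSpace ℝ (Fin d)) :
    ‖fderiv ℝ f x‖ ≤ √(∑ i, pderiv' f i x ^ 2) := by
  refine ContinuousLinearMap.opNorm_le_bound _ (Real.sqrt_nonneg _) fun v => ?_
  rw [fderiv_eq_sum_pderiv', EuclideanSpace.norm_eq, mul_comm]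
  simpa using abs_sum_mul_le_sqrt (fun i => v i) (fun i => pderiv' f i x)

/-- A family of smooth cutoff functions at scale `R` with gradient of order `1 / R`. -/
theorem exists_cutoff (d : ℕ) : ∃ C : ℝ, 0 < C ∧ ∀ R : ℝ, 0 < R →
    ∃ ζ : EuclideanSpace ℝ (Fin d) → ℝ, ContDiff ℝ (⊤ : ℕ∞) ζ ∧ HasCompactSupport ζ ∧
      (∀ x, 0 ≤ ζ x) ∧ (∀ x, ζ x ≤ 1) ∧ (∀ x, ‖x‖ ≤ R → ζ x = 1) ∧
      tsupport ζ ⊆ Metric.closedBall 0 (2 * R) ∧ ∀ x, √(∑ i, pderiv' ζ i x ^ 2) ≤ C / R := by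
  let χ : ContDiffBump (0 : EuclideanSpace ℝ (Fin d)) := ⟨1, 2, by norm_num, by norm_num⟩
  have hχ : ContDiff ℝ (⊤ : ℕ∞) χ := χ.contDiff
  obtain ⟨C, hC⟩ := (χ.hasCompactSupport.fderiv (𝕜 := ℝ)).exists_bound_of_continuous
    (hχ.continuous_fderiv (by simp))
  have hC0 : 0 ≤ C := (norm_nonneg _).trans (hC 0)
  refine ⟨C + 1, by linarith, fun R hR => ⟨fun x => χ (R⁻¹ • x), ?_, ?_, fun x => χ.nonneg,
    fun x => χ.le_one, fun x hx => ?_, ?_, fun x => ?_⟩⟩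
  · exact hχ.comp (contDiff_const_smul _)
  · exact χ.hasCompactSupport.comp_homeomorph (Homeomorph.smulOfNeZero R⁻¹ (by positivity))
  · refine χ.one_of_mem_closedBall ?_
    rw [mem_closedBall_zero_iff, norm_smul, norm_inv, Real.norm_of_nonneg hR.le]
    show R⁻¹ * ‖x‖ ≤ 1
    rw [inv_mul_le_iff₀ hR]; linarith
  · refine closure_minimal (fun x hx => ?_) Metric.isClosed_closedBall
    have : R⁻¹ • x ∈ Function.support χ := hx
    rw [χ.support_eq, mem_ball_zero_iff, norm_smul, norm_inv, Real.norm_of_nonneg hR.le] at this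
    have h2 : R⁻¹ * ‖x‖ < 2 := this
    rw [inv_mul_lt_iff₀ hR] at h2
    rw [mem_closedBall_zero_iff]; linarith
  · refine (sqrt_sum_pderiv'_sq_le x).trans ?_
    have h1 : HasFDerivAt (fun x : EuclideanSpace ℝ (Fin d) => χ (R⁻¹ • x))
        ((fderiv ℝ χ (R⁻¹ • x)).comp (R⁻¹ • ContinuousLinearMap.id ℝ _)) x :=
      ((hχ.differentiable (by simp)) (R⁻¹ • x)).hasFDerivAt.comp x
        ((hasFDerivAt_id x).const_smul R⁻¹)
    rw [h1.fderiv, ContinuousLinearMap.comp_smul, ContinuousLinearMap.comp_id, norm_smul, norm_inv,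
      Real.norm_of_nonneg hR.le, div_eq_inv_mul]
    gcongr
    exact (hC _).trans (by linarith)

/-- A nonnegative function which is dominated outside a ball by an integrable function minus the
divergence of a field `Z` with `‖Z x‖ ≤ ‖x‖ * B' x`, `B'` integrable, is integrable. -/
theorem integrable_of_le_sub_divergence {A B B' : EuclideanSpace ℝ (Fin d) → ℝ}
    {Z : Fin d → EuclideanSpace ℝ (Fin d) → ℝ} {R₀ : ℝ}
    (hA : Continuous A) (hA0 : ∀ x, 0 ≤ A x) (hB : Integrable B) (hBc : Continuous B)
    (hB' : Integrable B') (hZ : ∀ i, ContDiff ℝ 1 (Z i))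
    (hZB : ∀ x, √(∑ i, Z i x ^ 2) ≤ ‖x‖ * B' x)
    (hle : ∀ x, R₀ ≤ ‖x‖ → A x ≤ B x - ∑ i, pderiv' (Z i) i x) : Integrable A := by
  obtain ⟨C, hC, hcut⟩ := exists_cutoff d
  have hdiv : Continuous (fun x => ∑ i, pderiv' (Z i) i x) := by
    refine continuous_finsetSum _ fun i _ => ?_
    unfold pderiv'
    exact ((hZ i).continuous_fderiv (by simp)).clm_apply continuous_const
  set D : EuclideanSpace ℝ (Fin d) → ℝ := fun x => |A x| + |B x| + |∑ i, pderiv' (Z i) i x| with hD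
  have hDc : Continuous D := (hA.abs.add hBc.abs).add hdiv.abs
  have hDi : Integrable ((Metric.closedBall 0 R₀).indicator D) :=
    (hDc.continuousOn.integrableOn_compact (isCompact_closedBall _ _)).integrable_indicator
      Metric.isClosed_closedBall.measurableSet
  have hD0 : ∀ x, 0 ≤ (Metric.closedBall 0 R₀).indicator D x := fun x =>
    Set.indicator_nonneg (fun _ _ => by positivity) x
  have hpt : ∀ x, A x ≤ B x - ∑ i, pderiv' (Z i) i x + (Metric.closedBall 0 R₀).indicator D x := by
    intro x
    by_cases hx : R₀ ≤ ‖x‖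
    · exact (hle x hx).trans (by linarith [hD0 x])
    · rw [Set.indicator_of_mem (by rw [mem_closedBall_zero_iff]; linarith)]
      have := neg_abs_le (B x)
      have := le_abs_self (∑ i, pderiv' (Z i) i x)
      have := le_abs_self (A x)
      simp only [hD]; linarith
  set K := (∫ x, |B x|) + (∫ x, 2 * C * |B' x|) + ∫ x, (Metric.closedBall 0 R₀).indicator D x
  refine (aecover_ball (μ := volume) (x := (0 : EuclideanSpace ℝ (Fin d)))
    (Filter.tendsto_id (α := ℝ))).integrable_of_integral_norm_bounded K
    (fun R => (hA.continuousOn.integrableOn_compact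
      (isCompact_closedBall 0 R)).mono_set Metric.ball_subset_closedBall) ?_
  filter_upwards [Filter.eventually_gt_atTop 0] with R hR
  obtain ⟨ζ, hζ, hζc, hζ0, hζ1, hζR, hζs, hζg⟩ := hcut R hR
  have hζ' : ContDiff ℝ 1 ζ := hζ.of_le (by simp)
  have i1 : Integrable (fun x => ζ x * A x) :=
    (hζ.continuous.mul hA).integrable_of_hasCompactSupport hζc.mul_right
  have i2 : ∀ i, ContDiff ℝ 1 (fun x => ζ x * Z i x) := fun i => hζ'.mul (hZ i)
  have i3 : ∀ i, HasCompactSupport (fun x => ζ x * Z i x) := fun i => hζc.mul_right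
  have i4 : ∀ i, Integrable (pderiv' (fun x => ζ x * Z i x) i) := fun i => by
    refine Continuous.integrable_of_hasCompactSupport ?_ ((i3 i).pderiv' i)
    unfold pderiv'
    exact ((i2 i).continuous_fderiv (by simp)).clm_apply continuous_const
  have i5 : Integrable (fun x => ∑ i, pderiv' (fun x => ζ x * Z i x) i x) :=
    integrable_finsetSum _ fun i _ => i4 i
  have e5 : ∫ x, ∑ i, pderiv' (fun x => ζ x * Z i x) i x = 0 := by
    rw [integral_finsetSum _ fun i _ => i4 i]
    exact Finset.sum_eq_zero fun i _ => integral_pderiv'_eq_zero (i2 i) (i3 i) i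
  have hgr : ∀ x, |∑ i, pderiv' ζ i x * Z i x| ≤ 2 * C * |B' x| := by
    intro x
    refine (abs_sum_mul_le_sqrt _ _).trans ?_
    by_cases hx : x ∈ tsupport ζ
    · have h1 := hζs hx
      rw [mem_closedBall_zero_iff] at h1
      calc _ ≤ C / R * (2 * R * |B' x|) := by
            refine mul_le_mul (hζg x) ((hZB x).trans ?_) (Real.sqrt_nonneg _) (by positivity)
            exact (mul_le_mul_of_nonneg_left (le_abs_self _) (norm_nonneg _)).trans
              (mul_le_mul_of_nonneg_right h1 (abs_nonneg _))
        _ = 2 * C * |B' x| := by field_simp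
    · have : ∀ i, pderiv' ζ i x = 0 := fun i => by
        rw [pderiv', (notMem_tsupport_iff_eventuallyEq.mp hx).fderiv_eq]; simp
      simp only [this]
      simp
      positivity
  have hall : ∀ x, ζ x * A x ≤ |B x| - ∑ i, pderiv' (fun x => ζ x * Z i x) i x
      + 2 * C * |B' x| + (Metric.closedBall 0 R₀).indicator D x := by
    intro x
    have e : ∑ i, pderiv' (fun x => ζ x * Z i x) i x
        = ∑ i, pderiv' ζ i x * Z i x + ζ x * ∑ i, pderiv' (Z i) i x := by
      rw [Finset.mul_sum, ← Finset.sum_add_distrib]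
      exact Finset.sum_congr rfl fun i _ => pderiv'_mul (hζ.differentiable (by simp) x)
        ((hZ i).differentiable (by simp) x) i
    have h1 := mul_le_mul_of_nonneg_left (hpt x) (hζ0 x)
    have h2 := (le_abs_self _).trans (hgr x)
    have h3 : ζ x * B x ≤ |B x| := by
      refine (le_abs_self _).trans ?_
      rw [abs_mul, abs_of_nonneg (hζ0 x)]
      exact mul_le_of_le_one_left (abs_nonneg _) (hζ1 x)
    have h4 := mul_le_of_le_one_left (hD0 x) (hζ1 x)
    rw [e]; linarith
  have j1 : Integrable (fun x => |B x| - ∑ i, pderiv' (fun x => ζ x * Z i x) i x) :=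
    hB.abs.sub i5
  have j2 : Integrable (fun x => |B x| - ∑ i, pderiv' (fun x => ζ x * Z i x) i x
      + 2 * C * |B' x|) := j1.add (hB'.abs.const_mul (2 * C))
  have := integral_mono i1 (j2.add hDi) hall
  have e6 : ∫ x, (|B x| - ∑ i, pderiv' (fun x => ζ x * Z i x) i x
      + 2 * C * |B' x| + (Metric.closedBall 0 R₀).indicator D x) = K := by
    rw [integral_add j2 hDi, integral_add j1 (hB'.abs.const_mul (2 * C)), integral_sub hB.abs i5,
      e5, sub_zero]
  calc ∫ x in Metric.ball 0 R, ‖A x‖ = ∫ x in Metric.ball 0 R, ζ x * A x := by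
        refine setIntegral_congr_fun Metric.isOpen_ball.measurableSet fun x hx => ?_
        rw [mem_ball_zero_iff] at hx
        simp [hζR x hx.le, abs_of_nonneg (hA0 x)]
    _ ≤ ∫ x, ζ x * A x := setIntegral_le_integral i1
        (Filter.Eventually.of_forall fun x => mul_nonneg (hζ0 x) (hA0 x))
    _ ≤ K := this.trans e6.le

end Cutoff

section TraceBound

variable {d : ℕ}

theorem le_trace_sub_of_quadratic_lower_bound {H : Fin d → Fin d → ℝ} {β : ℝ} (hβ : 0 ≤ β)
    (hH : ∀ v : Fin d → ℝ, β * ∑ i, v i ^ 2 ≤ ∑ i, ∑ j, H i j * (v i * v j))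
    {m : Fin d → ℝ} (hm : ∑ i, m i ^ 2 ≤ 1) :
    β * ((d : ℝ) - 1) ≤ ∑ i, H i i - ∑ i, ∑ j, H i j * (m i * m j) := by
  set s := ∑ i, m i ^ 2 with hs
  have hs0 : 0 ≤ s := Finset.sum_nonneg fun i _ => sq_nonneg _
  have h1 := Finset.sum_le_sum fun k (_ : k ∈ Finset.univ) =>
    hH (fun i => (if i = k then 1 else 0) - m k * m i)
  have e1 : ∑ k, β * ∑ i, ((if i = k then (1 : ℝ) else 0) - m k * m i) ^ 2
      = β * (d - 2 * s + s ^ 2) := by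
    rw [← Finset.mul_sum]
    congr 1
    have : ∀ k, ∑ i, ((if i = k then (1 : ℝ) else 0) - m k * m i) ^ 2
        = 1 - 2 * m k ^ 2 + m k ^ 2 * s := by
      intro k
      have : ∀ i, ((if i = k then (1 : ℝ) else 0) - m k * m i) ^ 2
          = (if i = k then 1 else 0) - (if i = k then 2 * (m k * m i) else 0)
            + m k ^ 2 * m i ^ 2 := by
        intro i; split_ifs <;> ring
      simp only [this, Finset.sum_add_distrib, Finset.sum_sub_distrib, Finset.sum_ite_eq',
        Finset.mem_univ, if_true, ← Finset.mul_sum]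
      ring
    simp only [this, Finset.sum_add_distrib, Finset.sum_sub_distrib, ← Finset.mul_sum,
      ← Finset.sum_mul]
    simp [← hs]; ring
  have e2 : ∑ k, ∑ i, ∑ j, H i j * (((if i = k then 1 else 0) - m k * m i)
      * ((if j = k then 1 else 0) - m k * m j))
      = ∑ i, H i i - (2 - s) * ∑ i, ∑ j, H i j * (m i * m j) := by
    rw [Finset.sum_comm]
    have : ∀ i, ∑ k, ∑ j, H i j * (((if i = k then 1 else 0) - m k * m i)
        * ((if j = k then 1 else 0) - m k * m j))
        = H i i - (2 - s) * ∑ j, H i j * (m i * m j) := by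
      intro i
      rw [Finset.sum_comm, Finset.mul_sum]
      have : ∀ j, ∑ k, H i j * (((if i = k then 1 else 0) - m k * m i)
          * ((if j = k then 1 else 0) - m k * m j))
          = (if i = j then H i j else 0) - (2 - s) * (H i j * (m i * m j)) := by
        intro j
        have : ∀ k, H i j * (((if i = k then (1 : ℝ) else 0) - m k * m i)
          * ((if j = k then 1 else 0) - m k * m j)) = (if i = k then (if j = k then H i j else 0)
             else 0) - (if i = k then H i j * (m k * m j) else 0)
             - (if j = k then H i j * (m k * m i) else 0) + H i j * (m i * m j) * m k ^ 2 := by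
          intro k; split_ifs <;> ring
        simp only [this, Finset.sum_add_distrib, Finset.sum_sub_distrib, Finset.sum_ite_eq,
          Finset.mem_univ, if_true, ← Finset.mul_sum, ← hs]
        simp only [eq_comm (a := j) (b := i)]
        ring
      simp only [this, Finset.sum_sub_distrib]
      simp
    simp only [this, Finset.sum_sub_distrib, ← Finset.mul_sum]
  have h2 := hH m
  rw [e1, e2] at h1
  nlinarith

end TraceBound

section DensityPower

variable {d : ℕ} {π : EuclideanSpace ℝ (Fin d) → ℝ}
  {γ : EuclideanSpace ℝ (Fin d) → EuclideanSpace ℝ (Fin d)}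

/-- The power `π ^ (-1/a)` of a positive density. -/
def densityPower (π : EuclideanSpace ℝ (Fin d) → ℝ) (a : ℝ) (x : EuclideanSpace ℝ (Fin d)) : ℝ :=
  Real.exp (-a⁻¹ * Real.log (π x))

theorem densityPower_pos (a : ℝ) (x : EuclideanSpace ℝ (Fin d)) : 0 < densityPower π a x :=
  Real.exp_pos _

theorem contDiff_densityPower (hπ : ContDiff ℝ (⊤ : ℕ∞) π) (hpos : ∀ x, 0 < π x) (a : ℝ) :
    ContDiff ℝ (⊤ : ℕ∞) (densityPower π a) :=
  (contDiff_const.mul (contDiff_log_density hπ hpos)).exp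

theorem pderiv'_densityPower (hπ : ContDiff ℝ (⊤ : ℕ∞) π) (hpos : ∀ x, 0 < π x) (a : ℝ) (i : Fin d)
    (x : EuclideanSpace ℝ (Fin d)) :
    pderiv' (densityPower π a) i x
      = densityPower π a x * (-a⁻¹ * pderiv' (fun y => Real.log (π y)) i x) := by
  have hL := (contDiff_log_density hπ hpos).differentiable (by simp) x
  unfold densityPower
  rw [pderiv'_comp (Real.hasDerivAt_exp _) (hL.const_mul _), pderiv'_const_mul hL]

theorem pderiv2_densityPower (hπ : ContDiff ℝ (⊤ : ℕ∞) π) (hpos : ∀ x, 0 < π x) (a : ℝ)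
    (i j : Fin d) (x : EuclideanSpace ℝ (Fin d)) :
    pderiv2 (densityPower π a) i j x = densityPower π a x *
      (a⁻¹ ^ 2 * (pderiv' (fun y => Real.log (π y)) i x * pderiv' (fun y => Real.log (π y)) j x)
        - a⁻¹ * pderiv2 (fun y => Real.log (π y)) i j x) := by
  have hL := contDiff_log_density hπ hpos
  have hW := contDiff_densityPower hπ hpos a
  have hLj := (contDiff_pderiv' hL j).differentiable (by simp) x
  have e : (fun y => pderiv' (densityPower π a) j y) = fun y => densityPower π a y *
      (-a⁻¹ * pderiv' (fun y => Real.log (π y)) j y) := by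
    ext y; exact pderiv'_densityPower hπ hpos a j y
  rw [pderiv2, e, pderiv'_mul (hW.differentiable (by simp) x) (hLj.const_mul _),
    pderiv'_const_mul hLj, pderiv'_densityPower hπ hpos, pderiv2]
  ring

theorem hessian_densityPower_lower_bound (hπ : ContDiff ℝ (⊤ : ℕ∞) π) (hpos : ∀ x, 0 < π x)
    {lam : ℝ} (hcond : ∀ (x v : EuclideanSpace ℝ (Fin d)),
      lam * ‖v‖ ^ 2 ≤ ∑ i, ∑ j, Rtensor π γ i j x * v i * v j)
    {a : ℝ} (ha : a = (d : ℝ) - 3 / 2) (ha0 : 0 < a) (x : EuclideanSpace ℝ (Fin d))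
    (v : Fin d → ℝ) :
    densityPower π a x / a * (lam + (∑ k, γ x k ^ 2) / 8) * ∑ i, v i ^ 2
      ≤ ∑ i, ∑ j, pderiv2 (densityPower π a) i j x * (v i * v j) := by
  have h := hcond x (WithLp.toLp 2 v)
  rw [EuclideanSpace.norm_sq_eq] at h
  simp only [Real.norm_eq_abs, sq_abs] at h
  rw [sum_Rtensor_mul x v] at h
  set W := densityPower π a x with hW
  have hW0 : 0 < W := densityPower_pos a x
  set g := ∑ k, γ x k * v k
  set X := ∑ k, pderiv' (fun y => Real.log (π y)) k x * v k with hX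
  have e : ∑ i, ∑ j, pderiv2 (densityPower π a) i j x * (v i * v j)
      = W * (a⁻¹ ^ 2 * X ^ 2
        - a⁻¹ * ∑ i, ∑ j, pderiv2 (fun y => Real.log (π y)) i j x * (v i * v j)) := by
    have : ∀ i j, pderiv2 (densityPower π a) i j x * (v i * v j)
        = W * a⁻¹ ^ 2 * ((pderiv' (fun y => Real.log (π y)) i x * v i)
            * (pderiv' (fun y => Real.log (π y)) j x * v j))
          - W * a⁻¹ * (pderiv2 (fun y => Real.log (π y)) i j x * (v i * v j)) := by
      intro i j
      rw [pderiv2_densityPower hπ hpos]; ring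
    simp only [this, Finset.sum_sub_distrib, ← Finset.mul_sum, ← Finset.sum_mul]
    rw [hX]; ring
  rw [e]
  set Lvv := ∑ i, ∑ j, pderiv2 (fun y => Real.log (π y)) i j x * (v i * v j)
  have hk : (lam + (∑ k, γ x k ^ 2) / 8) * ∑ i, v i ^ 2 ≤ a⁻¹ * X ^ 2 - Lvv := by
    have h1 : g * X ≤ a / 4 * g ^ 2 + a⁻¹ * X ^ 2 := by
      have : 0 ≤ a * (g / 2 - a⁻¹ * X) ^ 2 := by positivity
      have e2 : a * (g / 2 - a⁻¹ * X) ^ 2 = a / 4 * g ^ 2 + a⁻¹ * X ^ 2 - g * X := by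
        field_simp; ring
      linarith
    have e3 : (3 - 2 * (d : ℝ)) / 8 = - (a / 4) := by rw [ha]; ring
    rw [e3] at h
    simp only at h
    linarith
  calc _ = W / a * ((lam + (∑ k, γ x k ^ 2) / 8) * ∑ i, v i ^ 2) := by ring
    _ ≤ W / a * (a⁻¹ * X ^ 2 - Lvv) := mul_le_mul_of_nonneg_left hk (by positivity)
    _ = _ := by field_simp

end DensityPower

section Convexity

variable {d : ℕ} {W : EuclideanSpace ℝ (Fin d) → ℝ}

theorem le_of_hessian_nonneg (hW : ContDiff ℝ (⊤ : ℕ∞) W)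
    (hH : ∀ x (v : Fin d → ℝ), 0 ≤ ∑ i, ∑ j, pderiv2 W i j x * (v i * v j))
    (x y : EuclideanSpace ℝ (Fin d)) :
    W x + ∑ i, pderiv' W i x * (y i - x i) ≤ W y := by
  set v := y - x with hv
  have hline : ∀ t : ℝ, HasDerivAt (fun s : ℝ => x + s • v) v t := fun t => by
    simpa using ((hasDerivAt_id t).smul_const v).const_add x
  have hcomp : ∀ {f : EuclideanSpace ℝ (Fin d) → ℝ}, ContDiff ℝ (⊤ : ℕ∞) f → ∀ t : ℝ,
      HasDerivAt (fun s : ℝ => f (x + s • v)) (∑ i, v i * pderiv' f i (x + t • v)) t := by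
    intro f hf t
    rw [← fderiv_eq_sum_pderiv']
    exact ((hf.differentiable (by simp)) (x + t • v)).hasFDerivAt.comp_hasDerivAt t (hline t)
  have h2 : ∀ t : ℝ, HasDerivAt (fun s : ℝ => ∑ i, v i * pderiv' W i (x + s • v))
      (∑ i, v i * ∑ j, v j * pderiv' (pderiv' W i) j (x + t • v)) t := fun t =>
    HasDerivAt.fun_sum fun i _ => (hcomp (contDiff_pderiv' hW i) t).const_mul (v i)
  have hconv : ConvexOn ℝ Set.univ (fun s : ℝ => W (x + s • v)) := by
    refine convexOn_of_hasDerivWithinAt2_nonneg convex_univ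
      (fun t _ => (hcomp hW t).continuousAt.continuousWithinAt)
      (fun t _ => (hcomp hW t).hasDerivWithinAt) (fun t _ => (h2 t).hasDerivWithinAt) fun t _ => ?_
    refine (hH (x + t • v) (fun i => v i)).trans_eq ?_
    rw [Finset.sum_comm]
    refine Finset.sum_congr rfl fun i _ => ?_
    rw [Finset.mul_sum]
    refine Finset.sum_congr rfl fun j _ => ?_
    simp only [pderiv2]
    ring
  have := hconv.le_slope_of_hasDerivAt (Set.mem_univ 0) (Set.mem_univ 1) one_pos (hcomp hW 0)
  rw [slope_def_field] at this
  simp only [one_smul, zero_smul, add_zero, sub_zero, div_one] at this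
  have e : x + v = y := by rw [hv]; abel
  rw [e] at this
  have e2 : ∑ i, pderiv' W i x * (y i - x i) = ∑ i, v i * pderiv' W i x :=
    Finset.sum_congr rfl fun i _ => by simp [hv, mul_comm]
  linarith

theorem midpoint_le_of_hessian_nonneg (hW : ContDiff ℝ (⊤ : ℕ∞) W)
    (hH : ∀ x (v : Fin d → ℝ), 0 ≤ ∑ i, ∑ j, pderiv2 W i j x * (v i * v j))
    (x y : EuclideanSpace ℝ (Fin d)) :
    W ((1 / 2 : ℝ) • (x + y)) ≤ (W x + W y) / 2 := by
  have h1 := le_of_hessian_nonneg hW hH ((1 / 2 : ℝ) • (x + y)) x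
  have h2 := le_of_hessian_nonneg hW hH ((1 / 2 : ℝ) • (x + y)) y
  have e : ∑ i, pderiv' W i ((1 / 2 : ℝ) • (x + y)) * (x i - ((1 / 2 : ℝ) • (x + y)) i)
      + ∑ i, pderiv' W i ((1 / 2 : ℝ) • (x + y)) * (y i - ((1 / 2 : ℝ) • (x + y)) i) = 0 := by
    rw [← Finset.sum_add_distrib]
    refine Finset.sum_eq_zero fun i _ => ?_
    simp only [PiLp.smul_apply, PiLp.add_apply, smul_eq_mul]
    ring
  linarith

/-- For a convex function, the radial derivative controls the length of the gradient. -/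
theorem sqrt_sum_add_le_radial_of_hessian_nonneg (hW : ContDiff ℝ (⊤ : ℕ∞) W)
    (hH : ∀ x (v : Fin d → ℝ), 0 ≤ ∑ i, ∑ j, pderiv2 W i j x * (v i * v j))
    {S : ℝ} (hS : ∀ x, ‖x‖ ≤ 1 → W x ≤ S) (x : EuclideanSpace ℝ (Fin d)) :
    √(∑ i, pderiv' W i x ^ 2) + W x - S ≤ ∑ i, x i * pderiv' W i x := by
  set n := √(∑ i, pderiv' W i x ^ 2) with hn
  have hn2 : n ^ 2 = ∑ i, pderiv' W i x ^ 2 :=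
    Real.sq_sqrt (Finset.sum_nonneg fun i _ => sq_nonneg _)
  set e : EuclideanSpace ℝ (Fin d) := WithLp.toLp 2 (fun i => n⁻¹ * pderiv' W i x) with he
  have hne : ‖e‖ ≤ 1 := by
    rw [EuclideanSpace.norm_eq, Real.sqrt_le_one]
    simp only [he, Real.norm_eq_abs, sq_abs, mul_pow, ← Finset.mul_sum, ← hn2]
    rcases eq_or_ne n 0 with h | h
    · simp [h]
    · rw [← mul_pow, inv_mul_cancel₀ h]; simp
  have h1 := (le_of_hessian_nonneg hW hH x e).trans (hS e hne)
  have e1 : ∑ i, pderiv' W i x * (e i - x i) = n - ∑ i, x i * pderiv' W i x := by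
    simp only [mul_sub, Finset.sum_sub_distrib, he]
    have : ∑ i, pderiv' W i x * (n⁻¹ * pderiv' W i x) = n⁻¹ * n ^ 2 := by
      rw [hn2, Finset.mul_sum]
      exact Finset.sum_congr rfl fun i _ => by ring
    rw [this]
    have : n⁻¹ * n ^ 2 = n := by
      rcases eq_or_ne n 0 with h | h
      · simp [h]
      · field_simp
    rw [this]
    simp only [mul_comm]
  rw [e1] at h1
  linarith

theorem bounded_sublevel_of_midpoint_le {π : EuclideanSpace ℝ (Fin d) → ℝ}
    (hπ0 : ∀ x, 0 ≤ π x) (hπi : Integrable π)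
    (hmid : ∀ x y, W ((1 / 2 : ℝ) • (x + y)) ≤ (W x + W y) / 2)
    {S c : ℝ} (hc : 0 < c) (hS : ∀ x, ‖x‖ ≤ 1 → W x ≤ S) (hSc : ∀ x, W x ≤ S → c ≤ π x) :
    ∃ R, ∀ x, W x ≤ S → ‖x‖ ≤ R := by
  set V := volume.real (Metric.ball (0 : EuclideanSpace ℝ (Fin d)) (1 / 2))
  have hV : 0 < V := by
    refine ENNReal.toReal_pos (Metric.measure_ball_pos _ _ (by norm_num)).ne'
      measure_ball_lt_top.ne
  have ht := (aecover_ball (μ := volume) (x := (0 : EuclideanSpace ℝ (Fin d)))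
    (Filter.tendsto_id (α := ℝ))).integral_tendsto_of_countably_generated hπi
  obtain ⟨R, hR⟩ := (ht.eventually_const_lt
    (show (∫ x, π x) - c * V < ∫ x, π x by nlinarith [mul_pos hc hV])).exists
  refine ⟨2 * R + 1, fun x hx => ?_⟩
  by_contra! hlt
  set B := Metric.ball ((1 / 2 : ℝ) • x) (1 / 2) with hB
  have hBS : ∀ y ∈ B, c ≤ π y := by
    intro y hy
    apply hSc
    have h1 : ‖(2 : ℝ) • y - x‖ ≤ 1 := by
      have : (2 : ℝ) • y - x = (2 : ℝ) • (y - (1 / 2 : ℝ) • x) := by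
        rw [smul_sub, smul_smul]; norm_num
      rw [this, norm_smul]
      rw [hB, mem_ball_iff_norm] at hy
      norm_num
      norm_num at hy
      linarith
    have h2 := hmid x ((2 : ℝ) • y - x)
    have e : (1 / 2 : ℝ) • (x + ((2 : ℝ) • y - x)) = y := by
      rw [add_sub_cancel, smul_smul]; norm_num
    rw [e] at h2
    linarith [hS _ h1]
  have hdisj : Disjoint (Metric.ball (0 : EuclideanSpace ℝ (Fin d)) R) B := by
    refine Metric.ball_disjoint_ball ?_
    rw [dist_comm, dist_zero_right, norm_smul]
    norm_num
    linarith
  have h3 : c * V ≤ ∫ y in B, π y := by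
    have : ∫ y in B, c ≤ ∫ y in B, π y :=
      setIntegral_mono_on (integrableOn_const measure_ball_lt_top.ne) hπi.integrableOn
        measurableSet_ball hBS
    rw [setIntegral_const, smul_eq_mul, mul_comm] at this
    refine le_trans (le_of_eq ?_) this
    congr 1
    simp only [V, hB, Measure.real, Measure.addHaar_ball_center]
  have h4 : ∫ y in Metric.ball 0 R ∪ B, π y
      = (∫ y in Metric.ball 0 R, π y) + ∫ y in B, π y :=
    setIntegral_union hdisj measurableSet_ball hπi.integrableOn hπi.integrableOn
  have h5 : ∫ y in Metric.ball 0 R ∪ B, π y ≤ ∫ y, π y :=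
    setIntegral_le_integral hπi (Filter.Eventually.of_forall hπ0)
  simp only [id] at hR
  linarith

end Convexity

section RadialFields

variable {d : ℕ} {W φ : EuclideanSpace ℝ (Fin d) → ℝ}

/-- The length of the gradient of the graph of `W`. -/
def gradLen (W : EuclideanSpace ℝ (Fin d) → ℝ) (x : EuclideanSpace ℝ (Fin d)) : ℝ :=
  √(∑ k, pderiv' W k x ^ 2 + 1)

/-- The radial derivative `⟨x, ∇W⟩`. -/
def radialDeriv (W : EuclideanSpace ℝ (Fin d) → ℝ) (x : EuclideanSpace ℝ (Fin d)) : ℝ :=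
  ∑ k, x k * pderiv' W k x

/-- The field `φ (N x - ⟨x, ∇W⟩ ∇W / N)` with `N = √(|∇W|² + 1)`. -/
def radialField (φ W : EuclideanSpace ℝ (Fin d) → ℝ) (i : Fin d)
    (x : EuclideanSpace ℝ (Fin d)) : ℝ :=
  φ x * (gradLen W x * x i - radialDeriv W x * pderiv' W i x * (gradLen W x)⁻¹)

theorem gradLen_pos (x : EuclideanSpace ℝ (Fin d)) : 0 < gradLen W x :=
  Real.sqrt_pos.mpr (by positivity)

theorem gradLen_sq (x : EuclideanSpace ℝ (Fin d)) :
    gradLen W x ^ 2 = ∑ k, pderiv' W k x ^ 2 + 1 :=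
  Real.sq_sqrt (by positivity)

theorem contDiff_coord (i : Fin d) :
    ContDiff ℝ (⊤ : ℕ∞) (fun x : EuclideanSpace ℝ (Fin d) => x i) :=
  (EuclideanSpace.proj (𝕜 := ℝ) i).contDiff

theorem contDiff_gradLen (hW : ContDiff ℝ (⊤ : ℕ∞) W) : ContDiff ℝ (⊤ : ℕ∞) (gradLen W) :=
  ((ContDiff.sum fun i _ => (contDiff_pderiv' hW i).pow 2).add contDiff_const).sqrt
    fun x => by positivity

theorem contDiff_radialDeriv (hW : ContDiff ℝ (⊤ : ℕ∞) W) : ContDiff ℝ (⊤ : ℕ∞) (radialDeriv W) :=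
  ContDiff.sum fun i _ => (contDiff_coord i).mul (contDiff_pderiv' hW i)

theorem contDiff_radialField (hφ : ContDiff ℝ (⊤ : ℕ∞) φ) (hW : ContDiff ℝ (⊤ : ℕ∞) W) (i : Fin d) :
    ContDiff ℝ (⊤ : ℕ∞) (radialField φ W i) :=
  hφ.mul (((contDiff_gradLen hW).mul (contDiff_coord i)).sub
    (((contDiff_radialDeriv hW).mul (contDiff_pderiv' hW i)).mul
      ((contDiff_gradLen hW).inv fun x => (gradLen_pos x).ne')))

theorem pderiv'_gradLen (hW : ContDiff ℝ (⊤ : ℕ∞) W) (i : Fin d) (x : EuclideanSpace ℝ (Fin d)) :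
    pderiv' (gradLen W) i x = (∑ j, pderiv2 W i j x * pderiv' W j x) * (gradLen W x)⁻¹ := by
  have hd : ∀ j, DifferentiableAt ℝ (pderiv' W j) x := fun j =>
    (contDiff_pderiv' hW j).differentiable (by simp) x
  have hΓ : DifferentiableAt ℝ (fun y => ∑ k, pderiv' W k y ^ 2 + 1) x := by fun_prop
  have h0 : ∑ k, pderiv' W k x ^ 2 + 1 ≠ 0 := by positivity
  unfold gradLen
  rw [pderiv'_comp (h := fun t => √t) (Real.hasDerivAt_sqrt h0) hΓ]
  have : pderiv' (fun y => ∑ k, pderiv' W k y ^ 2 + 1) i x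
      = ∑ j, 2 * (pderiv2 W i j x * pderiv' W j x) := by
    rw [pderiv'_add (by fun_prop) (by fun_prop), pderiv'_sum (fun k _ => (hd k).fun_pow 2),
      pderiv'_const, add_zero]
    refine Finset.sum_congr rfl fun k _ => ?_
    rw [pderiv'_pow_two (hd k), pderiv2]
    ring
  rw [this, ← Finset.mul_sum]
  field_simp

theorem pderiv'_radialDeriv (hW : ContDiff ℝ (⊤ : ℕ∞) W) (i : Fin d)
    (x : EuclideanSpace ℝ (Fin d)) :
    pderiv' (radialDeriv W) i x = pderiv' W i x + ∑ j, x j * pderiv2 W i j x := by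
  have hd : ∀ j, DifferentiableAt ℝ (pderiv' W j) x := fun j =>
    (contDiff_pderiv' hW j).differentiable (by simp) x
  have hc : ∀ j, DifferentiableAt ℝ (fun y : EuclideanSpace ℝ (Fin d) => y j) x := fun j =>
    (contDiff_coord j).differentiable (by simp) x
  unfold radialDeriv
  rw [pderiv'_sum fun j _ => (hc j).fun_mul (hd j)]
  have : ∀ j, pderiv' (fun y : EuclideanSpace ℝ (Fin d) => y j * pderiv' W j y) i x
      = (if j = i then pderiv' W j x else 0) + x j * pderiv2 W i j x := by
    intro j
    rw [pderiv'_mul (hc j) (hd j), pderiv'_coord, pderiv2]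
    simp
  simp only [this, Finset.sum_add_distrib]
  simp

theorem divergence_radialField {c : EuclideanSpace ℝ (Fin d) → ℝ} (hφ : ContDiff ℝ (⊤ : ℕ∞) φ)
    (hW : ContDiff ℝ (⊤ : ℕ∞) W) (hφW : ∀ i x, pderiv' φ i x = - c x * pderiv' W i x)
    (x : EuclideanSpace ℝ (Fin d)) :
    ∑ i, pderiv' (radialField φ W i) i x =
      φ x * (d * gradLen W x - (∑ k, pderiv' W k x ^ 2) * (gradLen W x)⁻¹
        - radialDeriv W x * (gradLen W x)⁻¹ * (∑ i, pderiv2 W i i x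
          - ∑ i, ∑ j, pderiv2 W i j x
            * ((pderiv' W i x * (gradLen W x)⁻¹) * (pderiv' W j x * (gradLen W x)⁻¹))))
      - c x * radialDeriv W x * (gradLen W x)⁻¹ := by
  set N := gradLen W x with hN
  set G := radialDeriv W x with hG
  have hN0 : N ≠ 0 := (gradLen_pos x).ne'
  have hN2 : ∑ k, pderiv' W k x ^ 2 = N ^ 2 - 1 := by rw [hN, gradLen_sq]; ring
  have dW : ∀ j, DifferentiableAt ℝ (pderiv' W j) x := fun j =>
    (contDiff_pderiv' hW j).differentiable (by simp) x
  have dc : ∀ j, DifferentiableAt ℝ (fun y : EuclideanSpace ℝ (Fin d) => y j) x := fun j =>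
    (contDiff_coord j).differentiable (by simp) x
  have dN : DifferentiableAt ℝ (gradLen W) x := (contDiff_gradLen hW).differentiable (by simp) x
  have dG : DifferentiableAt ℝ (radialDeriv W) x :=
    (contDiff_radialDeriv hW).differentiable (by simp) x
  have dφ : DifferentiableAt ℝ φ x := hφ.differentiable (by simp) x
  have dNi : DifferentiableAt ℝ (fun y => (gradLen W y)⁻¹) x := dN.fun_inv hN0
  set P : Fin d → ℝ := fun i => ∑ j, pderiv2 W i j x * pderiv' W j x with hP
  set Q : Fin d → ℝ := fun i => ∑ j, x j * pderiv2 W i j x with hQ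
  have term : ∀ i, pderiv' (radialField φ W i) i x =
      (- c x * N) * (x i * pderiv' W i x) + (c x * G * N⁻¹) * pderiv' W i x ^ 2
      + (φ x * N⁻¹) * (P i * x i) + φ x * N - (φ x * N⁻¹) * pderiv' W i x ^ 2
      - (φ x * N⁻¹) * (Q i * pderiv' W i x) - (φ x * G * N⁻¹) * pderiv2 W i i x
      + (φ x * G * N⁻¹ ^ 3) * (P i * pderiv' W i x) := by
    intro i
    have e1 : pderiv' (fun y => (gradLen W y)⁻¹) i x = - (N ^ 2)⁻¹ * (P i * N⁻¹) := by
      rw [pderiv'_comp (h := fun t => t⁻¹) (hasDerivAt_inv hN0) dN, pderiv'_gradLen hW]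
    unfold radialField
    rw [pderiv'_mul dφ ((dN.fun_mul (dc i)).fun_sub ((dG.fun_mul (dW i)).fun_mul dNi)),
      pderiv'_sub (dN.fun_mul (dc i)) ((dG.fun_mul (dW i)).fun_mul dNi),
      pderiv'_mul dN (dc i), pderiv'_mul (dG.fun_mul (dW i)) dNi, pderiv'_mul dG (dW i),
      pderiv'_coord, if_pos rfl, pderiv'_gradLen hW, pderiv'_radialDeriv hW, e1, hφW, ← pderiv2,
      ← hN, ← hG]
    simp only [hP, hQ]
    field_simp
    ring
  have eQ : ∑ i, Q i * pderiv' W i x = ∑ i, P i * x i := by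
    simp only [hP, hQ, Finset.sum_mul]
    rw [Finset.sum_comm]
    refine Finset.sum_congr rfl fun i _ => Finset.sum_congr rfl fun j _ => ?_
    rw [pderiv2, pderiv2, pderiv'_comm hW]
    ring
  have eP : ∑ i, ∑ j, pderiv2 W i j x * ((pderiv' W i x * N⁻¹) * (pderiv' W j x * N⁻¹))
      = N⁻¹ ^ 2 * ∑ i, P i * pderiv' W i x := by
    simp only [hP, Finset.sum_mul, Finset.mul_sum]
    exact Finset.sum_congr rfl fun i _ => Finset.sum_congr rfl fun j _ => by ring
  have eG : ∑ i, x i * pderiv' W i x = G := rfl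
  simp only [term, Finset.sum_add_distrib, Finset.sum_sub_distrib, ← Finset.mul_sum, eQ, eP, eG,
    hN2, Finset.sum_const, Finset.card_univ, Fintype.card_fin, nsmul_eq_mul]
  field_simp
  ring

theorem sqrt_sum_radialField_sq_le (hφ0 : ∀ x, 0 ≤ φ x) (x : EuclideanSpace ℝ (Fin d)) :
    √(∑ i, radialField φ W i x ^ 2) ≤ ‖x‖ * (2 * (φ x * gradLen W x)) := by
  set N := gradLen W x with hN
  have hN0 : 0 < N := gradLen_pos x
  set u : EuclideanSpace ℝ (Fin d) := WithLp.toLp 2 (fun i => pderiv' W i x) with hu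
  have hun : ‖u‖ = √(∑ i, pderiv' W i x ^ 2) := by
    rw [EuclideanSpace.norm_eq]; simp [hu]
  have huN : ‖u‖ ≤ N := by
    rw [hun, hN, gradLen]
    exact Real.sqrt_le_sqrt (by linarith)
  have hG : |radialDeriv W x| ≤ ‖x‖ * ‖u‖ := by
    rw [hun, EuclideanSpace.norm_eq]
    simpa [radialDeriv] using abs_sum_mul_le_sqrt (fun i => x i) (fun i => pderiv' W i x)
  have e : √(∑ i, radialField φ W i x ^ 2)
      = ‖φ x • (N • x - (radialDeriv W x * N⁻¹) • u)‖ := by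
    rw [EuclideanSpace.norm_eq]
    congr 1
    refine Finset.sum_congr rfl fun i _ => ?_
    simp only [radialField, PiLp.smul_apply, PiLp.sub_apply, smul_eq_mul, Real.norm_eq_abs, sq_abs,
      hu, ← hN]
    ring
  rw [e, norm_smul, Real.norm_of_nonneg (hφ0 x)]
  have h1 : ‖N • x - (radialDeriv W x * N⁻¹) • u‖ ≤ 2 * (N * ‖x‖) := by
    refine (norm_sub_le _ _).trans ?_
    rw [norm_smul, norm_smul, Real.norm_of_nonneg hN0.le, norm_mul, norm_inv,
      Real.norm_of_nonneg hN0.le, Real.norm_eq_abs]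
    have h2 : |radialDeriv W x| * N⁻¹ * ‖u‖ ≤ ‖x‖ * ‖u‖ * N⁻¹ * ‖u‖ := by gcongr
    have h3 : ‖x‖ * ‖u‖ * N⁻¹ * ‖u‖ ≤ ‖x‖ * N * N⁻¹ * N := by gcongr
    have h4 : ‖x‖ * N * N⁻¹ * N = N * ‖x‖ := by field_simp
    linarith
  calc _ ≤ φ x * (2 * (N * ‖x‖)) := mul_le_mul_of_nonneg_left h1 (hφ0 x)
    _ = _ := by ring

end RadialFields

section DriftIntegrability

variable {d : ℕ} {π : EuclideanSpace ℝ (Fin d) → ℝ}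
  {γ : EuclideanSpace ℝ (Fin d) → EuclideanSpace ℝ (Fin d)}

theorem integrable_norm_drift_sq_of_two_le (hd : 2 ≤ d)
    (hπ : ContDiff ℝ (⊤ : ℕ∞) π) (hpos : ∀ x, 0 < π x) (hπi : Integrable π)
    (hγ : ContDiff ℝ (⊤ : ℕ∞) γ) {lam : ℝ} (hlam : 0 < lam)
    (hcond : ∀ (x v : EuclideanSpace ℝ (Fin d)),
      lam * ‖v‖ ^ 2 ≤ ∑ i, ∑ j, Rtensor π γ i j x * v i * v j) :
    Integrable (fun x => ‖γ x‖ ^ 2 * π x) := by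
  have hd' : (2 : ℝ) ≤ d := by exact_mod_cast hd
  set a : ℝ := (d : ℝ) - 3 / 2 with ha
  have ha0 : 0 < a := by linarith
  set W := densityPower π a with hWdef
  have hW : ContDiff ℝ (⊤ : ℕ∞) W := contDiff_densityPower hπ hpos a
  have hW0 : ∀ x, 0 < W x := densityPower_pos a
  have hH := hessian_densityPower_lower_bound hπ hpos hcond ha ha0
  have hγ2 : ∀ x, 0 ≤ ∑ k, γ x k ^ 2 := fun x => Finset.sum_nonneg fun _ _ => sq_nonneg _
  have hH0 : ∀ x (v : Fin d → ℝ), 0 ≤ ∑ i, ∑ j, pderiv2 W i j x * (v i * v j) := fun x v =>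
    (mul_nonneg (mul_nonneg (div_nonneg (hW0 x).le ha0.le) (by linarith [hγ2 x]))
      (Finset.sum_nonneg fun _ _ => sq_nonneg _)).trans (hH x v)
  obtain ⟨S, hS⟩ : ∃ S, ∀ x : EuclideanSpace ℝ (Fin d), ‖x‖ ≤ 1 → W x ≤ S := by
    obtain ⟨S, hS⟩ := (isCompact_closedBall (0 : EuclideanSpace ℝ (Fin d)) 1).exists_bound_of_continuousOn
      hW.continuous.continuousOn
    exact ⟨S, fun x hx => (le_abs_self _).trans (hS x (by simpa using hx))⟩
  have hS0 : 0 < S := (hW0 0).trans_le (hS 0 (by simp))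
  obtain ⟨R, hR⟩ := bounded_sublevel_of_midpoint_le (W := W) (S := S + 1)
    (c := Real.exp (-a * Real.log (S + 1))) (fun x => (hpos x).le) hπi
    (midpoint_le_of_hessian_nonneg hW hH0) (Real.exp_pos _) (fun x hx => by linarith [hS x hx])
    (fun x hx => by
      rw [← Real.exp_log (hpos x)]
      refine Real.exp_le_exp.mpr ?_
      have h1 := Real.log_le_log (hW0 x) hx
      rw [hWdef, densityPower, Real.log_exp] at h1
      have h2 := mul_le_mul_of_nonneg_left h1 ha0.le
      have h3 : a * (-a⁻¹ * Real.log (π x)) = - Real.log (π x) := by field_simp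
      linarith)
  have hrad : ∀ x : EuclideanSpace ℝ (Fin d), R + 1 ≤ ‖x‖ → gradLen W x ≤ radialDeriv W x := by
    intro x hx
    have h1 : S + 1 ≤ W x := by
      by_contra! h
      linarith [hR x h.le]
    have h2 := sqrt_sum_add_le_radial_of_hessian_nonneg hW hH0 hS x
    have h3 : gradLen W x ≤ √(∑ i, pderiv' W i x ^ 2) + 1 := by
      unfold gradLen
      rw [Real.sqrt_le_left (by positivity)]
      have := Real.sq_sqrt (show 0 ≤ ∑ i, pderiv' W i x ^ 2 by positivity)
      nlinarith [Real.sqrt_nonneg (∑ i, pderiv' W i x ^ 2)]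
    unfold radialDeriv
    linarith
  set φ : EuclideanSpace ℝ (Fin d) → ℝ := fun x => π x * (W x)⁻¹ with hφdef
  have hφ : ContDiff ℝ (⊤ : ℕ∞) φ := hπ.mul (hW.inv fun x => (hW0 x).ne')
  have hφ0 : ∀ x, 0 < φ x := fun x => mul_pos (hpos x) (inv_pos.mpr (hW0 x))
  have hWπ : ∀ i x, φ x * pderiv' W i x = - a⁻¹ * pderiv' π i x := by
    intro i x
    rw [hWdef, pderiv'_densityPower hπ hpos, pderiv'_density hπ hpos, ← hWdef, hφdef]
    have := (hW0 x).ne'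
    field_simp
  have hφN : Integrable (fun x => φ x * gradLen W x) := by
    refine integrable_of_le_sub_divergence (B := fun x => a⁻¹ * d * π x)
      (B' := fun x => a⁻¹ * π x) (Z := fun i x => a⁻¹ * π x * x i) (R₀ := R + 1)
      (hφ.continuous.mul (contDiff_gradLen hW).continuous)
      (fun x => (mul_pos (hφ0 x) (gradLen_pos x)).le) (hπi.const_mul _)
      (continuous_const.mul hπ.continuous) (hπi.const_mul _)
      (fun i => ((contDiff_const.mul hπ).mul (contDiff_coord i)).of_le (by simp))
      (fun x => ?_) fun x hx => ?_
    · simp only [mul_pow _ _ 2, ← Finset.mul_sum]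
      rw [Real.sqrt_mul (by positivity), ← mul_pow, Real.sqrt_sq (by have := hpos x; positivity),
        EuclideanSpace.norm_eq]
      simp [mul_comm]
    · have e : ∀ i, pderiv' (fun x : EuclideanSpace ℝ (Fin d) => a⁻¹ * π x * x i) i x
          = a⁻¹ * π x - x i * (φ x * pderiv' W i x) := by
        intro i
        have dπ := hπ.differentiable (by simp) x
        rw [pderiv'_mul (dπ.const_mul _) ((contDiff_coord i).differentiable (by simp) x),
          pderiv'_const_mul dπ, pderiv'_coord, hWπ]
        simp; ring
      simp only [e, Finset.sum_sub_distrib, Finset.sum_const, Finset.card_univ, Fintype.card_fin,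
        nsmul_eq_mul]
      have h1 := mul_le_mul_of_nonneg_left (hrad x hx) (hφ0 x).le
      have e2 : ∑ i, x i * (φ x * pderiv' W i x) = φ x * radialDeriv W x := by
        rw [radialDeriv, Finset.mul_sum]
        exact Finset.sum_congr rfl fun i _ => by ring
      rw [e2]
      linarith
  set k : ℝ := 8 * a / (d - 1) with hk
  have hk0 : 0 < k := by
    have : (0 : ℝ) < d - 1 := by linarith
    positivity
  have hn : ∀ x, ‖γ x‖ ^ 2 = ∑ i, γ x i ^ 2 := fun x => by
    rw [EuclideanSpace.norm_sq_eq]; simp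
  have hcW : ∀ i x, pderiv' φ i x = - (φ x * (a + 1) * (W x)⁻¹) * pderiv' W i x := by
    intro i x
    have dW := hW.differentiable (by simp) x
    have e1 : pderiv' π i x = - a * (φ x * pderiv' W i x) := by
      rw [hWπ]; field_simp
    have hw := (hW0 x).ne'
    rw [hφdef, pderiv'_mul (hπ.differentiable (by simp) x) (dW.fun_inv hw),
      pderiv'_comp (h := fun t => t⁻¹) (hasDerivAt_inv hw) dW, e1, hφdef]
    field_simp
    ring
  refine integrable_of_le_sub_divergence (B := fun x => k * d * (φ x * gradLen W x))
    (B' := fun x => k * (2 * (φ x * gradLen W x))) (Z := fun i x => k * radialField φ W i x)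
    (R₀ := R + 1) ((hγ.continuous.norm.pow 2).mul hπ.continuous)
    (fun x => mul_nonneg (sq_nonneg _) (hpos x).le) (hφN.const_mul _)
    (continuous_const.mul (hφ.continuous.mul (contDiff_gradLen hW).continuous))
    ((hφN.const_mul 2).const_mul k)
    (fun i => (contDiff_const.mul (contDiff_radialField hφ hW i)).of_le (by simp))
    (fun x => ?_) fun x hx => ?_
  · simp only [mul_pow _ _ 2, ← Finset.mul_sum]
    rw [Real.sqrt_mul (by positivity), Real.sqrt_sq hk0.le]
    have := mul_le_mul_of_nonneg_left
      (sqrt_sum_radialField_sq_le (W := W) (fun x => (hφ0 x).le) x) hk0.le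
    linarith
  · have e : ∀ i, pderiv' (fun x => k * radialField φ W i x) i x
        = k * pderiv' (radialField φ W i) i x := fun i =>
      pderiv'_const_mul ((contDiff_radialField hφ hW i).differentiable (by simp) x) k i
    simp only [e, ← Finset.mul_sum]
    rw [divergence_radialField hφ hW hcW x, hn]
    set N := gradLen W x with hN
    have hN0 : 0 < N := gradLen_pos x
    have hG : N ≤ radialDeriv W x := hrad x hx
    set G := radialDeriv W x
    set g2 := ∑ i, γ x i ^ 2 with hg2
    set β := W x / a * (lam + g2 / 8) with hβ
    have hW0x := hW0 x
    have hβ0 : 0 ≤ β := by have := hγ2 x; positivity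
    have hm : ∑ i, (pderiv' W i x * N⁻¹) ^ 2 ≤ 1 := by
      simp only [mul_pow, ← Finset.sum_mul]
      rw [inv_pow, ← div_eq_mul_inv, div_le_one (by positivity), hN, gradLen_sq]
      linarith
    have htr := le_trace_sub_of_quadratic_lower_bound hβ0 (fun v => hH x v) hm
    set T := ∑ i, pderiv2 W i i x - ∑ i, ∑ j, pderiv2 W i j x
            * ((pderiv' W i x * N⁻¹) * (pderiv' W j x * N⁻¹))
    have hGN : 1 ≤ G * N⁻¹ := by rwa [← div_eq_mul_inv, one_le_div hN0]
    have hT0 : 0 ≤ β * ((d : ℝ) - 1) := mul_nonneg hβ0 (by linarith)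
    have h1 : β * ((d : ℝ) - 1) ≤ G * N⁻¹ * T :=
      htr.trans (le_mul_of_one_le_left (hT0.trans htr) hGN)
    have hφx := hφ0 x
    have h2 : 0 ≤ φ x * (a + 1) * (W x)⁻¹ * G * N⁻¹ := by
      have : 0 < G := hN0.trans_le hG
      positivity
    have h3 : 0 ≤ (∑ k, pderiv' W k x ^ 2) * N⁻¹ := by positivity
    have h4 : g2 * π x ≤ k * (φ x * (β * ((d : ℝ) - 1))) := by
      have : k * (φ x * (β * ((d : ℝ) - 1))) = 8 * lam * π x + g2 * π x := by
        have h5 : (d : ℝ) - 1 ≠ 0 := by linarith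
        rw [hk, hβ, hφdef]
        field_simp
      rw [this]
      have := hpos x
      have : 0 ≤ 8 * lam * π x := by positivity
      linarith
    have h5 : φ x * (β * ((d : ℝ) - 1)) ≤ φ x * (G * N⁻¹ * T + (∑ k, pderiv' W k x ^ 2) * N⁻¹)
        + φ x * (a + 1) * (W x)⁻¹ * G * N⁻¹ := by
      have := mul_le_mul_of_nonneg_left (h1.trans (le_add_of_nonneg_right h3)) hφx.le
      linarith
    have h6 := mul_le_mul_of_nonneg_left h5 hk0.le
    linarith

end DriftIntegrability

section OneDimensional

theorem flux_nonpos_of_deriv_le {p M M' : ℝ → ℝ} {c lam : ℝ} (hlam : 0 < lam)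
    (hp : ∀ t, 0 < p t) (hp' : ∀ t, HasDerivAt p (p t * M t - c) t)
    (hM : ∀ t, HasDerivAt M (M' t) t) (hM' : ∀ t, M' t ≤ -lam) : c ≤ 0 := by
  by_contra! hc
  have hMd : ∀ t, 0 ≤ t → M t ≤ M 0 - lam * t := fun t ht => by
    have := image_sub_le_mul_sub_of_deriv_le (fun t => (hM t).differentiableAt) (C := -lam)
      (fun t => by rw [(hM t).deriv]; exact hM' t) ht
    linarith
  set T := |M 0| / lam with hT
  have hT0 : 0 ≤ T := by positivity
  have hMT : ∀ t, T ≤ t → M t ≤ 0 := fun t ht => by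
    have h1 := hMd t (hT0.trans ht)
    rw [hT, div_le_iff₀ hlam] at ht
    linarith [le_abs_self (M 0)]
  have := (convex_Ici T).image_sub_le_mul_sub_of_deriv_le
    (fun t _ => (hp' t).continuousAt.continuousWithinAt)
    (fun t _ => (hp' t).differentiableAt.differentiableWithinAt) (C := -c)
    (fun t ht => by
      rw [(hp' t).deriv]
      rw [interior_Ici] at ht
      nlinarith [hp t, hMT t (le_of_lt ht)]) T Set.self_mem_Ici (T + p T / c)
    (Set.mem_Ici.mpr (by have := hp T; have : 0 < p T / c := by positivity
                         linarith)) (by have := hp T; have : 0 < p T / c := by positivity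
                                        linarith)
  have e : -c * (T + p T / c - T) = - p T := by field_simp; ring
  linarith [hp (T + p T / c)]

variable {π : EuclideanSpace ℝ (Fin 1) → ℝ}
  {γ : EuclideanSpace ℝ (Fin 1) → EuclideanSpace ℝ (Fin 1)}

theorem drift_eq_zero_of_one_dimensional
    (hπ : ContDiff ℝ (⊤ : ℕ∞) π) (hpos : ∀ x, 0 < π x)
    (hγ : ContDiff ℝ (⊤ : ℕ∞) γ)
    (hstat : ∀ x, ∑ i, pderiv' (fun y => π y * γ y i) i x = 0)
    {lam : ℝ} (hlam : 0 < lam)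
    (hcond : ∀ (x v : EuclideanSpace ℝ (Fin 1)),
      lam * ‖v‖ ^ 2 ≤ ∑ i, ∑ j, Rtensor π γ i j x * v i * v j) (x : EuclideanSpace ℝ (Fin 1)) :
    γ x = 0 := by
  set e : EuclideanSpace ℝ (Fin 1) := EuclideanSpace.single 0 1 with he
  have hline : ∀ t : ℝ, HasDerivAt (fun s : ℝ => s • e) e t := fun t => by
    simpa using (hasDerivAt_id t).smul_const e
  have hcomp : ∀ {f : EuclideanSpace ℝ (Fin 1) → ℝ}, ContDiff ℝ (⊤ : ℕ∞) f → ∀ t : ℝ,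
      HasDerivAt (fun s : ℝ => f (s • e)) (pderiv' f 0 (t • e)) t := fun hf t =>
    ((hf.differentiable (by simp)) (t • e)).hasFDerivAt.comp_hasDerivAt t (hline t)
  have hL := contDiff_log_density hπ hpos
  set L := fun y => Real.log (π y) with hLdef
  have hγ0 : ContDiff ℝ (⊤ : ℕ∞) (fun y => γ y 0) := (contDiff_coord 0).comp hγ
  obtain ⟨c, hc⟩ : ∃ c, ∀ t : ℝ, π (t • e) * γ (t • e) 0 = c := by
    refine ⟨π ((0 : ℝ) • e) * γ ((0 : ℝ) • e) 0, fun t => ?_⟩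
    refine is_const_of_deriv_eq_zero (f := fun t : ℝ => π (t • e) * γ (t • e) 0)
      (fun s => (hcomp (hπ.mul hγ0) s).differentiableAt) (fun s => ?_) _ _
    rw [(hcomp (hπ.mul hγ0) s).deriv]
    simpa using hstat (s • e)
  have hp' : ∀ t, HasDerivAt (fun t : ℝ => π (t • e))
      (π (t • e) * (pderiv' L 0 (t • e) + γ (t • e) 0) - c) t := fun t => by
    have := hcomp hπ t
    rw [pderiv'_density hπ hpos] at this
    convert this using 1
    rw [← hc t]; ring
  have hγ' : ∀ t : ℝ, pderiv' (fun y => γ y 0) 0 (t • e)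
      = - (pderiv' L 0 (t • e) * γ (t • e) 0) := fun t => by
    have h1 := hstat (t • e)
    rw [Fin.sum_univ_one, pderiv'_mul (hπ.differentiable (by simp) _)
      (hγ0.differentiable (by simp) _), pderiv'_density hπ hpos] at h1
    have h2 : π (t • e) * (pderiv' L 0 (t • e) * γ (t • e) 0
      + pderiv' (fun y => γ y 0) 0 (t • e)) = 0 := by rw [← h1]; ring
    rcases mul_eq_zero.mp h2 with h | h
    · exact absurd h (hpos _).ne'
    · linarith
  have hM : ∀ t, HasDerivAt (fun t : ℝ => pderiv' L 0 (t • e) + γ (t • e) 0)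
      (pderiv2 L 0 0 (t • e) - pderiv' L 0 (t • e) * γ (t • e) 0) t := fun t => by
    have := (hcomp (contDiff_pderiv' hL 0) t).add (hcomp hγ0 t)
    rw [hγ' t] at this
    exact this
  have hM' : ∀ t : ℝ, pderiv2 L 0 0 (t • e) - pderiv' L 0 (t • e) * γ (t • e) 0 ≤ -lam := by
    intro t
    have h := hcond (t • e) e
    rw [sum_Rtensor_mul] at h
    simp only [Fin.sum_univ_one, he, PiLp.norm_single] at h
    norm_num at h
    simp only [← he, ← hLdef] at h
    linarith
  have h1 : c ≤ 0 := flux_nonpos_of_deriv_le hlam (fun t => hpos _) hp' hM hM'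
  have h2 : -c ≤ 0 := by
    refine flux_nonpos_of_deriv_le (p := fun t : ℝ => π ((-t) • e))
      (M := fun t => -(pderiv' L 0 ((-t) • e) + γ ((-t) • e) 0)) hlam (fun t => hpos _)
      (fun t => ?_) (fun t => ?_) (fun t => hM' (-t))
    · have := (hp' (-t)).comp t (hasDerivAt_neg t)
      exact this.congr_deriv (by ring)
    · have := ((hM (-t)).comp t (hasDerivAt_neg t)).neg
      exact this.congr_deriv (by ring)
  have hx : x = (x 0) • e := by
    ext j; fin_cases j; simp [he]
  have h3 := hc (x 0)
  rw [← hx] at h3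
  have h4 : γ x 0 = 0 := by
    rcases mul_eq_zero.mp (h3.trans (le_antisymm h1 (by linarith))) with h | h
    · exact absurd h (hpos _).ne'
    · exact h
  ext j; fin_cases j; simpa using h4

end OneDimensional

theorem integrable_norm_drift_sq {d : ℕ} (hd : 1 ≤ d) {π : EuclideanSpace ℝ (Fin d) → ℝ}
    {γ : EuclideanSpace ℝ (Fin d) → EuclideanSpace ℝ (Fin d)}
    (hπ : ContDiff ℝ (⊤ : ℕ∞) π) (hpos : ∀ x, 0 < π x) (hπi : Integrable π)
    (hγ : ContDiff ℝ (⊤ : ℕ∞) γ)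
    (hstat : ∀ x, ∑ i, pderiv' (fun y => π y * γ y i) i x = 0)
    {lam : ℝ} (hlam : 0 < lam)
    (hcond : ∀ (x v : EuclideanSpace ℝ (Fin d)),
      lam * ‖v‖ ^ 2 ≤ ∑ i, ∑ j, Rtensor π γ i j x * v i * v j) :
    Integrable (fun x => ‖γ x‖ ^ 2 * π x) := by
  obtain rfl | h := hd.eq_or_lt
  · simp [drift_eq_zero_of_one_dimensional hπ hpos hγ hstat hlam hcond]
  · exact integrable_norm_drift_sq_of_two_le h hπ hpos hπi hγ hlam hcond

section SobolevSpace

variable {d : ℕ}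

/-- The gradient as a vector in Euclidean space. -/
def grad (f : EuclideanSpace ℝ (Fin d) → ℝ) (x : EuclideanSpace ℝ (Fin d)) :
    EuclideanSpace ℝ (Fin d) :=
  WithLp.toLp 2 fun i => pderiv' f i x

theorem norm_grad_sq (f : EuclideanSpace ℝ (Fin d) → ℝ) (x : EuclideanSpace ℝ (Fin d)) :
    ‖grad f x‖ ^ 2 = ∑ i, pderiv' f i x ^ 2 := by
  simp [EuclideanSpace.norm_sq_eq, grad]

theorem norm_grad_le (f : EuclideanSpace ℝ (Fin d) → ℝ) (x : EuclideanSpace ℝ (Fin d)) :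
    ‖grad f x‖ ≤ ‖fderiv ℝ f x‖ := by
  have := sqrt_sum_pderiv'_sq_le (f := f) x
  rwa [← norm_grad_sq, Real.sqrt_sq (norm_nonneg _)] at this

theorem continuous_grad {f : EuclideanSpace ℝ (Fin d) → ℝ} (hf : ContDiff ℝ (⊤ : ℕ∞) f) :
    Continuous (grad f) := by
  unfold grad
  refine (PiLp.continuous_toLp 2 _).comp (continuous_pi fun i => (contDiff_pderiv' hf i).continuous)

/-- Smooth functions which are bounded together with their first derivative. -/
def testSpace (d : ℕ) : Submodule ℝ (EuclideanSpace ℝ (Fin d) → ℝ) where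
  carrier := {f | ContDiff ℝ (⊤ : ℕ∞) f ∧ ∃ C, ∀ x, |f x| ≤ C ∧ ‖fderiv ℝ f x‖ ≤ C}
  add_mem' := by
    rintro f g ⟨hf, C, hC⟩ ⟨hg, C', hC'⟩
    refine ⟨hf.add hg, C + C', fun x => ⟨(abs_add_le _ _).trans (add_le_add (hC x).1 (hC' x).1), ?_⟩⟩
    rw [fderiv_add (hf.differentiable (by simp) x) (hg.differentiable (by simp) x)]
    exact (norm_add_le _ _).trans (add_le_add (hC x).2 (hC' x).2)
  zero_mem' := ⟨contDiff_const, 0, fun x => by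
    have : fderiv ℝ (0 : EuclideanSpace ℝ (Fin d) → ℝ) x = 0 := by simp
    simp [this]⟩
  smul_mem' := by
    rintro c f ⟨hf, C, hC⟩
    refine ⟨contDiff_const.smul hf, |c| * C, fun x => ⟨?_, ?_⟩⟩
    · simpa [abs_mul] using mul_le_mul_of_nonneg_left (hC x).1 (abs_nonneg c)
    · rw [fderiv_const_smul (hf.differentiable (by simp) x), norm_smul]
      exact mul_le_mul_of_nonneg_left (hC x).2 (abs_nonneg c)

theorem mem_testSpace_of_hasCompactSupport {f : EuclideanSpace ℝ (Fin d) → ℝ}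
    (hf : ContDiff ℝ (⊤ : ℕ∞) f) (hc : HasCompactSupport f) : f ∈ testSpace d := by
  obtain ⟨C, hC⟩ := hc.exists_bound_of_continuous hf.continuous
  obtain ⟨C', hC'⟩ := (hc.fderiv (𝕜 := ℝ)).exists_bound_of_continuous
    (hf.continuous_fderiv (by simp))
  exact ⟨hf, max C C', fun x => ⟨(hC x).trans (le_max_left _ _), (hC' x).trans (le_max_right _ _)⟩⟩

theorem const_mem_testSpace (c : ℝ) : (fun _ => c) ∈ testSpace d :=
  ⟨contDiff_const, |c|, fun x => by simp⟩

theorem comp_mem_testSpace {T : ℝ → ℝ} (hT : ContDiff ℝ (⊤ : ℕ∞) T)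
    {f : EuclideanSpace ℝ (Fin d) → ℝ} (hf : f ∈ testSpace d) :
    (fun x => T (f x)) ∈ testSpace d := by
  obtain ⟨hf, C, hC⟩ := hf
  obtain ⟨A, hA⟩ := (isCompact_Icc (a := -C) (b := C)).exists_bound_of_continuousOn
    hT.continuous.continuousOn
  obtain ⟨B, hB⟩ := (isCompact_Icc (a := -C) (b := C)).exists_bound_of_continuousOn
    (hT.continuous_deriv (by simp)).continuousOn
  have hC0 : 0 ≤ C := (abs_nonneg _).trans (hC 0).1
  have hB0 : 0 ≤ B := (norm_nonneg _).trans (hB 0 ⟨by linarith, hC0⟩)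
  refine ⟨hT.comp hf, max A (B * C), fun x => ⟨?_, ?_⟩⟩
  · exact (hA _ (abs_le.mp (hC x).1)).trans (le_max_left _ _)
  · have := ((hT.differentiable (by simp) (f x)).hasDerivAt.comp_hasFDerivAt x
      (hf.differentiable (by simp) x).hasFDerivAt).fderiv
    simp only [Function.comp_def] at this
    rw [this, norm_smul]
    exact (mul_le_mul (hB _ (abs_le.mp (hC x).1)) (hC x).2 (norm_nonneg _) hB0).trans
      (le_max_right _ _)

variable {μ : Measure (EuclideanSpace ℝ (Fin d))} [IsFiniteMeasure μ]

theorem memLp_of_mem_testSpace {f : EuclideanSpace ℝ (Fin d) → ℝ} (hf : f ∈ testSpace d) :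
    MemLp f 2 μ := by
  obtain ⟨hf, C, hC⟩ := hf
  exact MemLp.of_bound hf.continuous.aestronglyMeasurable C
    (Filter.Eventually.of_forall fun x => (hC x).1)

theorem memLp_grad_of_mem_testSpace {f : EuclideanSpace ℝ (Fin d) → ℝ} (hf : f ∈ testSpace d) :
    MemLp (grad f) 2 μ := by
  obtain ⟨hf, C, hC⟩ := hf
  exact MemLp.of_bound (continuous_grad hf).aestronglyMeasurable C
    (Filter.Eventually.of_forall fun x => (norm_grad_le f x).trans (hC x).2)

theorem grad_add {f g : EuclideanSpace ℝ (Fin d) → ℝ} (hf : f ∈ testSpace d)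
    (hg : g ∈ testSpace d) : grad (f + g) = grad f + grad g := by
  ext x i
  exact pderiv'_add (hf.1.differentiable (by simp) x) (hg.1.differentiable (by simp) x) i

theorem grad_smul (c : ℝ) {f : EuclideanSpace ℝ (Fin d) → ℝ} (hf : f ∈ testSpace d) :
    grad (c • f) = c • grad f := by
  ext x i
  exact pderiv'_const_mul (hf.1.differentiable (by simp) x) c i

/-- Functions in `L²(μ)` paired with vector fields in `L²(μ)`. -/
abbrev PairSpace (μ : Measure (EuclideanSpace ℝ (Fin d))) : Type :=
  WithLp 2 (Lp ℝ 2 μ × Lp (EuclideanSpace ℝ (Fin d)) 2 μ)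

/-- The map `ψ ↦ (ψ, s ∇ψ)` on test functions. -/
def gradPair (μ : Measure (EuclideanSpace ℝ (Fin d))) [IsFiniteMeasure μ] (s : ℝ) :
    testSpace d →ₗ[ℝ] PairSpace μ where
  toFun ψ := WithLp.toLp 2 ((memLp_of_mem_testSpace ψ.2).toLp ψ.1,
    s • (memLp_grad_of_mem_testSpace ψ.2).toLp (grad ψ.1))
  map_add' ψ χ := by
    have h1 : (memLp_grad_of_mem_testSpace (μ := μ) (ψ + χ).2).toLp (grad (ψ + χ).1)
        = (memLp_grad_of_mem_testSpace ψ.2).toLp (grad ψ.1)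
          + (memLp_grad_of_mem_testSpace χ.2).toLp (grad χ.1) := by
      rw [← MemLp.toLp_add]
      exact MemLp.toLp_congr _ _ (Filter.Eventually.of_forall fun x =>
        congrFun (grad_add ψ.2 χ.2) x)
    rw [h1, smul_add]
    rfl
  map_smul' c ψ := by
    have h1 : (memLp_grad_of_mem_testSpace (μ := μ) (c • ψ).2).toLp (grad (c • ψ).1)
        = c • (memLp_grad_of_mem_testSpace ψ.2).toLp (grad ψ.1) := by
      rw [← MemLp.toLp_const_smul]
      exact MemLp.toLp_congr _ _ (Filter.Eventually.of_forall fun x =>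
        congrFun (grad_smul c ψ.2) x)
    rw [h1, smul_comm]
    rfl

/-- The weighted Sobolev space: the closure of the pairs `(ψ, s ∇ψ)`. -/
def sobolevSpace (μ : Measure (EuclideanSpace ℝ (Fin d))) [IsFiniteMeasure μ] (s : ℝ) :
    Submodule ℝ (PairSpace μ) :=
  (LinearMap.range (gradPair μ s)).topologicalClosure

theorem gradPair_mem_sobolevSpace (s : ℝ) (ψ : testSpace d) : gradPair μ s ψ ∈ sobolevSpace μ s :=
  Submodule.le_topologicalClosure _ ⟨ψ, rfl⟩

theorem exists_tendsto_gradPair {s : ℝ} {U : PairSpace μ} (hU : U ∈ sobolevSpace μ s) :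
    ∃ ψ : ℕ → testSpace d, Filter.Tendsto (fun n => gradPair μ s (ψ n)) Filter.atTop (nhds U) := by
  obtain ⟨W, hW, hlim⟩ := mem_closure_iff_seq_limit.mp
    (show U ∈ closure (LinearMap.range (gradPair μ s) : Set (PairSpace μ)) from hU)
  choose ψ hψ using hW
  exact ⟨ψ, by simpa only [hψ] using hlim⟩

theorem exists_resolvent (s : ℝ) (g : Lp ℝ 2 μ) : ∃ U ∈ sobolevSpace μ s,
    ∀ V ∈ sobolevSpace μ s, ⟪U.fst - g, V.fst⟫_ℝ + ⟪U.snd, V.snd⟫_ℝ = 0 := by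
  have hcl : IsClosed (sobolevSpace μ s : Set (PairSpace μ)) :=
    Submodule.isClosed_topologicalClosure _
  have : CompleteSpace (sobolevSpace μ s) := hcl.completeSpace_coe
  set P : PairSpace μ := WithLp.toLp 2 (g, 0) with hP
  refine ⟨(sobolevSpace μ s).starProjection P, Submodule.starProjection_apply_mem _ _,
    fun V hV => ?_⟩
  have := Submodule.starProjection_inner_eq_zero P V hV
  rw [WithLp.prod_inner_apply] at this
  have h1 : ⟪g - ((sobolevSpace μ s).starProjection P).fst, V.fst⟫_ℝ
    + ⟪0 - ((sobolevSpace μ s).starProjection P).snd, V.snd⟫_ℝ = 0 := this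
  rw [zero_sub, inner_neg_left, ← neg_sub, inner_neg_left] at h1
  linarith

end SobolevSpace

section MaximumPrinciple

variable {d : ℕ} {μ : Measure (EuclideanSpace ℝ (Fin d))} [IsFiniteMeasure μ]

theorem grad_comp {T : ℝ → ℝ} (hT : ContDiff ℝ (⊤ : ℕ∞) T) {f : EuclideanSpace ℝ (Fin d) → ℝ}
    (hf : ContDiff ℝ (⊤ : ℕ∞) f) (x : EuclideanSpace ℝ (Fin d)) :
    grad (fun x => T (f x)) x = deriv T (f x) • grad f x := by
  ext i
  have := ((hT.differentiable (by simp) (f x)).hasDerivAt.comp_hasFDerivAt x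
    (hf.differentiable (by simp) x).hasFDerivAt).fderiv
  simp only [Function.comp_def] at this
  simp [grad, pderiv', this]

/-- A smooth nondecreasing `1`-Lipschitz function vanishing exactly on `(-∞, 0]`. -/
theorem exists_smooth_positive_part : ∃ T : ℝ → ℝ, ContDiff ℝ (⊤ : ℕ∞) T ∧
    (∀ y, 0 ≤ deriv T y) ∧ (∀ y, deriv T y ≤ 1) ∧ (∀ y ≤ 0, T y = 0) ∧ ∀ y, 0 < y → 0 < T y := by
  have hc : Continuous Real.smoothTransition := Real.smoothTransition.continuous
  have hd : ∀ y, HasDerivAt (fun y => ∫ t in (0:ℝ)..y, Real.smoothTransition t)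
      (Real.smoothTransition y) y := fun y => hc.integral_hasStrictDerivAt 0 y |>.hasDerivAt
  have hd' : deriv (fun y => ∫ t in (0:ℝ)..y, Real.smoothTransition t)
      = Real.smoothTransition := funext fun y => (hd y).deriv
  refine ⟨fun y => ∫ t in (0:ℝ)..y, Real.smoothTransition t, ?_, ?_, ?_, ?_, ?_⟩
  · rw [contDiff_infty_iff_deriv, hd']
    exact ⟨fun y => (hd y).differentiableAt, Real.smoothTransition.contDiff⟩
  · intro y; rw [hd']; exact Real.smoothTransition.nonneg y
  · intro y; rw [hd']; exact Real.smoothTransition.le_one y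
  · intro y hy
    change ∫ t in (0:ℝ)..y, Real.smoothTransition t = 0
    rw [intervalIntegral.integral_symm, neg_eq_zero]
    refine (intervalIntegral.integral_congr (g := fun _ => 0) fun t ht => ?_).trans (by simp)
    rw [Set.uIcc_of_le hy] at ht
    exact Real.smoothTransition.zero_of_nonpos ht.2
  · intro y hy
    exact intervalIntegral.intervalIntegral_pos_of_pos_on (hc.intervalIntegrable _ _)
      (fun t ht => Real.smoothTransition.pos_of_pos ht.1) hy

theorem gradPair_fst (s : ℝ) (ψ : testSpace d) : (gradPair μ s ψ).fst =ᵐ[μ] ψ.1 :=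
  MemLp.coeFn_toLp (memLp_of_mem_testSpace ψ.2)

theorem gradPair_snd (s : ℝ) (ψ : testSpace d) :
    (gradPair μ s ψ).snd =ᵐ[μ] fun x => s • grad ψ.1 x := by
  refine (Lp.coeFn_smul _ _).trans ?_
  filter_upwards [MemLp.coeFn_toLp (memLp_grad_of_mem_testSpace (μ := μ) ψ.2)] with x hx
  simp [hx]

theorem exists_const_mem_sobolevSpace (s c : ℝ) : ∃ W ∈ sobolevSpace μ s,
    (W.fst =ᵐ[μ] fun _ => c) ∧ W.snd = 0 := by
  refine ⟨_, gradPair_mem_sobolevSpace s ⟨_, const_mem_testSpace c⟩, gradPair_fst _ _, ?_⟩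
  refine Lp.ext ((gradPair_snd _ _).trans ?_)
  filter_upwards [Lp.coeFn_zero (EuclideanSpace ℝ (Fin d)) 2 μ] with x hx
  rw [hx]
  ext i
  simp [grad, pderiv']

theorem inner_compLp_nonpos {s : ℝ} {U : PairSpace μ} (hU : U ∈ sobolevSpace μ s) {g : Lp ℝ 2 μ}
    (hres : ∀ V ∈ sobolevSpace μ s, ⟪U.fst - g, V.fst⟫_ℝ + ⟪U.snd, V.snd⟫_ℝ = 0)
    {T : ℝ → ℝ} (hT : ContDiff ℝ (⊤ : ℕ∞) T) (hT0 : T 0 = 0) (hT' : ∀ y, 0 ≤ deriv T y)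
    (hT1 : ∀ y, deriv T y ≤ 1) (hL : LipschitzWith 1 T) :
    ⟪U.fst - g, hL.compLp hT0 U.fst⟫_ℝ ≤ 0 := by
  obtain ⟨ψ, hψ⟩ := exists_tendsto_gradPair hU
  have h1 : Filter.Tendsto (fun n => (gradPair μ s (ψ n)).fst) Filter.atTop (nhds U.fst) :=
    ((WithLp.prod_continuous_ofLp 2 _ _).fst.tendsto U).comp hψ
  have h2 : Filter.Tendsto (fun n => (gradPair μ s (ψ n)).snd) Filter.atTop (nhds U.snd) :=
    ((WithLp.prod_continuous_ofLp 2 _ _).snd.tendsto U).comp hψ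
  have hlim : Filter.Tendsto
      (fun n => ⟪U.fst - g, hL.compLp hT0 (gradPair μ s (ψ n)).fst⟫_ℝ) Filter.atTop
      (nhds ⟪U.fst - g, hL.compLp hT0 U.fst⟫_ℝ) :=
    tendsto_const_nhds.inner (((hL.continuous_compLp hT0).tendsto _).comp h1)
  have hlim2 : Filter.Tendsto
      (fun n => ‖U.snd - (gradPair μ s (ψ n)).snd‖ * ‖(gradPair μ s (ψ n)).snd‖) Filter.atTop
      (nhds 0) := by
    simpa using ((tendsto_const_nhds (x := U.snd)).sub h2).norm.mul h2.norm
  refine le_of_tendsto_of_tendsto' hlim hlim2 fun n => ?_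
  set χ : testSpace d := ⟨fun x => T ((ψ n).1 x), comp_mem_testSpace hT (ψ n).2⟩ with hχ
  have hV := hres _ (gradPair_mem_sobolevSpace (μ := μ) s χ)
  have hfst : (gradPair μ s χ).fst = hL.compLp hT0 (gradPair μ s (ψ n)).fst := by
    apply Lp.ext
    refine (gradPair_fst s χ).trans ?_
    have hn := gradPair_fst (μ := μ) s (ψ n)
    filter_upwards [hL.coeFn_compLp hT0 (gradPair μ s (ψ n)).fst, hn] with x hx hx'
    rw [hx, Function.comp, hx']
  have e1 := gradPair_snd (μ := μ) s (ψ n)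
  have e2 : (gradPair μ s χ).snd =ᵐ[μ] fun x => s • deriv T ((ψ n).1 x) • grad (ψ n).1 x := by
    refine (gradPair_snd _ _).trans (Filter.Eventually.of_forall fun x => ?_)
    simp only [hχ, grad_comp hT (ψ n).2.1]
  have hpos : 0 ≤ ⟪(gradPair μ s (ψ n)).snd, (gradPair μ s χ).snd⟫_ℝ := by
    rw [L2.inner_def]
    refine integral_nonneg_of_ae ?_
    filter_upwards [e1, e2] with x h1 h2
    rw [h1, h2, inner_smul_left, inner_smul_right, inner_smul_right, real_inner_self_eq_norm_sq]
    have := hT' ((ψ n).1 x)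
    simp only [Pi.zero_apply, conj_trivial]
    have h3 := mul_nonneg (mul_self_nonneg s) (mul_nonneg this (sq_nonneg ‖grad (ψ n).1 x‖))
    linarith
  have hnorm : ‖(gradPair μ s χ).snd‖ ≤ ‖(gradPair μ s (ψ n)).snd‖ := by
    refine Lp.norm_le_norm_of_ae_le ?_
    filter_upwards [e1, e2] with x h1 h2
    rw [h1, h2, norm_smul, norm_smul, norm_smul, Real.norm_of_nonneg (hT' _)]
    refine mul_le_mul_of_nonneg_left ?_ (norm_nonneg _)
    exact mul_le_of_le_one_left (norm_nonneg _) (hT1 _)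
  rw [← hfst]
  have hcs := abs_real_inner_le_norm (U.snd - (gradPair μ s (ψ n)).snd) (gradPair μ s χ).snd
  rw [inner_sub_left] at hcs
  have hb := mul_le_mul_of_nonneg_left hnorm (norm_nonneg (U.snd - (gradPair μ s (ψ n)).snd))
  have := (abs_le.mp hcs).1
  linarith

theorem resolvent_le {s : ℝ} {U : PairSpace μ} (hU : U ∈ sobolevSpace μ s) {g : Lp ℝ 2 μ}
    (hres : ∀ V ∈ sobolevSpace μ s, ⟪U.fst - g, V.fst⟫_ℝ + ⟪U.snd, V.snd⟫_ℝ = 0)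
    {M : ℝ} (hg : ∀ᵐ x ∂μ, g x ≤ M) : ∀ᵐ x ∂μ, U.fst x ≤ M := by
  obtain ⟨T, hT, hT', hT1, hTz, hTpos⟩ := exists_smooth_positive_part
  have hdT : ∀ y, HasDerivAt (fun y => T (y - M) - T (0 - M)) (deriv T (y - M)) y := fun y => by
    simpa using (((hT.differentiable (by simp) (y - M)).hasDerivAt).comp y
      ((hasDerivAt_id y).sub_const M)).sub_const (T (0 - M))
  have hd' : deriv (fun y => T (y - M) - T (0 - M)) = fun y => deriv T (y - M) :=
    funext fun y => (hdT y).deriv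
  have hL : LipschitzWith 1 (fun y => T (y - M) - T (0 - M)) := by
    refine lipschitzWith_of_nnnorm_deriv_le (fun y => (hdT y).differentiableAt) fun y => ?_
    rw [hd', ← NNReal.coe_le_coe, coe_nnnorm, Real.norm_of_nonneg (hT' _)]
    exact hT1 _
  have h0 : (fun y => T (y - M) - T (0 - M)) 0 = 0 := by simp
  have hle := inner_compLp_nonpos hU hres (T := fun y => T (y - M) - T (0 - M))
    ((hT.comp (contDiff_id.sub contDiff_const)).sub contDiff_const) h0
    (fun y => by rw [hd']; exact hT' _) (fun y => by rw [hd']; exact hT1 _) hL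
  obtain ⟨W, hW, hc, hz⟩ := exists_const_mem_sobolevSpace (μ := μ) s (T (0 - M))
  have hone := hres W hW
  rw [hz, inner_zero_right, add_zero] at hone
  have hsum : ⟪U.fst - g, hL.compLp h0 U.fst + W.fst⟫_ℝ ≤ 0 := by
    rw [inner_add_right]; linarith
  rw [L2.inner_def] at hsum
  have hae : (fun x => ⟪(U.fst - g) x, (hL.compLp h0 U.fst + W.fst) x⟫_ℝ)
      =ᵐ[μ] fun x => T (U.fst x - M) * (U.fst x - g x) := by
    filter_upwards [Lp.coeFn_sub U.fst g, Lp.coeFn_add (hL.compLp h0 U.fst) W.fst,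
      hL.coeFn_compLp h0 U.fst, hc] with x h1 h2 h3 h4
    rw [h1, h2, Pi.add_apply, h3, h4]
    simp
  have hIntg := (L2.integrable_inner (𝕜 := ℝ) (U.fst - g) (hL.compLp h0 U.fst + W.fst)).congr hae
  rw [integral_congr_ae hae] at hsum
  have hnn : 0 ≤ᵐ[μ] fun x => T (U.fst x - M) * (U.fst x - g x) := by
    filter_upwards [hg] with x hx
    rcases le_or_gt (U.fst x - M) 0 with h | h
    · simp [hTz _ h]
    · exact mul_nonneg (hTpos _ h).le (by linarith)
  have := (integral_eq_zero_iff_of_nonneg_ae hnn hIntg).mp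
    (le_antisymm hsum (integral_nonneg_of_ae hnn))
  filter_upwards [this, hg] with x hx hgx
  by_contra! hcon
  have : 0 < T (U.fst x - M) * (U.fst x - g x) :=
    mul_pos (hTpos _ (by linarith)) (by linarith)
  rw [hx] at this
  exact lt_irrefl _ this

theorem le_resolvent {s : ℝ} {U : PairSpace μ} (hU : U ∈ sobolevSpace μ s) {g : Lp ℝ 2 μ}
    (hres : ∀ V ∈ sobolevSpace μ s, ⟪U.fst - g, V.fst⟫_ℝ + ⟪U.snd, V.snd⟫_ℝ = 0)
    {m : ℝ} (hg : ∀ᵐ x ∂μ, m ≤ g x) : ∀ᵐ x ∂μ, m ≤ U.fst x := by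
  have h := resolvent_le (U := -U) (g := -g) (M := -m) (neg_mem hU) (fun V hV => ?_) ?_
  · filter_upwards [h, Lp.coeFn_neg U.fst] with x h1 h2
    have : (-U).fst x = -(U.fst x) := by
      change (-U.fst) x = _
      rw [h2]; rfl
    linarith
  · have := hres V hV
    change ⟪-U.fst - -g, V.fst⟫_ℝ + ⟪-U.snd, V.snd⟫_ℝ = 0
    rw [inner_neg_left, show -U.fst - -g = -(U.fst - g) by abel, inner_neg_left]
    linarith
  · filter_upwards [hg, Lp.coeFn_neg g] with x h1 h2
    rw [h2, Pi.neg_apply]; linarith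

end MaximumPrinciple

section Nonlinearity

/-- The reaction term of the regularised Euler-Lagrange equation. -/
def reaction (κ ε σ y : ℝ) : ℝ :=
  -κ * (y * Real.log y) + ε * (y ^ 3 - 1 / y) + κ / 2 * (Real.log σ * y)

/-- The regularised entropy density. -/
def potential (κ ε y : ℝ) : ℝ :=
  -(κ / 2) * (y ^ 2 * Real.log y) + ε * (y ^ 4 / 4 - Real.log y - 1 / 4)

theorem abs_log_le {K y : ℝ} (hK : 1 ≤ K) (hy : 1 / K ≤ y) (hy' : y ≤ K) : |Real.log y| ≤ K := by
  have hy0 : 0 < y := lt_of_lt_of_le (by positivity) hy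
  have h1 := Real.log_le_sub_one_of_pos hy0
  have h2 := Real.log_le_sub_one_of_pos (inv_pos.mpr hy0)
  have h3 : y⁻¹ ≤ K := by
    rw [inv_le_comm₀ hy0 (by linarith)]; simpa using hy
  rw [Real.log_inv] at h2
  exact abs_le.mpr ⟨by linarith, by linarith⟩

theorem potential_sub_le {κ ε K a b : ℝ} (hκ : 0 < κ) (hε : 0 < ε) (hK : 1 ≤ K)
    (ha : 1 / K ≤ a) (ha' : a ≤ K) (hb : 1 / K ≤ b) (hb' : b ≤ K) :
    potential κ ε b - potential κ ε a
        - (reaction κ ε 1 a - κ / 2 * a) * (b - a) ≤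
      (κ * K + 3 * ε * K ^ 2) * (b - a) ^ 2 := by
  have hK0 : 0 < K := by linarith
  have ha0 : 0 < a := lt_of_lt_of_le (by positivity) ha
  have hb0 : 0 < b := lt_of_lt_of_le (by positivity) hb
  have hlog : Real.log a - Real.log b ≤ a / b - 1 := by
    rw [← Real.log_div ha0.ne' hb0.ne']
    exact Real.log_le_sub_one_of_pos (by positivity)
  have hla := abs_le.mp (abs_log_le hK ha ha')
  have h1 : -(b ^ 2 * Real.log b) + a ^ 2 * Real.log a + (2 * (a * Real.log a) + a) * (b - a)
      ≤ K * (b - a) ^ 2 := by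
    have h := mul_le_mul_of_nonneg_left hlog (sq_nonneg b)
    have e : b ^ 2 * (a / b - 1) = a * b - b ^ 2 := by field_simp
    rw [e] at h
    nlinarith [mul_nonneg (show 0 ≤ K + Real.log a by linarith) (sq_nonneg (b - a)),
      sq_nonneg (b - a)]
  have h2 : b ^ 4 / 4 - a ^ 4 / 4 - a ^ 3 * (b - a) ≤ 2 * K ^ 2 * (b - a) ^ 2 := by
    have e : b ^ 4 / 4 - a ^ 4 / 4 - a ^ 3 * (b - a)
      = (b ^ 2 + 2 * (a * b) + 3 * a ^ 2) / 4 * (b - a) ^ 2 := by ring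
    rw [e]
    refine mul_le_mul_of_nonneg_right ?_ (sq_nonneg _)
    have i1 : b ^ 2 ≤ K ^ 2 := by gcongr
    have i2 : a ^ 2 ≤ K ^ 2 := by gcongr
    have i3 : a * b ≤ K ^ 2 := by nlinarith
    nlinarith
  have h3 : -Real.log b + Real.log a + (b - a) / a ≤ K ^ 2 * (b - a) ^ 2 := by
    have e : a / b - 1 + (b - a) / a = (1 / a * (1 / b)) * (b - a) ^ 2 := by field_simp; ring
    have i1 : 1 / a ≤ K := by rw [one_div_le ha0 hK0]; exact ha
    have i2 : 1 / b ≤ K := by rw [one_div_le hb0 hK0]; exact hb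
    have i3 : 1 / a * (1 / b) ≤ K ^ 2 := by
      rw [sq]; exact mul_le_mul i1 i2 (by positivity) hK0.le
    have := mul_le_mul_of_nonneg_right i3 (sq_nonneg (b - a))
    linarith
  have key : potential κ ε b - potential κ ε a - (reaction κ ε 1 a - κ / 2 * a) * (b - a)
      = κ / 2 * (-(b ^ 2 * Real.log b) + a ^ 2 * Real.log a
          + (2 * (a * Real.log a) + a) * (b - a))
        + ε * ((b ^ 4 / 4 - a ^ 4 / 4 - a ^ 3 * (b - a))
          + (-Real.log b + Real.log a + (b - a) / a)) := by
    simp only [potential, reaction, Real.log_one]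
    field_simp
    ring
  rw [key]
  have j1 := mul_le_mul_of_nonneg_left h1 (by positivity : 0 ≤ κ / 2)
  have j2 := mul_le_mul_of_nonneg_left (add_le_add h2 h3) hε.le
  have j3 : 0 ≤ κ / 2 * (K * (b - a) ^ 2) := by positivity
  linarith

theorem reaction_sub_le {κ ε K σ a b : ℝ} (hκ : 0 < κ) (hε : 0 < ε) (hK : 1 ≤ K)
    (hσ : |Real.log σ| ≤ 2 * K) (ha : 1 / K ≤ a) (hab : a ≤ b) (hb' : b ≤ K) :
    |reaction κ ε σ b - reaction κ ε σ a| ≤ (3 * κ * K + 4 * ε * K ^ 2) * (b - a) := by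
  have hK0 : 0 < K := by linarith
  have ha0 : 0 < a := lt_of_lt_of_le (by positivity) ha
  have hb0 : 0 < b := ha0.trans_le hab
  have hba : 0 ≤ b - a := by linarith
  have hlb := abs_le.mp (abs_log_le hK (ha.trans hab) hb')
  have l1 : Real.log a - Real.log b ≤ 0 := by
    have := Real.log_le_log ha0 hab; linarith
  have l2 : a * (Real.log b - Real.log a) ≤ b - a := by
    rw [← Real.log_div hb0.ne' ha0.ne']
    have := mul_le_mul_of_nonneg_left (Real.log_le_sub_one_of_pos (div_pos hb0 ha0)) ha0.le
    have e : a * (b / a - 1) = b - a := by field_simp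
    linarith
  have h1 : |(-(b * Real.log b) + a * Real.log a)| ≤ 2 * K * (b - a) := by
    have e : -(b * Real.log b) + a * Real.log a
      = -(b - a) * Real.log b + a * (Real.log a - Real.log b) := by ring
    have i1 := mul_le_mul_of_nonneg_left hlb.1 hba
    have i2 := mul_le_mul_of_nonneg_left hlb.2 hba
    have i3 : a * (Real.log a - Real.log b) ≤ 0 := mul_nonpos_of_nonneg_of_nonpos ha0.le l1
    have i4 : b - a ≤ K * (b - a) := by nlinarith
    have i5 : 0 ≤ K * (b - a) := by positivity
    rw [e, abs_le]
    constructor <;> nlinarith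
  have h2 : |(b ^ 3 - 1 / b) - (a ^ 3 - 1 / a)| ≤ 4 * K ^ 2 * (b - a) := by
    have e : (b ^ 3 - 1 / b) - (a ^ 3 - 1 / a)
      = (b ^ 2 + a * b + a ^ 2 + 1 / a * (1 / b)) * (b - a) := by field_simp; ring
    rw [e, abs_of_nonneg (by positivity)]
    refine mul_le_mul_of_nonneg_right ?_ hba
    have j1 : 1 / a ≤ K := by rw [one_div_le ha0 hK0]; exact ha
    have j2 : 1 / b ≤ K := by rw [one_div_le hb0 hK0]; linarith
    have j3 : 1 / a * (1 / b) ≤ K ^ 2 := by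
      rw [sq]; exact mul_le_mul j1 j2 (by positivity) hK0.le
    have i1 : b ^ 2 ≤ K ^ 2 := by gcongr
    have i2 : a ^ 2 ≤ K ^ 2 := by gcongr; linarith
    have i3 : a * b ≤ K ^ 2 := by nlinarith
    linarith
  have h3 : |Real.log σ * (b - a)| ≤ 2 * K * (b - a) := by
    rw [abs_mul, abs_of_nonneg hba]
    exact mul_le_mul_of_nonneg_right hσ hba
  have e : reaction κ ε σ b - reaction κ ε σ a = κ * (-(b * Real.log b) + a * Real.log a)
      + ε * ((b ^ 3 - 1 / b) - (a ^ 3 - 1 / a)) + κ / 2 * (Real.log σ * (b - a)) := by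
    simp only [reaction]; ring
  rw [e]
  refine (abs_add_le _ _).trans ((add_le_add_left (abs_add_le _ _) _).trans ?_)
  rw [abs_mul, abs_mul, abs_mul, abs_of_pos hκ, abs_of_pos hε, abs_of_pos (half_pos hκ)]
  have k1 := mul_le_mul_of_nonneg_left h1 hκ.le
  have k2 := mul_le_mul_of_nonneg_left h2 hε.le
  have k3 := mul_le_mul_of_nonneg_left h3 (half_pos hκ).le
  linarith

theorem reaction_lipschitz {κ ε K σ a b : ℝ} (hκ : 0 < κ) (hε : 0 < ε) (hK : 1 ≤ K)
    (hσ : |Real.log σ| ≤ 2 * K) (ha : 1 / K ≤ a) (ha' : a ≤ K) (hb : 1 / K ≤ b) (hb' : b ≤ K) :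
    |reaction κ ε σ b - reaction κ ε σ a| ≤ (3 * κ * K + 4 * ε * K ^ 2) * |b - a| := by
  rcases le_total a b with h | h
  · rw [abs_of_nonneg (sub_nonneg.mpr h)]
    exact reaction_sub_le hκ hε hK hσ ha h hb'
  · rw [abs_sub_comm, abs_sub_comm b, abs_of_nonneg (sub_nonneg.mpr h)]
    exact reaction_sub_le hκ hε hK hσ hb h ha'

theorem log_sq_bounds {K σ : ℝ} (hK : 1 ≤ K) (h1 : (1 / K) ^ 2 ≤ σ) (h2 : σ ≤ K ^ 2) :
    |Real.log σ| ≤ 2 * Real.log K := by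
  have hK0 : 0 < K := by linarith
  have hσ : 0 < σ := lt_of_lt_of_le (by positivity) h1
  have a := Real.log_le_log (by positivity) h1
  have b := Real.log_le_log hσ h2
  rw [Real.log_pow, one_div, Real.log_inv] at a
  rw [Real.log_pow] at b
  push_cast at a b
  exact abs_le.mpr ⟨by linarith, by linarith⟩

theorem reaction_nonneg {κ ε K σ : ℝ} (hκ : 0 < κ) (hK : 1 ≤ K)
    (hKl : 2 * κ * Real.log K ≤ ε * (K ^ 2 - 1 / K ^ 2)) (h1 : (1 / K) ^ 2 ≤ σ)
    (h2 : σ ≤ K ^ 2) : 0 ≤ reaction κ ε σ K := by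
  have hK0 : 0 < K := by linarith
  have hl := (abs_le.mp (log_sq_bounds hK h1 h2)).1
  have e : reaction κ ε σ K = K * (ε * (K ^ 2 - 1 / K ^ 2) - κ * Real.log K
      + κ / 2 * Real.log σ) := by
    unfold reaction; field_simp; ring
  rw [e]
  refine mul_nonneg hK0.le ?_
  nlinarith

theorem reaction_nonpos {κ ε K σ : ℝ} (hκ : 0 < κ) (hK : 1 ≤ K)
    (hKl : 2 * κ * Real.log K ≤ ε * (K ^ 2 - 1 / K ^ 2)) (h1 : (1 / K) ^ 2 ≤ σ)
    (h2 : σ ≤ K ^ 2) : reaction κ ε σ (1 / K) ≤ 0 := by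
  have hK0 : 0 < K := by linarith
  have hl := (abs_le.mp (log_sq_bounds hK h1 h2)).2
  have e : reaction κ ε σ (1 / K) = -(1 / K * (ε * (K ^ 2 - 1 / K ^ 2) - κ * Real.log K
      - κ / 2 * Real.log σ)) := by
    unfold reaction; rw [one_div, Real.log_inv]; field_simp; ring
  rw [e, neg_nonpos]
  refine mul_nonneg (by positivity) ?_
  nlinarith

/-- The explicit step `y ↦ y - τ q(y)` preserves the interval `[1 / K, K]`. -/
theorem explicit_step_mem {κ ε K σ τ y : ℝ} (hκ : 0 < κ) (hε : 0 < ε) (hK : 1 ≤ K)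
    (hKl : 2 * κ * Real.log K ≤ ε * (K ^ 2 - 1 / K ^ 2)) (h1 : (1 / K) ^ 2 ≤ σ)
    (h2 : σ ≤ K ^ 2) (hτ : 0 < τ) (hτL : τ * (3 * κ * K + 4 * ε * K ^ 2) ≤ 1)
    (hy : 1 / K ≤ y) (hy' : y ≤ K) :
    1 / K ≤ y - τ * reaction κ ε σ y ∧ y - τ * reaction κ ε σ y ≤ K := by
  have hσ : |Real.log σ| ≤ 2 * K := (log_sq_bounds hK h1 h2).trans (by
    have := Real.log_le_sub_one_of_pos (show 0 < K by linarith); linarith)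
  have hKK : 1 / K ≤ K := hy.trans hy'
  have a1 := (abs_le.mp (reaction_sub_le hκ hε hK hσ hy hy' le_rfl)).2
  have a2 := (abs_le.mp (reaction_sub_le hκ hε hK hσ le_rfl hy hy')).2
  have q1 := reaction_nonneg hκ hK hKl h1 h2
  have q2 := reaction_nonpos hκ hK hKl h1 h2
  have b1 := mul_le_mul_of_nonneg_right hτL (show 0 ≤ K - y by linarith)
  have b2 := mul_le_mul_of_nonneg_right hτL (show 0 ≤ y - 1 / K by linarith)
  have c1 := mul_le_mul_of_nonneg_left
    (show -reaction κ ε σ y ≤ (3 * κ * K + 4 * ε * K ^ 2) * (K - y) by linarith) hτ.le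
  have c2 := mul_le_mul_of_nonneg_left
    (show reaction κ ε σ y ≤ (3 * κ * K + 4 * ε * K ^ 2) * (y - 1 / K) by linarith) hτ.le
  rw [← mul_assoc] at c1 c2
  constructor <;> linarith

end Nonlinearity

section Energy

variable {d : ℕ} {μ : Measure (EuclideanSpace ℝ (Fin d))}

/-- The energy of the regularised variational problem. -/
def energy (κ ε s : ℝ) (U : PairSpace μ) : ℝ :=
  1 / (2 * s ^ 2) * ‖U.snd‖ ^ 2 + ∫ x, potential κ ε (U.fst x) ∂μ
    + κ / 4 * (‖U.fst‖ ^ 2 * Real.log (‖U.fst‖ ^ 2))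

theorem norm_sq_eq_integral (u : Lp ℝ 2 μ) : ‖u‖ ^ 2 = ∫ x, u x ^ 2 ∂μ := by
  rw [← real_inner_self_eq_norm_sq, L2.inner_def]
  refine integral_congr_ae (Filter.Eventually.of_forall fun x => ?_)
  simp [sq]

variable [IsProbabilityMeasure μ]

theorem integrable_comp_of_continuousOn {m M : ℝ} {φ : ℝ → ℝ} (hφ : Measurable φ)
    (hc : ContinuousOn φ (Set.Icc m M)) {u : EuclideanSpace ℝ (Fin d) → ℝ}
    (hu : AEStronglyMeasurable u μ) (hr : ∀ᵐ x ∂μ, m ≤ u x ∧ u x ≤ M) :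
    Integrable (fun x => φ (u x)) μ := by
  obtain ⟨C, hC⟩ := isCompact_Icc.exists_bound_of_continuousOn hc
  refine Integrable.of_bound (hφ.comp_aemeasurable hu.aemeasurable).aestronglyMeasurable C ?_
  filter_upwards [hr] with x hx using hC _ hx

theorem measurable_potential (κ ε : ℝ) : Measurable (potential κ ε) := by
  unfold potential; fun_prop

theorem measurable_reaction (κ ε σ : ℝ) : Measurable (reaction κ ε σ) := by
  unfold reaction; fun_prop

theorem continuousOn_potential (κ ε : ℝ) {m M : ℝ} (hm : 0 < m) :
    ContinuousOn (potential κ ε) (Set.Icc m M) := by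
  have : ContinuousOn Real.log (Set.Icc m M) :=
    Real.continuousOn_log.mono fun y hy => (hm.trans_le hy.1).ne'
  unfold potential
  fun_prop

theorem continuousOn_reaction (κ ε σ : ℝ) {m M : ℝ} (hm : 0 < m) :
    ContinuousOn (reaction κ ε σ) (Set.Icc m M) := by
  have : ContinuousOn Real.log (Set.Icc m M) :=
    Real.continuousOn_log.mono fun y hy => (hm.trans_le hy.1).ne'
  have h2 : ContinuousOn (fun y : ℝ => 1 / y) (Set.Icc m M) :=
    continuousOn_const.div continuousOn_id fun y hy => (hm.trans_le hy.1).ne'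
  unfold reaction
  fun_prop

theorem norm_sq_mem_range {K : ℝ} (hK : 1 ≤ K) {u : Lp ℝ 2 μ}
    (hr : ∀ᵐ x ∂μ, 1 / K ≤ u x ∧ u x ≤ K) : (1 / K) ^ 2 ≤ ‖u‖ ^ 2 ∧ ‖u‖ ^ 2 ≤ K ^ 2 := by
  have hK0 : 0 < 1 / K := by positivity
  have hi : Integrable (fun x => u x ^ 2) μ :=
    integrable_comp_of_continuousOn (φ := fun y => y ^ 2) (by fun_prop) (by fun_prop)
      (Lp.aestronglyMeasurable u) hr
  rw [norm_sq_eq_integral]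
  constructor
  · have := integral_mono_ae (integrable_const ((1 / K) ^ 2)) hi (by
      filter_upwards [hr] with x hx using pow_le_pow_left₀ hK0.le hx.1 2)
    simpa using this
  · have := integral_mono_ae hi (integrable_const (K ^ 2)) (by
      filter_upwards [hr] with x hx using pow_le_pow_left₀ (hK0.le.trans hx.1) hx.2 2)
    simpa using this

theorem integral_potential_sub_le {κ ε K : ℝ} (hκ : 0 < κ) (hε : 0 < ε) (hK : 1 ≤ K)
    {u v q : Lp ℝ 2 μ} (hu : ∀ᵐ x ∂μ, 1 / K ≤ u x ∧ u x ≤ K)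
    (hv : ∀ᵐ x ∂μ, 1 / K ≤ v x ∧ v x ≤ K) {σ : ℝ}
    (hq : ∀ᵐ x ∂μ, q x = reaction κ ε σ (u x)) :
    (∫ x, potential κ ε (v x) ∂μ) - ∫ x, potential κ ε (u x) ∂μ ≤
      ⟪q, v - u⟫_ℝ - κ / 2 * (Real.log σ + 1) * ⟪u, v - u⟫_ℝ
        + (κ * K + 3 * ε * K ^ 2) * ‖v - u‖ ^ 2 := by
  have hK0 : 0 < 1 / K := by positivity
  have hc := continuousOn_potential κ ε (m := 1 / K) (M := K) hK0
  have hiu := integrable_comp_of_continuousOn (measurable_potential κ ε) hc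
    (Lp.aestronglyMeasurable u) hu
  have hiv := integrable_comp_of_continuousOn (measurable_potential κ ε) hc
    (Lp.aestronglyMeasurable v) hv
  have i1 : Integrable (fun x => ⟪q x, (v - u) x⟫_ℝ) μ := L2.integrable_inner q (v - u)
  have i2 : Integrable (fun x => κ / 2 * (Real.log σ + 1) * ⟪u x, (v - u) x⟫_ℝ) μ :=
    (L2.integrable_inner (𝕜 := ℝ) u (v - u)).const_mul _
  have i3 : Integrable (fun x => (κ * K + 3 * ε * K ^ 2) * ⟪(v - u) x, (v - u) x⟫_ℝ) μ :=
    (L2.integrable_inner (𝕜 := ℝ) (v - u) (v - u)).const_mul _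
  have i12 : Integrable (fun x => ⟪q x, (v - u) x⟫_ℝ
    - κ / 2 * (Real.log σ + 1) * ⟪u x, (v - u) x⟫_ℝ) μ := i1.sub i2
  rw [← real_inner_self_eq_norm_sq, L2.inner_def, L2.inner_def, L2.inner_def,
    ← integral_const_mul, ← integral_const_mul, ← integral_sub i1 i2, ← integral_add i12 i3,
    ← integral_sub hiv hiu]
  refine integral_mono_ae (hiv.sub hiu) (i12.add i3) ?_
  filter_upwards [hu, hv, hq, Lp.coeFn_sub v u] with x h1 h2 h3 h4
  have := potential_sub_le hκ hε hK h1.1 h1.2 h2.1 h2.2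
  simp only [h3, h4, Pi.sub_apply, RCLike.inner_apply, conj_trivial]
  have e : reaction κ ε 1 (u x) = reaction κ ε σ (u x) - κ / 2 * (Real.log σ * u x) := by
    simp [reaction]
  rw [e] at this
  linarith

theorem energy_descent {κ ε K s : ℝ} (hκ : 0 < κ) (hε : 0 < ε) (hK : 1 ≤ K) (hs : 0 < s)
    {U₀ U₁ : PairSpace μ} {q : Lp ℝ 2 μ}
    (h₀ : ∀ᵐ x ∂μ, 1 / K ≤ U₀.fst x ∧ U₀.fst x ≤ K)
    (h₁ : ∀ᵐ x ∂μ, 1 / K ≤ U₁.fst x ∧ U₁.fst x ≤ K)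
    (hq : ∀ᵐ x ∂μ, q x = reaction κ ε (‖U₀.fst‖ ^ 2) (U₀.fst x))
    (hres : ⟪U₁.fst - (U₀.fst - s ^ 2 • q), U₀.fst - U₁.fst⟫_ℝ
      + ⟪U₁.snd, U₀.snd - U₁.snd⟫_ℝ = 0) :
    energy κ ε s U₁ + (1 / s ^ 2 - (κ * K + 3 * ε * K ^ 2 + κ / 4 * (2 * K + 1 + 4 * K ^ 4)))
      * ‖U₁.fst - U₀.fst‖ ^ 2 ≤ energy κ ε s U₀ := by
  have hpot := integral_potential_sub_le hκ hε hK h₀ h₁ hq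
  obtain ⟨a1, a2⟩ := norm_sq_mem_range hK h₀
  obtain ⟨b1, b2⟩ := norm_sq_mem_range hK h₁
  have hK0 : 0 < K := by linarith
  set u := U₀.fst with hu
  set v := U₁.fst with hv
  have hσ : 0 < ‖u‖ ^ 2 := lt_of_lt_of_le (by positivity) a1
  have hσ' : 0 < ‖v‖ ^ 2 := lt_of_lt_of_le (by positivity) b1
  have nu : ‖u‖ ≤ K := abs_le_of_sq_le_sq' a2 hK0.le |>.2
  have nv : ‖v‖ ≤ K := abs_le_of_sq_le_sq' b2 hK0.le |>.2
  have hgrad : 1 / (2 * s ^ 2) * ‖U₁.snd‖ ^ 2 + 1 / s ^ 2 * ‖v - u‖ ^ 2 + ⟪q, v - u⟫_ℝ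
      ≤ 1 / (2 * s ^ 2) * ‖U₀.snd‖ ^ 2 := by
    have e1 : ⟪v - (u - s ^ 2 • q), u - v⟫_ℝ = -‖v - u‖ ^ 2 - s ^ 2 * ⟪q, v - u⟫_ℝ := by
      rw [show v - (u - s ^ 2 • q) = (v - u) + s ^ 2 • q by abel,
        show u - v = -(v - u) by abel, inner_neg_right, inner_add_left,
        real_inner_smul_left, real_inner_self_eq_norm_sq]
      ring
    have e2 : ‖U₀.snd‖ ^ 2 = ‖U₁.snd‖ ^ 2 + 2 * ⟪U₁.snd, U₀.snd - U₁.snd⟫_ℝ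
        + ‖U₀.snd - U₁.snd‖ ^ 2 := by
      rw [← norm_add_sq_real, add_sub_cancel]
    have e3 : ⟪U₁.snd, U₀.snd - U₁.snd⟫_ℝ = ‖v - u‖ ^ 2 + s ^ 2 * ⟪q, v - u⟫_ℝ := by linarith
    rw [e2, e3]
    have : 1 / (2 * s ^ 2) * (‖U₁.snd‖ ^ 2 + 2 * (‖v - u‖ ^ 2 + s ^ 2 * ⟪q, v - u⟫_ℝ)
        + ‖U₀.snd - U₁.snd‖ ^ 2) = 1 / (2 * s ^ 2) * ‖U₁.snd‖ ^ 2 + 1 / s ^ 2 * ‖v - u‖ ^ 2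
        + ⟪q, v - u⟫_ℝ + 1 / (2 * s ^ 2) * ‖U₀.snd - U₁.snd‖ ^ 2 := by
      field_simp
      ring
    rw [this]
    have : 0 ≤ 1 / (2 * s ^ 2) * ‖U₀.snd - U₁.snd‖ ^ 2 := by positivity
    linarith
  have hsq : ‖v‖ ^ 2 = ‖u‖ ^ 2 + 2 * ⟪u, v - u⟫_ℝ + ‖v - u‖ ^ 2 := by
    rw [← norm_add_sq_real, add_sub_cancel]
  have hlog : ‖v‖ ^ 2 * Real.log (‖v‖ ^ 2) ≤ ‖u‖ ^ 2 * Real.log (‖u‖ ^ 2)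
      + (Real.log (‖u‖ ^ 2) + 1) * (‖v‖ ^ 2 - ‖u‖ ^ 2) + (‖v‖ ^ 2 - ‖u‖ ^ 2) ^ 2 / ‖u‖ ^ 2 := by
    have h := Real.log_le_sub_one_of_pos (div_pos hσ' hσ)
    rw [Real.log_div hσ'.ne' hσ.ne'] at h
    have h2 := mul_le_mul_of_nonneg_left h hσ'.le
    have hu0 : ‖u‖ ≠ 0 := fun h0 => by simp [h0] at hσ
    have e : ‖v‖ ^ 2 * (‖v‖ ^ 2 / ‖u‖ ^ 2 - 1)
      = (‖v‖ ^ 2 - ‖u‖ ^ 2) + (‖v‖ ^ 2 - ‖u‖ ^ 2) ^ 2 / ‖u‖ ^ 2 := by field_simp; ring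
    rw [e] at h2
    linarith
  have hdiff : (‖v‖ ^ 2 - ‖u‖ ^ 2) ^ 2 / ‖u‖ ^ 2 ≤ 4 * K ^ 4 * ‖v - u‖ ^ 2 := by
    have e1 : (‖v‖ - ‖u‖) ^ 2 ≤ ‖v - u‖ ^ 2 := by
      rw [← sq_abs (‖v‖ - ‖u‖)]
      exact pow_le_pow_left₀ (abs_nonneg _) (abs_norm_sub_norm_le v u) 2
    have e2 : (‖v‖ + ‖u‖) ^ 2 ≤ (2 * K) ^ 2 := by
      refine pow_le_pow_left₀ (by positivity) (by linarith) 2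
    have e3 : (‖v‖ ^ 2 - ‖u‖ ^ 2) ^ 2 ≤ (2 * K) ^ 2 * ‖v - u‖ ^ 2 := by
      rw [show (‖v‖ ^ 2 - ‖u‖ ^ 2) ^ 2 = (‖v‖ + ‖u‖) ^ 2 * (‖v‖ - ‖u‖) ^ 2 by ring]
      exact mul_le_mul e2 e1 (sq_nonneg _) (by positivity)
    rw [div_le_iff₀ hσ]
    have e4 : 1 ≤ K ^ 2 * ‖u‖ ^ 2 := by
      have := mul_le_mul_of_nonneg_left a1 (sq_nonneg K)
      rwa [← mul_pow, mul_one_div_cancel hK0.ne', one_pow] at this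
    have := mul_le_mul_of_nonneg_right e4 (show 0 ≤ (2 * K) ^ 2 * ‖v - u‖ ^ 2 by positivity)
    nlinarith
  have hls : Real.log (‖u‖ ^ 2) + 1 ≤ 2 * K + 1 := by
    have := (abs_le.mp (log_sq_bounds hK a1 a2)).2
    have := Real.log_le_sub_one_of_pos hK0
    linarith
  have hl2 := mul_le_mul_of_nonneg_right hls (sq_nonneg ‖v - u‖)
  have hl3 : ‖v‖ ^ 2 * Real.log (‖v‖ ^ 2) ≤ ‖u‖ ^ 2 * Real.log (‖u‖ ^ 2)
      + (Real.log (‖u‖ ^ 2) + 1) * (2 * ⟪u, v - u⟫_ℝ)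
      + (2 * K + 1 + 4 * K ^ 4) * ‖v - u‖ ^ 2 := by
    have : ‖v‖ ^ 2 - ‖u‖ ^ 2 = 2 * ⟪u, v - u⟫_ℝ + ‖v - u‖ ^ 2 := by linarith
    rw [this] at hlog hdiff
    linarith
  have hl4 := mul_le_mul_of_nonneg_left hl3 (show 0 ≤ κ / 4 by positivity)
  unfold energy
  rw [← hu, ← hv]
  linarith

end Energy

section Descent

variable {d : ℕ} {μ : Measure (EuclideanSpace ℝ (Fin d))} [IsProbabilityMeasure μ]

/-- Sobolev functions with values in `[1 / K, K]`. -/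
def IsAdmissible (μ : Measure (EuclideanSpace ℝ (Fin d))) [IsProbabilityMeasure μ]
    (s K : ℝ) (U : PairSpace μ) : Prop :=
  U ∈ sobolevSpace μ s ∧ ∀ᵐ x ∂μ, 1 / K ≤ U.fst x ∧ U.fst x ≤ K

theorem exists_energy_lower_bound {κ ε K : ℝ} (hκ : 0 < κ) (hK : 1 ≤ K) :
    ∃ B, ∀ (s : ℝ) (U : PairSpace μ), IsAdmissible μ s K U → B ≤ energy κ ε s U := by
  have hK0 : 0 < 1 / K := by positivity
  have hc := continuousOn_potential κ ε (m := 1 / K) (M := K) hK0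
  obtain ⟨C, hC⟩ := isCompact_Icc.exists_bound_of_continuousOn hc
  refine ⟨-C + κ / 4 * -1, fun s U hU => ?_⟩
  have h1 : -C ≤ ∫ x, potential κ ε (U.fst x) ∂μ := by
    have := integral_mono_ae (integrable_const (-C)) (integrable_comp_of_continuousOn
      (measurable_potential κ ε) hc (Lp.aestronglyMeasurable U.fst) hU.2) (by
      filter_upwards [hU.2] with x hx using (abs_le.mp (hC _ hx)).1)
    simpa using this
  have h2 : -1 ≤ ‖U.fst‖ ^ 2 * Real.log (‖U.fst‖ ^ 2) := by
    have := Real.self_sub_one_le_mul_log (x := ‖U.fst‖ ^ 2) (by positivity)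
    nlinarith [sq_nonneg ‖U.fst‖]
  have h3 := mul_le_mul_of_nonneg_left h2 (show 0 ≤ κ / 4 by positivity)
  have h4 : 0 ≤ 1 / (2 * s ^ 2) * ‖U.snd‖ ^ 2 := by positivity
  unfold energy
  linarith

theorem exists_almost_stationary {κ ε K s : ℝ} (hκ : 0 < κ) (hε : 0 < ε) (hK : 1 ≤ K)
    (hKl : 2 * κ * Real.log K ≤ ε * (K ^ 2 - 1 / K ^ 2)) (hs : 0 < s)
    (hsL : s ^ 2 * (3 * κ * K + 4 * ε * K ^ 2) ≤ 1)
    (hsC : 1 ≤ 1 / s ^ 2 - (κ * K + 3 * ε * K ^ 2 + κ / 4 * (2 * K + 1 + 4 * K ^ 4)))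
    {Φ : PairSpace μ} (hΦ : IsAdmissible μ s K Φ) {δ : ℝ} (hδ : 0 < δ) :
    ∃ U₀ U₁ : PairSpace μ, IsAdmissible μ s K U₀ ∧ IsAdmissible μ s K U₁ ∧
      energy κ ε s U₁ ≤ energy κ ε s Φ + δ ∧ ‖U₁.fst - U₀.fst‖ ^ 2 ≤ δ ∧
      ∀ V ∈ sobolevSpace μ s,
        (∫ x, (U₁.fst x - U₀.fst x + s ^ 2 * reaction κ ε (‖U₀.fst‖ ^ 2) (U₀.fst x)) * V.fst x ∂μ)
          + ⟪U₁.snd, V.snd⟫_ℝ = 0 := by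
  obtain ⟨B, hB⟩ := exists_energy_lower_bound (μ := μ) (ε := ε) hκ hK
  set S : Set ℝ := {e | ∃ U : PairSpace μ, IsAdmissible μ s K U ∧ energy κ ε s U = e} with hS
  have hSb : BddBelow S := ⟨B, by rintro e ⟨U, hU, rfl⟩; exact hB s U hU⟩
  have hSn : S.Nonempty := ⟨_, Φ, hΦ, rfl⟩
  obtain ⟨e, ⟨U₀, hU₀, rfl⟩, he⟩ := Real.lt_sInf_add_pos hSn hδ
  have hmin : ∀ V : PairSpace μ, IsAdmissible μ s K V → energy κ ε s U₀ < energy κ ε s V + δ :=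
    fun V hV => he.trans_le (by linarith [csInf_le hSb (show energy κ ε s V ∈ S from ⟨V, hV, rfl⟩)])
  have hK0 : 0 < 1 / K := by positivity
  obtain ⟨a1, a2⟩ := norm_sq_mem_range hK hU₀.2
  set σ := ‖U₀.fst‖ ^ 2 with hσ
  obtain ⟨C, hC⟩ := isCompact_Icc.exists_bound_of_continuousOn
    (continuousOn_reaction κ ε σ (m := 1 / K) (M := K) hK0)
  have hm : MemLp (fun x => reaction κ ε σ (U₀.fst x)) 2 μ := by
    refine MemLp.of_bound ((measurable_reaction κ ε σ).comp_aemeasurable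
      (Lp.aestronglyMeasurable U₀.fst).aemeasurable).aestronglyMeasurable C ?_
    filter_upwards [hU₀.2] with x hx using hC _ hx
  set q : Lp ℝ 2 μ := hm.toLp _ with hq
  have hqa : ∀ᵐ x ∂μ, q x = reaction κ ε σ (U₀.fst x) := hm.coeFn_toLp
  have hga : ∀ᵐ x ∂μ, (U₀.fst - s ^ 2 • q) x
      = U₀.fst x - s ^ 2 * reaction κ ε σ (U₀.fst x) := by
    filter_upwards [Lp.coeFn_sub U₀.fst (s ^ 2 • q), Lp.coeFn_smul (s ^ 2) q, hqa] with x h1 h2 h3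
    rw [h1, Pi.sub_apply, h2, Pi.smul_apply, h3, smul_eq_mul]
  have hstep : ∀ᵐ x ∂μ, 1 / K ≤ (U₀.fst - s ^ 2 • q) x ∧ (U₀.fst - s ^ 2 • q) x ≤ K := by
    filter_upwards [hga, hU₀.2] with x h1 h2
    rw [h1]
    exact explicit_step_mem hκ hε hK hKl a1 a2 (by positivity) hsL h2.1 h2.2
  obtain ⟨U₁, hU₁, hres⟩ := exists_resolvent s (U₀.fst - s ^ 2 • q)
  have hr : ∀ᵐ x ∂μ, 1 / K ≤ U₁.fst x ∧ U₁.fst x ≤ K :=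
    (le_resolvent hU₁ hres (hstep.mono fun x h => h.1)).and
      (resolvent_le hU₁ hres (hstep.mono fun x h => h.2))
  have hdes := energy_descent hκ hε hK hs hU₀.2 hr hqa
    (hres (U₀ - U₁) (sub_mem hU₀.1 hU₁))
  have hn := sq_nonneg ‖U₁.fst - U₀.fst‖
  have hn' := mul_le_mul_of_nonneg_right hsC hn
  refine ⟨U₀, U₁, hU₀, ⟨hU₁, hr⟩, ?_, ?_, fun V hV => ?_⟩
  · linarith [hmin Φ hΦ]
  · linarith [hmin U₁ ⟨hU₁, hr⟩]
  · rw [← hres V hV, L2.inner_def]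
    congr 1
    refine integral_congr_ae ?_
    filter_upwards [hga, Lp.coeFn_sub U₁.fst (U₀.fst - s ^ 2 • q)] with x h1 h2
    rw [h2, Pi.sub_apply, h1]
    simp
    ring

end Descent

section Mollification

variable {d : ℕ} {ρ u : EuclideanSpace ℝ (Fin d) → ℝ}

/-- The convolution of `u` with the kernel `ρ`. -/
def mollify (ρ u : EuclideanSpace ℝ (Fin d) → ℝ) (x : EuclideanSpace ℝ (Fin d)) : ℝ :=
  ∫ y, ρ (x - y) * u y

theorem mollify_eq_convolution (ρ u : EuclideanSpace ℝ (Fin d) → ℝ) :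
    mollify ρ u = convolution ρ u (ContinuousLinearMap.lsmul ℝ ℝ) volume := by
  ext x
  rw [convolution_eq_swap]
  simp [mollify]

theorem HasCompactSupport.reflect (hρc : HasCompactSupport ρ) (x : EuclideanSpace ℝ (Fin d)) :
    HasCompactSupport fun y => ρ (x - y) :=
  hρc.comp_homeomorph (Homeomorph.subLeft x)

theorem integrable_mollify (hρ : Continuous ρ) (hρc : HasCompactSupport ρ)
    (hu : LocallyIntegrable u) (x : EuclideanSpace ℝ (Fin d)) :
    Integrable fun y => ρ (x - y) * u y := by
  simpa using hu.integrable_smul_left_of_hasCompactSupport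
    (hρ.comp (continuous_const.sub continuous_id)) (hρc.reflect x)

theorem contDiff_mollify (hρ : ContDiff ℝ (⊤ : ℕ∞) ρ) (hρc : HasCompactSupport ρ)
    (hu : LocallyIntegrable u) : ContDiff ℝ (⊤ : ℕ∞) (mollify ρ u) := by
  rw [mollify_eq_convolution]
  exact hρc.contDiff_convolution_left _ hρ hu

theorem pderiv'_mollify (hρ : ContDiff ℝ (⊤ : ℕ∞) ρ) (hρc : HasCompactSupport ρ)
    (hu : LocallyIntegrable u) (i : Fin d) (x : EuclideanSpace ℝ (Fin d)) :
    pderiv' (mollify ρ u) i x = ∫ y, pderiv' ρ i (x - y) * u y := by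
  rw [pderiv', mollify_eq_convolution,
    (hρc.hasFDerivAt_convolution_left (ContinuousLinearMap.lsmul ℝ ℝ)
      (hρ.of_le (by simp)) hu x).fderiv, convolution_eq_swap,
    ContinuousLinearMap.integral_apply]
  · rfl
  · have := (hρc.fderiv (𝕜 := ℝ)).convolutionExists_left
      ((ContinuousLinearMap.lsmul ℝ ℝ : ℝ →L[ℝ] ℝ →L[ℝ] ℝ).precompL (EuclideanSpace ℝ (Fin d)))
      (hρ.continuous_fderiv (by simp)) hu x
    exact this.integrable_swap

theorem pderiv'_reflect (hρ : ContDiff ℝ (⊤ : ℕ∞) ρ) (i : Fin d)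
    (x y : EuclideanSpace ℝ (Fin d)) :
    pderiv' (fun y => ρ (x - y)) i y = -pderiv' ρ i (x - y) := by
  have h1 : HasFDerivAt (fun y => ρ (x - y))
      ((fderiv ℝ ρ (x - y)).comp (-ContinuousLinearMap.id ℝ _)) y :=
    ((hρ.differentiable (by simp) (x - y)).hasFDerivAt).comp y ((hasFDerivAt_id y).const_sub x)
  rw [pderiv', h1.fderiv]
  simp [pderiv']

theorem pderiv'_mollify_of_weak (hρ : ContDiff ℝ (⊤ : ℕ∞) ρ) (hρc : HasCompactSupport ρ)
    (hu : LocallyIntegrable u) {p : EuclideanSpace ℝ (Fin d) → ℝ} {i : Fin d}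
    (hw : ∀ χ : EuclideanSpace ℝ (Fin d) → ℝ, ContDiff ℝ (⊤ : ℕ∞) χ → HasCompactSupport χ →
      ∫ x, pderiv' χ i x * u x = -∫ x, χ x * p x) :
    pderiv' (mollify ρ u) i = mollify ρ p := by
  ext x
  rw [pderiv'_mollify hρ hρc hu, mollify]
  have := hw (fun y => ρ (x - y)) (hρ.comp (contDiff_const.sub contDiff_id)) (hρc.reflect x)
  simp only [pderiv'_reflect hρ, neg_mul, integral_neg] at this
  linarith

variable {π : EuclideanSpace ℝ (Fin d) → ℝ}

theorem genL_mollify (hπ : ContDiff ℝ (⊤ : ℕ∞) π) (hpos : ∀ x, 0 < π x)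
    (hρ : ContDiff ℝ (⊤ : ℕ∞) ρ) (hρc : HasCompactSupport ρ)
    (hu : LocallyIntegrable u) {p : Fin d → EuclideanSpace ℝ (Fin d) → ℝ}
    (hp : ∀ i, LocallyIntegrable (p i)) {h : EuclideanSpace ℝ (Fin d) → ℝ}
    (hh : LocallyIntegrable h)
    (hw : ∀ i, ∀ χ : EuclideanSpace ℝ (Fin d) → ℝ, ContDiff ℝ (⊤ : ℕ∞) χ → HasCompactSupport χ →
      ∫ x, pderiv' χ i x * u x = -∫ x, χ x * p i x)
    (he : ∀ χ : EuclideanSpace ℝ (Fin d) → ℝ, ContDiff ℝ (⊤ : ℕ∞) χ → HasCompactSupport χ →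
      ∫ x, (h x * χ x + ∑ i, p i x * pderiv' χ i x) * π x = 0)
    (x : EuclideanSpace ℝ (Fin d)) :
    genL π (mollify ρ u) x = mollify ρ h x + ∑ i, ∫ y, ρ (x - y) *
      ((pderiv' (fun z => Real.log (π z)) i x - pderiv' (fun z => Real.log (π z)) i y) * p i y) := by
  have hL := contDiff_log_density hπ hpos
  have hLi : ∀ i, Continuous (pderiv' (fun z => Real.log (π z)) i) := fun i =>
    (contDiff_pderiv' hL i).continuous
  have hρ' : ∀ i, Continuous (pderiv' ρ i) := fun i => (contDiff_pderiv' hρ i).continuous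
  have i1 : Integrable fun y => ρ (x - y) * h y := integrable_mollify hρ.continuous hρc hh x
  have i2 : ∀ i, Integrable fun y => pderiv' ρ i (x - y) * p i y := fun i =>
    integrable_mollify (hρ' i) (hρc.pderiv' i) (hp i) x
  have i3 : ∀ i, Integrable fun y => ρ (x - y) * p i y := fun i =>
    integrable_mollify hρ.continuous hρc (hp i) x
  have i4 : ∀ i, Integrable fun y => ρ (x - y) * (pderiv' (fun z => Real.log (π z)) i y * p i y) :=
    fun i => integrable_mollify hρ.continuous hρc ((hp i).continuous_smul (hLi i)) x
  have hlap : lap (mollify ρ u) x = ∑ i, ∫ y, pderiv' ρ i (x - y) * p i y := by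
    refine Finset.sum_congr rfl fun i _ => ?_
    rw [pderiv2, ← pderiv'_mollify hρ hρc (hp i), ← pderiv'_mollify_of_weak hρ hρc hu (hw i)]
  have hχ : ContDiff ℝ (⊤ : ℕ∞) fun y => ρ (x - y) / π y :=
    (hρ.comp (contDiff_const.sub contDiff_id)).div hπ fun y => (hpos y).ne'
  have hχc : HasCompactSupport fun y => ρ (x - y) / π y := by
    simp only [div_eq_mul_inv]
    exact (hρc.reflect x).mul_right
  have key := he _ hχ hχc
  have hpt : ∀ y, (h y * (ρ (x - y) / π y) + ∑ i, p i y * pderiv' (fun y => ρ (x - y) / π y) i y)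
      * π y = ρ (x - y) * h y - (∑ i, pderiv' ρ i (x - y) * p i y
        + ∑ i, ρ (x - y) * (pderiv' (fun z => Real.log (π z)) i y * p i y)) := by
    intro y
    have hd : ∀ i, pderiv' (fun y => ρ (x - y) / π y) i y * π y
        = -pderiv' ρ i (x - y) - ρ (x - y) * pderiv' (fun z => Real.log (π z)) i y := by
      intro i
      have e := pderiv'_mul (hχ.differentiable (by simp) y) (hπ.differentiable (by simp) y) i
      have e2 : (fun y => ρ (x - y) / π y * π y) = fun y => ρ (x - y) :=
        funext fun y => div_mul_cancel₀ _ (hpos y).ne'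
      rw [e2, pderiv'_reflect hρ, pderiv'_density hπ hpos] at e
      have e3 : ρ (x - y) / π y * (π y * pderiv' (fun z => Real.log (π z)) i y)
        = ρ (x - y) * pderiv' (fun z => Real.log (π z)) i y := by
        field_simp [(hpos y).ne']
      linarith
    rw [add_mul, Finset.sum_mul, ← Finset.sum_add_distrib, mul_assoc,
      div_mul_cancel₀ _ (hpos y).ne', mul_comm (h y),
      sub_eq_add_neg (ρ (x - y) * h y), ← Finset.sum_neg_distrib]
    congr 1
    refine Finset.sum_congr rfl fun i _ => ?_
    rw [mul_assoc, hd i]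
    ring
  simp only [hpt] at key
  have j2 : Integrable fun y => ∑ i, pderiv' ρ i (x - y) * p i y :=
    integrable_finsetSum _ fun i _ => i2 i
  have j4 : Integrable fun y => ∑ i, ρ (x - y) * (pderiv' (fun z => Real.log (π z)) i y * p i y) :=
    integrable_finsetSum _ fun i _ => i4 i
  have j24 : Integrable fun y => ∑ i, pderiv' ρ i (x - y) * p i y
      + ∑ i, ρ (x - y) * (pderiv' (fun z => Real.log (π z)) i y * p i y) := j2.add j4
  rw [integral_sub i1 j24, integral_add j2 j4, integral_finsetSum _ fun i _ => i2 i,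
    integral_finsetSum _ fun i _ => i4 i, ← hlap] at key
  have hG : Gamma1 (fun z => Real.log (π z)) (mollify ρ u) x
      = ∑ i, ∫ y, ρ (x - y) * (pderiv' (fun z => Real.log (π z)) i x * p i y) := by
    refine Finset.sum_congr rfl fun i _ => ?_
    rw [pderiv'_mollify_of_weak hρ hρc hu (hw i), mollify, ← integral_const_mul]
    exact integral_congr_ae (Filter.Eventually.of_forall fun y => by ring)
  have hfin : ∑ i, ∫ y, ρ (x - y) *
      ((pderiv' (fun z => Real.log (π z)) i x - pderiv' (fun z => Real.log (π z)) i y) * p i y)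
      = ∑ i, (∫ y, ρ (x - y) * (pderiv' (fun z => Real.log (π z)) i x * p i y))
        - ∑ i, ∫ y, ρ (x - y) * (pderiv' (fun z => Real.log (π z)) i y * p i y) := by
    rw [← Finset.sum_sub_distrib]
    refine Finset.sum_congr rfl fun i _ => ?_
    have i5 : Integrable fun y => ρ (x - y) * (pderiv' (fun z => Real.log (π z)) i x * p i y) :=
      ((i3 i).const_mul (pderiv' (fun z => Real.log (π z)) i x)).congr
        (Filter.Eventually.of_forall fun y => by ring)
    rw [← integral_sub i5 (i4 i)]
    exact integral_congr_ae (Filter.Eventually.of_forall fun y => by ring)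
  rw [genL, hG, hfin]
  have : mollify ρ h x = ∫ y, ρ (x - y) * h y := rfl
  rw [this]
  linarith

end Mollification

section MollifierEstimates

variable {d : ℕ} {ρ : EuclideanSpace ℝ (Fin d) → ℝ}

/-- A smooth probability kernel supported in the ball of radius `δ`. -/
structure IsMollifier (ρ : EuclideanSpace ℝ (Fin d) → ℝ) (δ : ℝ) : Prop where
  contDiff : ContDiff ℝ (⊤ : ℕ∞) ρ
  hasCompactSupport : HasCompactSupport ρ
  nonneg : ∀ x, 0 ≤ ρ x
  integral_eq_one : ∫ x, ρ x = 1
  eq_zero_of_lt : ∀ x, δ < ‖x‖ → ρ x = 0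

theorem ContDiffBump.isMollifier_normed (φ : ContDiffBump (0 : EuclideanSpace ℝ (Fin d))) :
    IsMollifier (φ.normed volume) φ.rOut where
  contDiff := φ.contDiff_normed
  hasCompactSupport := φ.hasCompactSupport_normed
  nonneg := φ.nonneg_normed
  integral_eq_one := φ.integral_normed
  eq_zero_of_lt x hx := by
    by_contra h
    have : x ∈ Function.support (φ.normed volume) := h
    rw [φ.support_normed_eq, mem_ball_zero_iff] at this
    linarith

variable {δ : ℝ} (hρ : IsMollifier ρ δ)
include hρ

theorem IsMollifier.integral_reflect (x : EuclideanSpace ℝ (Fin d)) : ∫ y, ρ (x - y) = 1 := by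
  rw [integral_sub_left_eq_self ρ, hρ.integral_eq_one]

theorem IsMollifier.integrable_reflect (x : EuclideanSpace ℝ (Fin d)) :
    Integrable fun y => ρ (x - y) :=
  (hρ.contDiff.continuous.comp (continuous_const.sub continuous_id)).integrable_of_hasCompactSupport
    (hρ.hasCompactSupport.reflect x)

theorem IsMollifier.integrable_mul {u : EuclideanSpace ℝ (Fin d) → ℝ} (hu : LocallyIntegrable u)
    (x : EuclideanSpace ℝ (Fin d)) : Integrable fun y => ρ (x - y) * u y :=
  integrable_mollify hρ.contDiff.continuous hρ.hasCompactSupport hu x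

theorem IsMollifier.le_mollify {u : EuclideanSpace ℝ (Fin d) → ℝ} (hu : LocallyIntegrable u)
    {m : ℝ} (hm : ∀ᵐ x, m ≤ u x) (x : EuclideanSpace ℝ (Fin d)) : m ≤ mollify ρ u x := by
  have h := integral_mono_ae ((hρ.integrable_reflect x).mul_const m) (hρ.integrable_mul hu x) (by
    filter_upwards [hm] with y hy using mul_le_mul_of_nonneg_left hy (hρ.nonneg _))
  rwa [integral_mul_const, hρ.integral_reflect, one_mul] at h

theorem IsMollifier.mollify_le {u : EuclideanSpace ℝ (Fin d) → ℝ} (hu : LocallyIntegrable u)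
    {M : ℝ} (hM : ∀ᵐ x, u x ≤ M) (x : EuclideanSpace ℝ (Fin d)) : mollify ρ u x ≤ M := by
  have h := integral_mono_ae (hρ.integrable_mul hu x) ((hρ.integrable_reflect x).mul_const M) (by
    filter_upwards [hM] with y hy using mul_le_mul_of_nonneg_left hy (hρ.nonneg _))
  rwa [integral_mul_const, hρ.integral_reflect, one_mul] at h

theorem IsMollifier.mollify_sq_le {P : EuclideanSpace ℝ (Fin d) → ℝ} (hP : LocallyIntegrable P)
    (hP2 : LocallyIntegrable fun x => P x ^ 2) (x : EuclideanSpace ℝ (Fin d)) :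
    mollify ρ P x ^ 2 ≤ mollify ρ (fun x => P x ^ 2) x := by
  set a := mollify ρ P x with ha
  have h := integral_mono (((hρ.integrable_mul hP x).const_mul (2 * a)))
    (((hρ.integrable_reflect x).mul_const (a ^ 2)).add (hρ.integrable_mul hP2 x)) (fun y => by
      have := mul_nonneg (hρ.nonneg (x - y)) (sq_nonneg (a - P y))
      change 2 * a * (ρ (x - y) * P y) ≤ ρ (x - y) * a ^ 2 + ρ (x - y) * P y ^ 2
      linarith)
  rw [integral_const_mul, integral_add' ((hρ.integrable_reflect x).mul_const (a ^ 2))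
    (hρ.integrable_mul hP2 x), integral_mul_const, hρ.integral_reflect, one_mul] at h
  have e1 : ∫ y, ρ (x - y) * P y = a := rfl
  have e2 : ∫ y, ρ (x - y) * P y ^ 2 = mollify ρ (fun x => P x ^ 2) x := rfl
  rw [e1, e2] at h
  linarith

theorem IsMollifier.integral_mollify_sq_le {P : EuclideanSpace ℝ (Fin d) → ℝ}
    (hP : LocallyIntegrable P) (hP2 : LocallyIntegrable fun x => P x ^ 2) (hδ : δ ≤ 1) (R : ℝ) :
    ∫ x in Metric.closedBall 0 R, mollify ρ P x ^ 2 ≤ ∫ x in Metric.closedBall 0 (R + 1), P x ^ 2 := by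
  set g : EuclideanSpace ℝ (Fin d) → ℝ :=
    (Metric.closedBall 0 (R + 1)).indicator fun x => P x ^ 2 with hg
  have hgi : Integrable g := by
    rw [hg, integrable_indicator_iff Metric.isClosed_closedBall.measurableSet]
    exact hP2.integrableOn_isCompact (isCompact_closedBall _ _)
  have hg0 : ∀ x, 0 ≤ g x := fun x => Set.indicator_nonneg (fun x _ => sq_nonneg _) x
  have hρi : Integrable ρ := hρ.contDiff.continuous.integrable_of_hasCompactSupport
    hρ.hasCompactSupport
  have hmi : Integrable (mollify ρ g) := by
    rw [mollify_eq_convolution]; exact hρi.integrable_convolution _ hgi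
  have hm0 : ∀ x, 0 ≤ mollify ρ g x := fun x =>
    integral_nonneg fun y => mul_nonneg (hρ.nonneg _) (hg0 y)
  have htot : ∫ x, mollify ρ g x = ∫ x in Metric.closedBall 0 (R + 1), P x ^ 2 := by
    rw [mollify_eq_convolution, integral_convolution _ hρi hgi, hρ.integral_eq_one, hg,
      integral_indicator Metric.isClosed_closedBall.measurableSet]
    simp
  rw [← htot]
  refine (setIntegral_mono_on ?_ hmi.integrableOn Metric.isClosed_closedBall.measurableSet
    fun x hx => ?_).trans
    (setIntegral_le_integral hmi (Filter.Eventually.of_forall hm0))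
  · exact (((contDiff_mollify hρ.contDiff hρ.hasCompactSupport hP).continuous.pow 2)
      |>.locallyIntegrable).integrableOn_isCompact (isCompact_closedBall _ _)
  · refine (hρ.mollify_sq_le hP hP2 x).trans (le_of_eq ?_)
    refine integral_congr_ae (Filter.Eventually.of_forall fun y => ?_)
    change ρ (x - y) * P y ^ 2 = ρ (x - y) * g y
    by_cases hy : δ < ‖x - y‖
    · rw [hρ.eq_zero_of_lt _ hy]; simp
    · have : y ∈ Metric.closedBall (0 : EuclideanSpace ℝ (Fin d)) (R + 1) := by
        rw [mem_closedBall_zero_iff] at hx ⊢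
        have := norm_sub_norm_le y x
        rw [norm_sub_rev] at this
        linarith [not_lt.mp hy]
      rw [hg, Set.indicator_of_mem this]

theorem IsMollifier.abs_commutator_le {L p : Fin d → EuclideanSpace ℝ (Fin d) → ℝ}
    (hp : ∀ i, LocallyIntegrable (p i)) {ω : ℝ} {x : EuclideanSpace ℝ (Fin d)}
    (hω : ∀ i y, ‖x - y‖ ≤ δ → |L i x - L i y| ≤ ω) :
    |∑ i, ∫ y, ρ (x - y) * ((L i x - L i y) * p i y)| ≤
      ω * mollify ρ (fun y => ∑ i, |p i y|) x := by
  have hpa : ∀ i, LocallyIntegrable fun y => |p i y| := fun i x => ((hp i) x).norm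
  have e : ω * mollify ρ (fun y => ∑ i, |p i y|) x = ∑ i, ∫ y, ω * (ρ (x - y) * |p i y|) := by
    simp only [integral_const_mul, ← Finset.mul_sum]
    rw [← integral_finsetSum _ fun i _ => hρ.integrable_mul (hpa i) x]
    simp only [mollify, Finset.mul_sum]
  rw [e]
  refine (Finset.abs_sum_le_sum_abs _ _).trans (Finset.sum_le_sum fun i _ => ?_)
  refine (abs_integral_le_integral_abs).trans (integral_mono_of_nonneg
    (Filter.Eventually.of_forall fun y => abs_nonneg _) ((hρ.integrable_mul (hpa i) x).const_mul ω)
    (Filter.Eventually.of_forall fun y => ?_))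
  change |ρ (x - y) * ((L i x - L i y) * p i y)| ≤ ω * (ρ (x - y) * |p i y|)
  by_cases hy : δ < ‖x - y‖
  · rw [hρ.eq_zero_of_lt _ hy]; simp
  · rw [abs_mul, abs_mul, abs_of_nonneg (hρ.nonneg _)]
    have := mul_le_mul_of_nonneg_right (hω i y (not_lt.mp hy))
      (mul_nonneg (hρ.nonneg (x - y)) (abs_nonneg (p i y)))
    linarith

end MollifierEstimates

section MollifiedEquation

variable {d : ℕ}

theorem exists_pos_forall_abs_sub_le {L : Fin d → EuclideanSpace ℝ (Fin d) → ℝ}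
    (hL : ∀ i, Continuous (L i)) (R : ℝ) {ω : ℝ} (hω : 0 < ω) :
    ∃ δ > 0, ∀ x ∈ Metric.closedBall (0 : EuclideanSpace ℝ (Fin d)) R,
      ∀ y ∈ Metric.closedBall (0 : EuclideanSpace ℝ (Fin d)) R, ‖x - y‖ < δ →
        ∀ i, |L i x - L i y| ≤ ω := by
  have hc : Continuous fun x i => L i x := continuous_pi hL
  have := (isCompact_closedBall (0 : EuclideanSpace ℝ (Fin d)) R).uniformContinuousOn_of_continuous
    hc.continuousOn
  obtain ⟨δ, hδ, h⟩ := Metric.uniformContinuousOn_iff.mp this ω hω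
  refine ⟨δ, hδ, fun x hx y hy hxy i => ?_⟩
  have h1 := h x hx y hy (by rwa [dist_eq_norm])
  have h2 := dist_le_pi_dist (fun i => L i x) (fun i => L i y) i
  rw [Real.dist_eq] at h2
  exact h2.trans h1.le

theorem locallyIntegrable_of_ae_abs_le {h : EuclideanSpace ℝ (Fin d) → ℝ} {C : ℝ}
    (hh : AEStronglyMeasurable h) (hC : ∀ᵐ x, |h x| ≤ C) : LocallyIntegrable h :=
  (locallyIntegrable_const C).mono hh (by
    filter_upwards [hC] with x hx
    exact hx.trans (le_abs_self C))

/-- Bounded functions converging to zero almost everywhere have integrals over balls converging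
to zero. -/
theorem tendsto_setIntegral_zero {F : ℕ → EuclideanSpace ℝ (Fin d) → ℝ} {C : ℝ}
    (hF : ∀ n, AEStronglyMeasurable (F n)) (hC : ∀ n, ∀ᵐ x, |F n x| ≤ C)
    (h0 : ∀ᵐ x, Filter.Tendsto (fun n => F n x) Filter.atTop (nhds 0)) (R : ℝ) :
    Filter.Tendsto (fun n => ∫ x in Metric.closedBall 0 R, F n x) Filter.atTop (nhds 0) := by
  have : IsFiniteMeasure
      ((volume : Measure (EuclideanSpace ℝ (Fin d))).restrict (Metric.closedBall 0 R)) :=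
    isFiniteMeasure_restrict.mpr (measure_closedBall_lt_top (x := 0) (r := R)).ne
  have := tendsto_integral_of_dominated_convergence
    (μ := (volume : Measure (EuclideanSpace ℝ (Fin d))).restrict (Metric.closedBall 0 R))
    (F := F) (f := fun _ => 0) (fun _ => C) (fun n => (hF n).restrict) (integrable_const C)
    (fun n => ae_restrict_of_ae (hC n)) (ae_restrict_of_ae h0)
  simpa using this

/-- The radially scaled bump functions used as mollifiers. -/
def shrinkingBump (d n : ℕ) : ContDiffBump (0 : EuclideanSpace ℝ (Fin d)) where
  rIn := 1 / (2 * ((n : ℝ) + 1))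
  rOut := 1 / ((n : ℝ) + 1)
  rIn_pos := by positivity
  rIn_lt_rOut := by
    have : (0 : ℝ) < (n : ℝ) + 1 := by positivity
    exact one_div_lt_one_div_of_lt this (by linarith)

theorem tendsto_shrinkingBump_rOut (d : ℕ) :
    Filter.Tendsto (fun n => (shrinkingBump d n).rOut) Filter.atTop (nhds 0) :=
  tendsto_one_div_add_atTop_nhds_zero_nat

theorem ae_tendsto_mollify {u : EuclideanSpace ℝ (Fin d) → ℝ} (hu : LocallyIntegrable u) :
    ∀ᵐ x, Filter.Tendsto (fun n => mollify ((shrinkingBump d n).normed volume) u x)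
      Filter.atTop (nhds (u x)) := by
  have := ContDiffBump.ae_convolution_tendsto_right_of_locallyIntegrable (μ := volume)
    (φ := shrinkingBump d) (K := 2) (tendsto_shrinkingBump_rOut d)
    (Filter.Eventually.of_forall fun n => by
      change 1 / ((n : ℝ) + 1) ≤ 2 * (1 / (2 * ((n : ℝ) + 1)))
      rw [one_div, one_div, mul_inv]
      linarith [show 0 < ((n : ℝ) + 1)⁻¹ by positivity]) hu
  filter_upwards [this] with x hx
  simpa only [mollify_eq_convolution] using hx

variable {π u h q : EuclideanSpace ℝ (Fin d) → ℝ}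

/-- A bounded weak solution of `L u = h` is approximated, locally, by smooth functions with the
same bounds whose image under the generator is close to `h`. -/
theorem exists_mollification (hπ : ContDiff ℝ (⊤ : ℕ∞) π) (hpos : ∀ x, 0 < π x)
    {q : ℝ → ℝ} {m M C : ℝ}
    (hu : AEStronglyMeasurable u) (hum : ∀ᵐ x, m ≤ u x) (huM : ∀ᵐ x, u x ≤ M)
    (hh : AEStronglyMeasurable h) (hhC : ∀ᵐ x, |h x| ≤ C)
    {p : Fin d → EuclideanSpace ℝ (Fin d) → ℝ} (hp : ∀ i, LocallyIntegrable (p i))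
    (hp2 : ∀ i, LocallyIntegrable fun x => p i x ^ 2)
    (hw : ∀ i, ∀ χ : EuclideanSpace ℝ (Fin d) → ℝ, ContDiff ℝ (⊤ : ℕ∞) χ → HasCompactSupport χ →
      ∫ x, pderiv' χ i x * u x = -∫ x, χ x * p i x)
    (he : ∀ χ : EuclideanSpace ℝ (Fin d) → ℝ, ContDiff ℝ (⊤ : ℕ∞) χ → HasCompactSupport χ →
      ∫ x, (h x * χ x + ∑ i, p i x * pderiv' χ i x) * π x = 0)
    (hqm : Measurable q) (hqc : ContinuousOn q (Set.Icc m M)) (R : ℝ) {η : ℝ} (hη : 0 < η) :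
    ∃ v : EuclideanSpace ℝ (Fin d) → ℝ, ContDiff ℝ (⊤ : ℕ∞) v ∧ (∀ x, m ≤ v x) ∧
      (∀ x, v x ≤ M) ∧
      ∫ x in Metric.closedBall 0 R, (genL π v x - q (v x) - (h x - q (u x))) ^ 2 ≤ η ∧
      ∫ x in Metric.closedBall 0 R, |v x - u x| ≤ η := by
  set ρ := fun n => (shrinkingBump d n).normed (volume : Measure (EuclideanSpace ℝ (Fin d)))
  have hρ : ∀ n, IsMollifier (ρ n) (shrinkingBump d n).rOut := fun n =>
    (shrinkingBump d n).isMollifier_normed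
  have huL : LocallyIntegrable u := locallyIntegrable_of_ae_abs_le (C := max |m| |M|) hu (by
    filter_upwards [hum, huM] with x h1 h2 using abs_le_max_abs_abs h1 h2)
  have hhL := locallyIntegrable_of_ae_abs_le hh hhC
  obtain ⟨Cq, hCq⟩ := isCompact_Icc.exists_bound_of_continuousOn hqc
  simp only [Real.norm_eq_abs] at hCq
  set v := fun n => mollify (ρ n) u
  have hv : ∀ n, ContDiff ℝ (⊤ : ℕ∞) (v n) := fun n =>
    contDiff_mollify (hρ n).contDiff (hρ n).hasCompactSupport huL
  have hvm : ∀ n x, m ≤ v n x := fun n => (hρ n).le_mollify huL hum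
  have hvM : ∀ n x, v n x ≤ M := fun n => (hρ n).mollify_le huL huM
  have hhm : ∀ n x, |mollify (ρ n) h x| ≤ C := fun n x => abs_le.mpr
    ⟨(hρ n).le_mollify hhL (by filter_upwards [hhC] with x hx using (abs_le.mp hx).1) x,
      (hρ n).mollify_le hhL (by filter_upwards [hhC] with x hx using (abs_le.mp hx).2) x⟩
  have hqv : ∀ n, Continuous fun x => q (v n x) := fun n => continuousOn_univ.mp
    (hqc.comp (hv n).continuous.continuousOn fun x _ => ⟨hvm n x, hvM n x⟩)
  have hqu : AEStronglyMeasurable fun x => q (u x) :=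
    (hqm.comp_aemeasurable hu.aemeasurable).aestronglyMeasurable
  set F := fun n x => mollify (ρ n) h x - h x - (q (v n x) - q (u x))
  have hFm : ∀ n, AEStronglyMeasurable (F n) := fun n =>
    (((contDiff_mollify (hρ n).contDiff (hρ n).hasCompactSupport
      hhL).continuous.aestronglyMeasurable).sub hh).sub ((hqv n).aestronglyMeasurable.sub hqu)
  have hFC : ∀ n, ∀ᵐ x, |F n x| ≤ 2 * C + 2 * Cq := fun n => by
    filter_upwards [hum, huM, hhC] with x h1 h2 h3
    have a1 := abs_le.mp (hhm n x)
    have a2 := abs_le.mp h3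
    have a3 := abs_le.mp (hCq _ ⟨hvm n x, hvM n x⟩)
    have a4 := abs_le.mp (hCq _ ⟨h1, h2⟩)
    refine abs_le.mpr ⟨?_, ?_⟩ <;> simp only [F] <;> linarith
  have hF0 : ∀ᵐ x, Filter.Tendsto (fun n => F n x) Filter.atTop (nhds 0) := by
    filter_upwards [ae_tendsto_mollify huL, ae_tendsto_mollify hhL, hum, huM] with x t1 t2 h1 h2
    have t3 : Filter.Tendsto (fun n => q (v n x)) Filter.atTop (nhds (q (u x))) :=
      (hqc (u x) ⟨h1, h2⟩).tendsto.comp (tendsto_nhdsWithin_iff.mpr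
        ⟨t1, Filter.Eventually.of_forall fun n => ⟨hvm n x, hvM n x⟩⟩)
    have := (t2.sub_const (h x)).sub (t3.sub_const (q (u x)))
    simpa using this
  have hF2C : ∀ n, ∀ᵐ x, |F n x ^ 2| ≤ (2 * C + 2 * Cq) ^ 2 := fun n => by
    filter_upwards [hFC n] with x hx
    rw [abs_pow]
    exact pow_le_pow_left₀ (abs_nonneg _) hx 2
  have lim1 := tendsto_setIntegral_zero (F := fun n x => F n x ^ 2) (fun n => (hFm n).pow 2) hF2C
    (by filter_upwards [hF0] with x hx; simpa using hx.pow 2) R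
  have lim2 := tendsto_setIntegral_zero (F := fun n x => |v n x - u x|) (C := M - m)
    (fun n => ((hv n).continuous.aestronglyMeasurable.sub hu).norm)
    (fun n => by
      filter_upwards [hum, huM] with x h1 h2
      rw [abs_abs]
      exact abs_le.mpr ⟨by linarith [hvm n x], by linarith [hvM n x]⟩)
    (by
      filter_upwards [ae_tendsto_mollify huL] with x hx
      simpa using (hx.sub_const (u x)).abs) R
  set P : EuclideanSpace ℝ (Fin d) → ℝ := fun x => ∑ i, |p i x| with hPdef
  have hpa : ∀ i, LocallyIntegrable fun x => |p i x| := fun i x => ((hp i) x).norm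
  have hPL : LocallyIntegrable P := locallyIntegrable_finsetSum _ fun i _ => hpa i
  have hP2 : LocallyIntegrable fun x => P x ^ 2 :=
    ((locallyIntegrable_finsetSum Finset.univ fun i _ => hp2 i).smul (d : ℝ)).mono
      (hPL.aestronglyMeasurable.pow 2) (Filter.Eventually.of_forall fun x => by
        rw [Real.norm_eq_abs, Real.norm_eq_abs]
        refine abs_le_abs_of_nonneg (sq_nonneg _) ?_
        have := sq_sum_le_card_mul_sum_sq (s := Finset.univ) (f := fun i => |p i x|)
        simpa using this)
  set I := ∫ x in Metric.closedBall 0 (R + 1), P x ^ 2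
  have hI : 0 ≤ I := integral_nonneg fun x => sq_nonneg _
  set ω := √(η / (4 * (I + 1)))
  have hω : 0 < ω := Real.sqrt_pos.mpr (by positivity)
  have hω2 : 2 * (ω ^ 2 * I) ≤ η / 2 := by
    rw [Real.sq_sqrt (by positivity), div_mul_eq_mul_div, mul_div_assoc', div_le_div_iff₀
      (by positivity) (by positivity)]
    nlinarith
  have hLc : ∀ i, Continuous (pderiv' (fun z => Real.log (π z)) i) := fun i =>
    (contDiff_pderiv' (contDiff_log_density hπ hpos) i).continuous
  obtain ⟨δ, hδ, hunif⟩ := exists_pos_forall_abs_sub_le hLc (R + 1) hω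
  obtain ⟨n, ⟨⟨hn1, hn2⟩, hn3⟩, hn4⟩ := (((lim1.eventually (ge_mem_nhds (by positivity : 0 < η / 4))).and
    (lim2.eventually (ge_mem_nhds hη))).and ((tendsto_shrinkingBump_rOut d).eventually
      (gt_mem_nhds hδ))).and ((tendsto_shrinkingBump_rOut d).eventually
      (ge_mem_nhds (zero_lt_one))) |>.exists
  refine ⟨v n, hv n, hvm n, hvM n, ?_, hn2⟩
  have hmP := contDiff_mollify (hρ n).contDiff (hρ n).hasCompactSupport hPL
  have hMI : IntegrableOn (fun x => mollify (ρ n) P x ^ 2) (Metric.closedBall 0 R) :=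
    (hmP.continuous.pow 2).locallyIntegrable.integrableOn_isCompact (isCompact_closedBall _ _)
  have hFI : IntegrableOn (fun x => F n x ^ 2) (Metric.closedBall 0 R) :=
    (locallyIntegrable_of_ae_abs_le ((hFm n).pow 2) (hF2C n)).integrableOn_isCompact
      (isCompact_closedBall _ _)
  have hpt : ∀ x ∈ Metric.closedBall (0 : EuclideanSpace ℝ (Fin d)) R,
      (genL π (v n) x - q (v n x) - (h x - q (u x))) ^ 2 ≤
        2 * F n x ^ 2 + 2 * (ω ^ 2 * mollify (ρ n) P x ^ 2) := by
    intro x hx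
    rw [genL_mollify hπ hpos (hρ n).contDiff (hρ n).hasCompactSupport huL hp hhL hw he]
    have hc := (hρ n).abs_commutator_le (L := pderiv' (fun z => Real.log (π z))) hp (ω := ω) (x := x)
      (fun i y hy => by
        refine hunif x (Metric.closedBall_subset_closedBall (by linarith) hx) y ?_
          (hy.trans_lt hn3) i
        rw [mem_closedBall_zero_iff] at hx ⊢
        have := norm_sub_norm_le y x
        rw [norm_sub_rev] at this
        linarith)
    set G := ∑ i, ∫ y, ρ n (x - y) * ((pderiv' (fun z => Real.log (π z)) i x
      - pderiv' (fun z => Real.log (π z)) i y) * p i y)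
    have hG : G ^ 2 ≤ ω ^ 2 * mollify (ρ n) P x ^ 2 := by
      rw [← mul_pow, ← sq_abs G]
      exact pow_le_pow_left₀ (abs_nonneg _) hc 2
    have e : mollify (ρ n) h x + G - q (v n x) - (h x - q (u x)) = F n x + G := by
      simp only [F]; ring
    rw [e]
    nlinarith [sq_nonneg (F n x - G)]
  have hbound : IntegrableOn (fun x => 2 * F n x ^ 2 + 2 * (ω ^ 2 * mollify (ρ n) P x ^ 2))
      (Metric.closedBall 0 R) := (hFI.const_mul 2).add ((hMI.const_mul (ω ^ 2)).const_mul 2)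
  refine (integral_mono_of_nonneg (Filter.Eventually.of_forall fun x => sq_nonneg _) hbound
    ((ae_restrict_iff' Metric.isClosed_closedBall.measurableSet).mpr
      (Filter.Eventually.of_forall hpt))).trans ?_
  rw [integral_add (hFI.const_mul 2) ((hMI.const_mul (ω ^ 2)).const_mul 2), integral_const_mul,
    integral_const_mul, integral_const_mul]
  have := (hρ n).integral_mollify_sq_le hPL hP2 hn4 R
  have := mul_le_mul_of_nonneg_left this (sq_nonneg ω)
  linarith

end MollifiedEquation

section DensityMeasure

variable {d : ℕ} {π : EuclideanSpace ℝ (Fin d) → ℝ}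

/-- The measure with density `π`. -/
def densityMeasure (π : EuclideanSpace ℝ (Fin d) → ℝ) : Measure (EuclideanSpace ℝ (Fin d)) :=
  volume.withDensity fun x => ENNReal.ofReal (π x)

theorem integral_densityMeasure (hπ : Continuous π) (hpos : ∀ x, 0 < π x)
    (f : EuclideanSpace ℝ (Fin d) → ℝ) : ∫ x, f x ∂densityMeasure π = ∫ x, f x * π x := by
  rw [densityMeasure, integral_withDensity_eq_integral_toReal_smul
    hπ.measurable.ennreal_ofReal (by simp)]
  simp only [ENNReal.toReal_ofReal (hpos _).le, smul_eq_mul, mul_comm]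

theorem integrable_densityMeasure_iff (hπ : Continuous π) (hpos : ∀ x, 0 < π x)
    {f : EuclideanSpace ℝ (Fin d) → ℝ} :
    Integrable f (densityMeasure π) ↔ Integrable fun x => f x * π x := by
  rw [densityMeasure, integrable_withDensity_iff
    hπ.measurable.ennreal_ofReal (by simp)]
  simp only [ENNReal.toReal_ofReal (hpos _).le]

theorem volume_absolutelyContinuous_densityMeasure (hπ : Continuous π) (hpos : ∀ x, 0 < π x) :
    (volume : Measure (EuclideanSpace ℝ (Fin d))) ≪ densityMeasure π :=
  withDensity_absolutelyContinuous' hπ.measurable.ennreal_ofReal.aemeasurable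
    (Filter.Eventually.of_forall fun x => by simpa using hpos x)

theorem isProbabilityMeasure_densityMeasure (hpos : ∀ x, 0 < π x)
    (hπi : Integrable π) (h1 : ∫ x, π x = 1) : IsProbabilityMeasure (densityMeasure π) := by
  constructor
  rw [densityMeasure, withDensity_apply _ MeasurableSet.univ, Measure.restrict_univ,
    ← ofReal_integral_eq_lintegral_ofReal hπi (Filter.Eventually.of_forall fun x => (hpos x).le), h1,
    ENNReal.ofReal_one]

theorem locallyIntegrable_of_integrable_densityMeasure (hπ : Continuous π) (hpos : ∀ x, 0 < π x)
    {f : EuclideanSpace ℝ (Fin d) → ℝ} (hf : Integrable f (densityMeasure π)) :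
    LocallyIntegrable f := by
  have h1 := ((integrable_densityMeasure_iff hπ hpos).mp hf).locallyIntegrable.continuous_smul
    (hπ.inv₀ fun x => (hpos x).ne')
  have : (fun x => π⁻¹ x • (f x * π x)) = f := by
    funext x
    rw [Pi.inv_apply, smul_eq_mul, mul_comm, mul_assoc, mul_inv_cancel₀ (hpos x).ne', mul_one]
  rwa [this] at h1

theorem integrable_snd_sq_densityMeasure (U : PairSpace (densityMeasure π)) (i : Fin d) :
    Integrable (fun x => (U.snd x i) ^ 2) (densityMeasure π) := by
  have h := (memLp_two_iff_integrable_sq_norm (Lp.aestronglyMeasurable U.snd)).mp (Lp.memLp U.snd)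
  refine h.mono ((((PiLp.continuous_apply 2 _ i).comp_aestronglyMeasurable
    (Lp.aestronglyMeasurable U.snd)).pow 2)) (Filter.Eventually.of_forall fun x => ?_)
  rw [Real.norm_eq_abs, Real.norm_eq_abs, abs_pow, abs_of_nonneg (sq_nonneg ‖U.snd x‖)]
  exact pow_le_pow_left₀ (abs_nonneg _) (PiLp.norm_apply_le (U.snd x) i) 2

variable [IsFiniteMeasure (densityMeasure π)] {s : ℝ}

theorem integrable_snd_densityMeasure (U : PairSpace (densityMeasure π)) (i : Fin d) :
    Integrable (fun x => U.snd x i) (densityMeasure π) :=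
  ((memLp_two_iff_integrable_sq ((PiLp.continuous_apply 2 _ i).comp_aestronglyMeasurable
    (Lp.aestronglyMeasurable U.snd))).mpr (integrable_snd_sq_densityMeasure U i)).integrable
    (by norm_num)

/-- Elements of the weighted Sobolev space have weak derivatives with respect to Lebesgue
measure. -/
theorem weak_pderiv'_of_mem_sobolevSpace (hπ : ContDiff ℝ (⊤ : ℕ∞) π) (hpos : ∀ x, 0 < π x)
    (hs : s ≠ 0) {U : PairSpace (densityMeasure π)} (hU : U ∈ sobolevSpace (densityMeasure π) s)
    (i : Fin d) {χ : EuclideanSpace ℝ (Fin d) → ℝ} (hχ : ContDiff ℝ (⊤ : ℕ∞) χ)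
    (hχc : HasCompactSupport χ) :
    ∫ x, pderiv' χ i x * U.fst x = -∫ x, χ x * (s⁻¹ * U.snd x i) := by
  have hinv : Continuous fun x => (π x)⁻¹ := hπ.continuous.inv₀ fun x => (hpos x).ne'
  have ha : MemLp (fun x => (π x)⁻¹ * pderiv' χ i x) 2 (densityMeasure π) := by
    have hc : Continuous fun x => (π x)⁻¹ * pderiv' χ i x :=
      hinv.mul (contDiff_pderiv' hχ i).continuous
    obtain ⟨C, hC⟩ := ((hχc.pderiv' i).mul_left (f := fun x => (π x)⁻¹)).exists_bound_of_continuous hc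
    exact MemLp.of_bound hc.aestronglyMeasurable C (Filter.Eventually.of_forall hC)
  have hb : MemLp (fun x => EuclideanSpace.single i ((π x)⁻¹ * (s⁻¹ * χ x))) 2 (densityMeasure π) := by
    have hc : Continuous fun x => (π x)⁻¹ * (s⁻¹ * χ x) :=
      hinv.mul (continuous_const.mul hχ.continuous)
    obtain ⟨C, hC⟩ := ((hχc.mul_left (f := fun _ => s⁻¹)).mul_left
      (f := fun x => (π x)⁻¹)).exists_bound_of_continuous hc
    refine MemLp.of_bound (f := fun x => EuclideanSpace.single i ((π x)⁻¹ * (s⁻¹ * χ x)))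
      (Continuous.aestronglyMeasurable ?_) C
      (Filter.Eventually.of_forall fun x => by
        rw [PiLp.norm_single]; exact hC x)
    refine (PiLp.continuous_toLp 2 _).comp (continuous_pi fun j => ?_)
    by_cases hj : j = i
    · subst hj; simpa using hc
    · simpa [Pi.single_eq_of_ne hj] using continuous_const
  have hform : ∀ V : PairSpace (densityMeasure π), ⟪ha.toLp, V.fst⟫_ℝ + ⟪hb.toLp, V.snd⟫_ℝ
      = (∫ x, pderiv' χ i x * V.fst x) + ∫ x, χ x * (s⁻¹ * V.snd x i) := by
    intro V
    rw [L2.inner_def, L2.inner_def]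
    congr 1
    · rw [← integral_congr_ae (f := fun x => ((π x)⁻¹ * pderiv' χ i x) * V.fst x),
        integral_densityMeasure hπ.continuous hpos]
      · refine integral_congr_ae (Filter.Eventually.of_forall fun x => ?_)
        have := (hpos x).ne'
        field_simp
      · filter_upwards [ha.coeFn_toLp] with x hx
        rw [hx]
        simp [mul_comm]
    · rw [← integral_congr_ae (f := fun x => ((π x)⁻¹ * (s⁻¹ * χ x)) * V.snd x i),
        integral_densityMeasure hπ.continuous hpos]
      · refine integral_congr_ae (Filter.Eventually.of_forall fun x => ?_)
        have := (hpos x).ne'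
        field_simp
      · filter_upwards [hb.coeFn_toLp] with x hx
        rw [hx]
        simp [EuclideanSpace.inner_single_left]
  obtain ⟨ψ, hψ⟩ := exists_tendsto_gradPair hU
  have h1 : Filter.Tendsto (fun n => (gradPair (densityMeasure π) s (ψ n)).fst) Filter.atTop (nhds U.fst) :=
    ((WithLp.prod_continuous_ofLp 2 _ _).fst.tendsto U).comp hψ
  have h2 : Filter.Tendsto (fun n => (gradPair (densityMeasure π) s (ψ n)).snd) Filter.atTop (nhds U.snd) :=
    ((WithLp.prod_continuous_ofLp 2 _ _).snd.tendsto U).comp hψ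
  have hlim := ((tendsto_const_nhds (x := ha.toLp)).inner (𝕜 := ℝ) h1).add
    ((tendsto_const_nhds (x := hb.toLp)).inner (𝕜 := ℝ) h2)
  have hz : ∀ n, ⟪ha.toLp, (gradPair (densityMeasure π) s (ψ n)).fst⟫_ℝ
      + ⟪hb.toLp, (gradPair (densityMeasure π) s (ψ n)).snd⟫_ℝ = 0 := by
    intro n
    rw [hform]
    have hac := volume_absolutelyContinuous_densityMeasure hπ.continuous hpos
    have e1 : ∫ x, pderiv' χ i x * (gradPair (densityMeasure π) s (ψ n)).fst x = ∫ x, pderiv' χ i x * (ψ n).1 x := by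
      refine integral_congr_ae ?_
      filter_upwards [hac.ae_le (gradPair_fst s (ψ n))] with x hx
      rw [hx]
    have e2 : ∫ x, χ x * (s⁻¹ * (gradPair (densityMeasure π) s (ψ n)).snd x i)
        = ∫ x, χ x * pderiv' (ψ n).1 i x := by
      refine integral_congr_ae ?_
      filter_upwards [hac.ae_le (gradPair_snd s (ψ n))] with x hx
      rw [hx]
      simp [grad, inv_mul_cancel_left₀ hs]
    have hψs := (ψ n).2.1
    have i1 : Integrable fun x => pderiv' χ i x * (ψ n).1 x :=
      ((contDiff_pderiv' hχ i).continuous.mul hψs.continuous).integrable_of_hasCompactSupport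
        ((hχc.pderiv' i).mul_right)
    have i2 : Integrable fun x => χ x * pderiv' (ψ n).1 i x :=
      (hχ.continuous.mul (contDiff_pderiv' hψs i).continuous).integrable_of_hasCompactSupport
        hχc.mul_right
    rw [e1, e2, ← integral_add i1 i2]
    have := integral_pderiv'_eq_zero ((hχ.mul hψs).of_le (by simp)) hχc.mul_right i
    rw [← this]
    refine integral_congr_ae (Filter.Eventually.of_forall fun x => ?_)
    exact (pderiv'_mul (hχ.differentiable (by simp) x) (hψs.differentiable (by simp) x) i).symm
  simp only [hz] at hlim
  have := tendsto_nhds_unique hlim tendsto_const_nhds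
  rw [hform] at this
  linarith

/-- The weak equation tested against compactly supported functions, in coordinates. -/
theorem weak_equation_of_forall_mem_sobolevSpace (hπ : ContDiff ℝ (⊤ : ℕ∞) π) (hpos : ∀ x, 0 < π x)
    (hs : s ≠ 0) {U : PairSpace (densityMeasure π)} {k : EuclideanSpace ℝ (Fin d) → ℝ}
    (hk : Integrable k (densityMeasure π))
    (hU : ∀ V ∈ sobolevSpace (densityMeasure π) s,
      (∫ x, s ^ 2 * k x * V.fst x ∂densityMeasure π) + ⟪U.snd, V.snd⟫_ℝ = 0)
    {χ : EuclideanSpace ℝ (Fin d) → ℝ} (hχ : ContDiff ℝ (⊤ : ℕ∞) χ) (hχc : HasCompactSupport χ) :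
    ∫ x, (k x * χ x + ∑ i, s⁻¹ * U.snd x i * pderiv' χ i x) * π x = 0 := by
  set ψ : testSpace d := ⟨χ, mem_testSpace_of_hasCompactSupport hχ hχc⟩ with hψ
  have h := hU _ (gradPair_mem_sobolevSpace s ψ)
  rw [← integral_densityMeasure hπ.continuous hpos]
  obtain ⟨C, hC⟩ := hχc.exists_bound_of_continuous hχ.continuous
  have i1 : Integrable (fun x => k x * χ x) (densityMeasure π) :=
    hk.mul_bdd hχ.continuous.aestronglyMeasurable (Filter.Eventually.of_forall hC)
  have i2 : ∀ i, Integrable (fun x => s⁻¹ * U.snd x i * pderiv' χ i x) (densityMeasure π) := fun i => by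
    obtain ⟨C', hC'⟩ := (hχc.pderiv' i).exists_bound_of_continuous
      (contDiff_pderiv' hχ i).continuous
    exact ((integrable_snd_densityMeasure U i).const_mul s⁻¹).mul_bdd
      (contDiff_pderiv' hχ i).continuous.aestronglyMeasurable (Filter.Eventually.of_forall hC')
  rw [integral_add i1 (integrable_finsetSum _ fun i _ => i2 i)]
  have e1 : ∫ x, s ^ 2 * k x * (gradPair (densityMeasure π) s ψ).fst x ∂densityMeasure π = s ^ 2 * ∫ x, k x * χ x ∂densityMeasure π := by
    rw [← integral_const_mul]
    refine integral_congr_ae ?_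
    filter_upwards [gradPair_fst (μ := densityMeasure π) s ψ] with x hx
    rw [hx, mul_assoc]
  have e2 : ⟪U.snd, (gradPair (densityMeasure π) s ψ).snd⟫_ℝ
      = s ^ 2 * ∫ x, ∑ i, s⁻¹ * U.snd x i * pderiv' χ i x ∂densityMeasure π := by
    rw [L2.inner_def, ← integral_const_mul]
    refine integral_congr_ae ?_
    filter_upwards [gradPair_snd (μ := densityMeasure π) s ψ] with x hx
    rw [hx, inner_smul_right, PiLp.inner_apply, Finset.mul_sum, Finset.mul_sum]
    refine Finset.sum_congr rfl fun i _ => ?_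
    have : s ^ 2 * (s⁻¹ * U.snd x i * pderiv' χ i x) = s * (s * s⁻¹) * (U.snd x i * pderiv' χ i x) := by
      ring
    rw [this, mul_inv_cancel₀ hs]
    simp [grad, hψ]
    exact Or.inl (mul_comm _ _)
  rw [e1, e2, ← mul_add] at h
  exact (mul_eq_zero.mp h).resolve_left (pow_ne_zero 2 hs)

end DensityMeasure

section Oscillation

variable {d : ℕ}

theorem enorm_sub_le_lintegral_segment {v : EuclideanSpace ℝ (Fin d) → ℝ} (hv : ContDiff ℝ 1 v)
    (y h : EuclideanSpace ℝ (Fin d)) :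
    ‖v (y + h) - v y‖ₑ ≤ ∫⁻ t in Set.Ioc (0 : ℝ) 1, ‖fderiv ℝ v (y + t • h)‖ₑ * ‖h‖ₑ := by
  have hd : ∀ t : ℝ, HasDerivAt (fun t : ℝ => v (y + t • h)) (fderiv ℝ v (y + t • h) h) t := by
    intro t
    have h1 : HasDerivAt (fun t : ℝ => y + t • h) h t := by
      simpa using ((hasDerivAt_id t).smul_const h).const_add y
    exact ((hv.differentiable (by simp) _).hasFDerivAt).comp_hasDerivAt t h1
  have hc : Continuous fun t : ℝ => fderiv ℝ v (y + t • h) h :=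
    ((hv.continuous_fderiv (by simp)).comp (by fun_prop)).clm_apply continuous_const
  have := intervalIntegral.integral_eq_sub_of_hasDerivAt (fun t _ => hd t)
    (hc.intervalIntegrable 0 1)
  simp only [one_smul, zero_smul, add_zero] at this
  rw [← this, intervalIntegral.integral_of_le zero_le_one]
  refine (enorm_integral_le_lintegral_enorm _).trans (lintegral_mono fun t => ?_)
  exact ContinuousLinearMap.le_opENorm _ _

theorem lintegral_oscillation_le {v : EuclideanSpace ℝ (Fin d) → ℝ} (hv : ContDiff ℝ 1 v)
    (R : ℝ) :
    ∫⁻ y in Metric.closedBall 0 R, ∫⁻ x in Metric.closedBall 0 R, ‖v x - v y‖ₑ ≤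
      ENNReal.ofReal (2 * R) * volume (Metric.closedBall (0 : EuclideanSpace ℝ (Fin d)) (2 * R)) *
        ∫⁻ x in Metric.closedBall 0 R, ‖fderiv ℝ v x‖ₑ := by
  set B := Metric.closedBall (0 : EuclideanSpace ℝ (Fin d)) R with hB
  set B2 := Metric.closedBall (0 : EuclideanSpace ℝ (Fin d)) (2 * R) with hB2
  have hBm : MeasurableSet B := Metric.isClosed_closedBall.measurableSet
  set G : EuclideanSpace ℝ (Fin d) → ℝ≥0∞ := B.indicator fun x => ‖fderiv ℝ v x‖ₑ with hG
  have hGm : Measurable G :=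
    ((hv.continuous_fderiv (by simp)).enorm.measurable).indicator hBm
  have step : ∀ y ∈ B, ∫⁻ x in B, ‖v x - v y‖ₑ ≤
      ∫⁻ h in B2, ∫⁻ t in Set.Ioc (0 : ℝ) 1, ENNReal.ofReal (2 * R) * G (y + t • h) := by
    intro y hy
    rw [← lintegral_indicator hBm, ← lintegral_add_left_eq_self _ y,
      ← lintegral_indicator Metric.isClosed_closedBall.measurableSet]
    refine lintegral_mono fun h => ?_
    by_cases hh : y + h ∈ B
    · have hn : ‖h‖ ≤ 2 * R := by
        have h1 := norm_sub_le (y + h) y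
        rw [add_sub_cancel_left] at h1
        rw [mem_closedBall_zero_iff] at hh hy
        linarith
      rw [Set.indicator_of_mem hh, Set.indicator_of_mem (mem_closedBall_zero_iff.mpr hn)]
      refine (enorm_sub_le_lintegral_segment hv y h).trans (setLIntegral_mono' measurableSet_Ioc
        fun t ht => ?_)
      have hmem : y + t • h ∈ B := by
        have := (convex_closedBall (0 : EuclideanSpace ℝ (Fin d)) R).add_smul_mem hy hh
          ⟨ht.1.le, ht.2⟩
        exact this
      rw [hG, Set.indicator_of_mem hmem, mul_comm]
      refine mul_le_mul_left ?_ _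
      rw [← ofReal_norm]
      exact ENNReal.ofReal_le_ofReal hn
    · rw [Set.indicator_of_notMem hh]; exact zero_le
  calc ∫⁻ y in B, ∫⁻ x in B, ‖v x - v y‖ₑ
      ≤ ∫⁻ y in B, ∫⁻ h in B2, ∫⁻ t in Set.Ioc (0 : ℝ) 1,
          ENNReal.ofReal (2 * R) * G (y + t • h) := setLIntegral_mono' hBm step
    _ ≤ ∫⁻ y, ∫⁻ h in B2, ∫⁻ t in Set.Ioc (0 : ℝ) 1,
          ENNReal.ofReal (2 * R) * G (y + t • h) := setLIntegral_le_lintegral _ _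
    _ = ∫⁻ h in B2, ∫⁻ y, ∫⁻ t in Set.Ioc (0 : ℝ) 1,
          ENNReal.ofReal (2 * R) * G (y + t • h) := by
        refine lintegral_lintegral_swap (Measurable.aemeasurable ?_)
        refine Measurable.lintegral_prod_right' (f := fun z : (EuclideanSpace ℝ (Fin d) ×
          EuclideanSpace ℝ (Fin d)) × ℝ => ENNReal.ofReal (2 * R) * G (z.1.1 + z.2 • z.1.2)) ?_
        exact (hGm.comp (by fun_prop)).const_mul _
    _ = ∫⁻ h in B2, ∫⁻ t in Set.Ioc (0 : ℝ) 1, ∫⁻ y,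
          ENNReal.ofReal (2 * R) * G (y + t • h) := by
        refine lintegral_congr fun h => ?_
        refine lintegral_lintegral_swap (Measurable.aemeasurable ?_)
        exact (hGm.comp (f := fun z : EuclideanSpace ℝ (Fin d) × ℝ => z.1 + z.2 • h)
          (by fun_prop)).const_mul _
    _ = ENNReal.ofReal (2 * R) * volume B2 * ∫⁻ x in B, ‖fderiv ℝ v x‖ₑ := by
        have : ∀ (h : EuclideanSpace ℝ (Fin d)) (t : ℝ),
            ∫⁻ y, ENNReal.ofReal (2 * R) * G (y + t • h)
              = ENNReal.ofReal (2 * R) * ∫⁻ x in B, ‖fderiv ℝ v x‖ₑ := by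
          intro h t
          rw [show (fun y => ENNReal.ofReal (2 * R) * G (y + t • h))
            = fun y => ENNReal.ofReal (2 * R) * (G ∘ fun y => y + t • h) y from rfl,
            lintegral_const_mul _ (hGm.comp (measurable_add_const (t • h)))]
          simp only [Function.comp_def]
          rw [lintegral_add_right_eq_self G,
            hG, lintegral_indicator hBm]
        simp only [this, lintegral_const, Measure.restrict_apply MeasurableSet.univ, Set.univ_inter,
          Real.volume_Ioc, sub_zero, ENNReal.ofReal_one, mul_one]
        ring

/-- A Poincaré inequality in `L¹` on a ball, the constant being a value of the function. -/
theorem exists_forall_oscillation_le (d : ℕ) {R : ℝ} (hR : 0 < R) :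
    ∃ C > 0, ∀ v : EuclideanSpace ℝ (Fin d) → ℝ, ContDiff ℝ (⊤ : ℕ∞) v →
      ∃ y, ∫ x in Metric.closedBall 0 R, |v x - v y| ≤
        C * ∫ x in Metric.closedBall 0 R, √(∑ i, pderiv' v i x ^ 2) := by
  set B := Metric.closedBall (0 : EuclideanSpace ℝ (Fin d)) R with hB
  set A : ℝ≥0∞ := ENNReal.ofReal (2 * R) *
    volume (Metric.closedBall (0 : EuclideanSpace ℝ (Fin d)) (2 * R)) / volume B with hA
  have hB0 : volume B ≠ 0 := (Metric.measure_closedBall_pos volume _ hR).ne'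
  have hBt : volume B ≠ ∞ := measure_closedBall_lt_top.ne
  have hAt : A ≠ ∞ := ENNReal.div_ne_top
    (ENNReal.mul_ne_top ENNReal.ofReal_ne_top measure_closedBall_lt_top.ne) hB0
  refine ⟨A.toReal + 1, by positivity, fun v hv => ?_⟩
  have hv1 : ContDiff ℝ 1 v := hv.of_le (by simp)
  have hm : Measurable fun y => ∫⁻ x in B, ‖v x - v y‖ₑ :=
    Measurable.lintegral_prod_right' (f := fun z : EuclideanSpace ℝ (Fin d) ×
      EuclideanSpace ℝ (Fin d) => ‖v z.2 - v z.1‖ₑ)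
      ((hv.continuous.comp continuous_snd).sub (hv.continuous.comp continuous_fst)).enorm.measurable
  obtain ⟨y, -, hy⟩ := exists_le_setLAverage hB0 hBt hm.aemeasurable
  refine ⟨y, ?_⟩
  have hc : Continuous fun x => √(∑ i, pderiv' v i x ^ 2) :=
    (continuous_finsetSum _ fun i _ => (contDiff_pderiv' hv i).continuous.pow 2).sqrt
  have hIntg : IntegrableOn (fun x => √(∑ i, pderiv' v i x ^ 2)) B :=
    hc.locallyIntegrable.integrableOn_isCompact (isCompact_closedBall _ _)
  have h0 : 0 ≤ ∫ x in B, √(∑ i, pderiv' v i x ^ 2) := integral_nonneg fun x => Real.sqrt_nonneg _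
  have hle : ∫⁻ x in B, ‖v x - v y‖ₑ ≤
      A * ENNReal.ofReal (∫ x in B, √(∑ i, pderiv' v i x ^ 2)) := by
    rw [ofReal_integral_eq_lintegral_ofReal hIntg
      (Filter.Eventually.of_forall fun x => Real.sqrt_nonneg _)]
    refine hy.trans ?_
    rw [setLAverage_eq, hA, ENNReal.mul_div_right_comm.symm]
    refine ENNReal.div_le_div_right ((lintegral_oscillation_le hv1 R).trans ?_) _
    refine mul_le_mul_right (lintegral_mono fun x => ?_) _
    rw [← ofReal_norm]
    exact ENNReal.ofReal_le_ofReal (norm_fderiv_le_sqrt_sum x)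
  rw [← ENNReal.ofReal_toReal hAt, ← ENNReal.ofReal_mul ENNReal.toReal_nonneg] at hle
  have e : ∫ x in B, |v x - v y| = (∫⁻ x in B, ‖v x - v y‖ₑ).toReal :=
    integral_norm_eq_lintegral_enorm
      (hv.continuous.sub continuous_const).aestronglyMeasurable
  rw [e]
  have := ENNReal.toReal_le_of_le_ofReal (by positivity) hle
  nlinarith

end Oscillation

section WeightedPoincare

variable {d : ℕ} {π : EuclideanSpace ℝ (Fin d) → ℝ}

theorem exists_pos_bounds_on_closedBall (hπ : Continuous π) (hpos : ∀ x, 0 < π x) (R : ℝ) :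
    ∃ c P : ℝ, 0 < c ∧ 0 < P ∧ ∀ x ∈ Metric.closedBall (0 : EuclideanSpace ℝ (Fin d)) R,
      c ≤ π x ∧ π x ≤ P := by
  have hK := isCompact_closedBall (0 : EuclideanSpace ℝ (Fin d)) R
  obtain ⟨P, hP⟩ := hK.exists_bound_of_continuousOn hπ.continuousOn
  obtain ⟨c, hc⟩ := hK.exists_bound_of_continuousOn (f := fun x => (π x)⁻¹)
    (hπ.inv₀ fun x => (hpos x).ne').continuousOn
  refine ⟨(max c 1)⁻¹, max P 1, by positivity, by positivity, fun x hx => ⟨?_, ?_⟩⟩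
  · rw [inv_le_comm₀ (by positivity) (hpos x)]
    exact ((le_abs_self _).trans (hc x hx)).trans (le_max_left _ _)
  · exact ((le_abs_self _).trans (hP x hx)).trans (le_max_left _ _)

theorem exists_forall_weighted_oscillation_le (hπ : Continuous π) (hpos : ∀ x, 0 < π x)
    {R θ : ℝ} (hR : 0 < R) (hθ : 0 < θ) :
    ∃ β > 0, ∀ v : EuclideanSpace ℝ (Fin d) → ℝ, ContDiff ℝ (⊤ : ℕ∞) v →
      ∫ x in Metric.closedBall 0 R, (∑ i, pderiv' v i x ^ 2) * π x ≤ β →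
      ∃ y, ∫ x in Metric.closedBall 0 R, |v x - v y| * π x ≤ θ := by
  obtain ⟨c, P, hc, hP, hcP⟩ := exists_pos_bounds_on_closedBall hπ hpos R
  obtain ⟨C, hC, hosc⟩ := exists_forall_oscillation_le d hR
  set B := Metric.closedBall (0 : EuclideanSpace ℝ (Fin d)) R with hB
  have hBc : IsCompact B := isCompact_closedBall _ _
  have hBm : MeasurableSet B := hBc.measurableSet
  set V := volume.real B with hV
  have hV0 : 0 ≤ V := measureReal_nonneg
  set t := θ / (2 * P * C * (V + 1)) with ht
  have ht0 : 0 < t := by positivity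
  refine ⟨t * c * θ / (2 * P * C), by positivity, fun v hv hβ => ?_⟩
  obtain ⟨y, hy⟩ := hosc v hv
  refine ⟨y, ?_⟩
  have hS : Continuous fun x => ∑ i, pderiv' v i x ^ 2 :=
    continuous_finsetSum _ fun i _ => ((contDiff_pderiv' hv i).continuous.pow 2)
  have h1 : ∫ x in B, √(∑ i, pderiv' v i x ^ 2) ≤
      ∫ x in B, (t + (t * c)⁻¹ * ((∑ i, pderiv' v i x ^ 2) * π x)) := by
    refine setIntegral_mono_on (hS.sqrt.continuousOn.integrableOn_compact hBc)
      ((Continuous.continuousOn (by fun_prop)).integrableOn_compact hBc) hBm fun x hx => ?_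
    have hS0 : 0 ≤ ∑ i, pderiv' v i x ^ 2 := Finset.sum_nonneg fun i _ => sq_nonneg _
    have h2 : t⁻¹ * (∑ i, pderiv' v i x ^ 2) ≤ (t * c)⁻¹ * ((∑ i, pderiv' v i x ^ 2) * π x) := by
      have := mul_le_mul_of_nonneg_left (hcP x hx).1 hS0
      calc t⁻¹ * (∑ i, pderiv' v i x ^ 2) = (t * c)⁻¹ * ((∑ i, pderiv' v i x ^ 2) * c) := by
            field_simp
        _ ≤ _ := by gcongr
    refine le_trans ?_ (add_le_add_right h2 t)
    set r := √(∑ i, pderiv' v i x ^ 2)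
    have hr : ∑ i, pderiv' v i x ^ 2 = r ^ 2 := (Real.sq_sqrt hS0).symm
    rw [hr]
    have e : t + t⁻¹ * r ^ 2 - r = t⁻¹ * ((r - t / 2) ^ 2 + 3 / 4 * t ^ 2) := by
      field_simp; ring
    have : 0 ≤ t⁻¹ * ((r - t / 2) ^ 2 + 3 / 4 * t ^ 2) := by positivity
    linarith
  have h2 : ∫ x in B, (t + (t * c)⁻¹ * ((∑ i, pderiv' v i x ^ 2) * π x)) =
      t * V + (t * c)⁻¹ * ∫ x in B, (∑ i, pderiv' v i x ^ 2) * π x := by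
    rw [integral_add, integral_const_mul]
    · simp [hV, mul_comm, Measure.real]
    · exact continuousOn_const.integrableOn_compact hBc
    · exact (Continuous.continuousOn (by fun_prop)).integrableOn_compact hBc
  have h3 : ∫ x in B, |v x - v y| * π x ≤ P * ∫ x in B, |v x - v y| := by
    rw [← integral_const_mul]
    have hvc := hv.continuous
    refine setIntegral_mono_on ((Continuous.continuousOn (by fun_prop)).integrableOn_compact hBc)
      ((Continuous.continuousOn (by fun_prop)).integrableOn_compact hBc) hBm fun x hx => ?_
    rw [mul_comm]
    exact mul_le_mul_of_nonneg_right (hcP x hx).2 (abs_nonneg _)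
  have h4 : (t * c)⁻¹ * ∫ x in B, (∑ i, pderiv' v i x ^ 2) * π x ≤ θ / (2 * P * C) := by
    calc _ ≤ (t * c)⁻¹ * (t * c * θ / (2 * P * C)) := by gcongr
      _ = _ := by field_simp
  have h5 : t * V ≤ θ / (2 * P * C) := by
    calc t * V ≤ t * (V + 1) := by gcongr; linarith
      _ = _ := by rw [ht]; field_simp
  calc _ ≤ P * (C * (θ / (2 * P * C) + θ / (2 * P * C))) := by
        refine h3.trans ?_
        gcongr
        refine hy.trans ?_
        gcongr
        linarith
    _ = θ := by field_simp; ring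

end WeightedPoincare

section GradientDecay

/-- A primitive of the reaction term. -/
def reactionPrimitive (κ ε σ y : ℝ) : ℝ :=
  -κ * (y ^ 2 / 2 * Real.log y - y ^ 2 / 4) + ε * (y ^ 4 / 4 - Real.log y)
    + κ / 4 * (Real.log σ * y ^ 2)

theorem hasDerivAt_reactionPrimitive (κ ε σ : ℝ) {y : ℝ} (hy : 0 < y) :
    HasDerivAt (reactionPrimitive κ ε σ) (reaction κ ε σ y) y := by
  have hl := Real.hasDerivAt_log hy.ne'
  have h2 : HasDerivAt (fun y : ℝ => y ^ 2) (2 * y) y := by simpa using hasDerivAt_pow 2 y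
  have h4 : HasDerivAt (fun y : ℝ => y ^ 4) (4 * y ^ 3) y := by simpa using hasDerivAt_pow 4 y
  have := (((((h2.div_const 2).mul hl).sub (h2.div_const 4)).const_mul (-κ)).add
    (((h4.div_const 4).sub hl).const_mul ε)).add ((h2.const_mul (Real.log σ)).const_mul (κ / 4))
  refine this.congr_deriv ?_
  unfold reaction
  field_simp
  ring

theorem hasDerivAt_reaction (κ ε σ : ℝ) {y : ℝ} (hy : 0 < y) :
    HasDerivAt (reaction κ ε σ)
      (-κ * (Real.log y + 1) + ε * (3 * y ^ 2 + 1 / y ^ 2) + κ / 2 * Real.log σ) y := by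
  have hl := Real.hasDerivAt_log hy.ne'
  have h3 : HasDerivAt (fun y : ℝ => y ^ 3) (3 * y ^ 2) y := by simpa using hasDerivAt_pow 3 y
  have hi : HasDerivAt (fun y : ℝ => 1 / y) (-(y ^ 2)⁻¹) y := by
    simpa only [one_div] using hasDerivAt_inv hy.ne'
  have := (((((hasDerivAt_id y).mul hl)).const_mul (-κ)).add
    ((h3.sub hi).const_mul ε)).add (((hasDerivAt_id y).const_mul (Real.log σ)).const_mul (κ / 2))
  refine this.congr_deriv ?_
  simp only [id]
  field_simp
  ring

theorem neg_deriv_reaction_add_le {κ ε : ℝ} (hε : 0 < ε) (σ : ℝ) {y : ℝ} (hy : 0 < y) :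
    -deriv (reaction κ ε σ) y + reaction κ ε σ y / y ≤ κ := by
  rw [(hasDerivAt_reaction κ ε σ hy).deriv]
  have e : -(-κ * (Real.log y + 1) + ε * (3 * y ^ 2 + 1 / y ^ 2) + κ / 2 * Real.log σ)
      + reaction κ ε σ y / y = κ - ε * (2 * y ^ 2 + 2 / y ^ 2) := by
    unfold reaction; field_simp; ring
  rw [e]
  have : 0 ≤ ε * (2 * y ^ 2 + 2 / y ^ 2) := by positivity
  linarith

theorem contDiffOn_reaction (κ ε σ : ℝ) : ContDiffOn ℝ 1 (reaction κ ε σ) (Set.Ioi 0) := by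
  have hl : ContDiffOn ℝ 1 Real.log (Set.Ioi 0) :=
    Real.contDiffOn_log.mono fun y hy => (Set.mem_Ioi.mp hy).ne'
  have hi : ContDiffOn ℝ 1 (fun y : ℝ => 1 / y) (Set.Ioi 0) :=
    contDiffOn_const.div contDiffOn_id fun y hy => (Set.mem_Ioi.mp hy).ne'
  unfold reaction
  exact ((contDiffOn_const.mul (contDiffOn_id.mul hl)).add
    (contDiffOn_const.mul ((contDiffOn_id.pow 3).sub hi))).add
    (contDiffOn_const.mul (contDiffOn_const.mul contDiffOn_id))

theorem abs_reaction_le {κ ε K σ y : ℝ} (hκ : 0 < κ) (hε : 0 < ε) (hK : 1 ≤ K)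
    (hσ : |Real.log σ| ≤ 2 * K) (hy : 1 / K ≤ y) (hy' : y ≤ K) :
    |reaction κ ε σ y| ≤ 2 * κ * K ^ 3 + 2 * ε * K ^ 4 := by
  have hK0 : 0 < K := by linarith
  have hy0 : 0 < y := lt_of_lt_of_le (by positivity) hy
  have hl := abs_log_le hK hy hy'
  have hi : 1 / y ≤ K := by rw [one_div_le hy0 hK0]; exact hy
  have h1 : |y * Real.log y| ≤ K * K := by
    rw [abs_mul, abs_of_pos hy0]; gcongr
  have h2 : |y ^ 3 - 1 / y| ≤ K ^ 3 + K := by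
    have a1 : y ^ 3 ≤ K ^ 3 := by gcongr
    have a2 : 0 < y ^ 3 := by positivity
    have a3 : 0 < 1 / y := by positivity
    have a4 : 0 < K ^ 3 := by positivity
    exact abs_le.mpr ⟨by linarith, by linarith⟩
  have h3 : |Real.log σ * y| ≤ 2 * K * K := by
    rw [abs_mul, abs_of_pos hy0]; gcongr
  unfold reaction
  refine (abs_add_le _ _).trans ((add_le_add_left (abs_add_le _ _) _).trans ?_)
  rw [abs_mul (-κ), abs_mul ε, abs_mul (κ / 2), abs_neg, abs_of_pos hκ, abs_of_pos hε,
    abs_of_pos (half_pos hκ)]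
  have k1 := mul_le_mul_of_nonneg_left h1 hκ.le
  have k2 := mul_le_mul_of_nonneg_left h2 hε.le
  have k3 := mul_le_mul_of_nonneg_left h3 (half_pos hκ).le
  have p1 : K ^ 2 ≤ K ^ 3 := pow_le_pow_right₀ hK (by norm_num)
  have p2 : K ^ 3 ≤ K ^ 4 := pow_le_pow_right₀ hK (by norm_num)
  have p3 : K ≤ K ^ 4 := le_self_pow₀ hK (by norm_num)
  have q1 := mul_le_mul_of_nonneg_left p1 hκ.le
  have q2 := mul_le_mul_of_nonneg_left (add_le_add p2 p3) hε.le
  nlinarith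

theorem abs_reactionPrimitive_le {κ ε K σ y : ℝ} (hκ : 0 < κ) (hε : 0 < ε) (hK : 1 ≤ K)
    (hσ : |Real.log σ| ≤ 2 * K) (hy : 1 / K ≤ y) (hy' : y ≤ K) :
    |reactionPrimitive κ ε σ y| ≤ 2 * κ * K ^ 3 + 2 * ε * K ^ 4 := by
  have hK0 : 0 < K := by linarith
  have hy0 : 0 < y := lt_of_lt_of_le (by positivity) hy
  have hl := abs_log_le hK hy hy'
  have hy2 : y ^ 2 ≤ K ^ 2 := by gcongr
  have hy4 : y ^ 4 ≤ K ^ 4 := by gcongr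
  have p1 : K ^ 2 ≤ K ^ 3 := pow_le_pow_right₀ hK (by norm_num)
  have p3 : K ≤ K ^ 4 := le_self_pow₀ hK (by norm_num)
  have h1 : |y ^ 2 / 2 * Real.log y - y ^ 2 / 4| ≤ 3 / 4 * K ^ 3 := by
    refine (abs_sub _ _).trans ?_
    rw [abs_mul, abs_of_pos (show 0 < y ^ 2 / 2 by positivity),
      abs_of_pos (show 0 < y ^ 2 / 4 by positivity)]
    have : y ^ 2 / 2 * |Real.log y| ≤ K ^ 2 / 2 * K := by gcongr
    nlinarith
  have h2 : |y ^ 4 / 4 - Real.log y| ≤ 2 * K ^ 4 := by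
    refine (abs_sub _ _).trans ?_
    rw [abs_of_pos (show 0 < y ^ 4 / 4 by positivity)]
    linarith [show 0 < K ^ 4 by positivity]
  have h3 : |Real.log σ * y ^ 2| ≤ 2 * K * K ^ 2 := by
    rw [abs_mul, abs_of_pos (show 0 < y ^ 2 by positivity)]; gcongr
  unfold reactionPrimitive
  refine (abs_add_le _ _).trans ((add_le_add_left (abs_add_le _ _) _).trans ?_)
  rw [abs_mul (-κ), abs_mul ε, abs_mul (κ / 4), abs_neg, abs_of_pos hκ, abs_of_pos hε,
    abs_of_pos (show 0 < κ / 4 by positivity)]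
  have k1 := mul_le_mul_of_nonneg_left h1 hκ.le
  have k2 := mul_le_mul_of_nonneg_left h2 hε.le
  have k3 := mul_le_mul_of_nonneg_left h3 (show 0 ≤ κ / 4 by positivity)
  have : 0 ≤ κ * K ^ 3 := by positivity
  nlinarith

variable {d : ℕ} {π : EuclideanSpace ℝ (Fin d) → ℝ}
  {γ : EuclideanSpace ℝ (Fin d) → EuclideanSpace ℝ (Fin d)}

theorem setIntegral_error_le (hπ : Continuous π) (hpos : ∀ x, 0 < π x) (hπi : Integrable π)
    (hπ1 : ∫ x, π x = 1) (hγ : Continuous γ) (hγi : Integrable fun x => ‖γ x‖ ^ 2 * π x)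
    {r : EuclideanSpace ℝ (Fin d) → ℝ} (hr : Continuous r) {B : Set (EuclideanSpace ℝ (Fin d))}
    (hB : IsCompact B) {G : ℝ} (hG : ∀ x ∈ B, ‖γ x‖ ^ 2 ≤ G) {η : ℝ} (hη : 0 < η) :
    ∫ x in B, (η + η * ‖γ x‖ ^ 2 + |r x| + |r x| ^ 2 * (1 + ‖γ x‖ ^ 2) / η) * π x ≤
      2 * η + η * (∫ x, ‖γ x‖ ^ 2 * π x) + (2 + G) / η * ∫ x in B, r x ^ 2 * π x := by
  have hra : Continuous fun x => |r x| := hr.abs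
  have i1 : IntegrableOn (fun x => 2 * η * π x) B := hπi.integrableOn.const_mul _
  have i2 : IntegrableOn (fun x => η * (‖γ x‖ ^ 2 * π x)) B := hγi.integrableOn.const_mul _
  have i3 : IntegrableOn (fun x => (2 + G) / η * (r x ^ 2 * π x)) B :=
    (((hr.pow 2).mul hπ).continuousOn.integrableOn_compact hB).const_mul _
  have i12 : IntegrableOn (fun x => 2 * η * π x + η * (‖γ x‖ ^ 2 * π x)) B := i1.add i2
  have h2 : ∫ x in B, (η + η * ‖γ x‖ ^ 2 + |r x| + |r x| ^ 2 * (1 + ‖γ x‖ ^ 2) / η) * π x ≤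
      ∫ x in B, (2 * η * π x + η * (‖γ x‖ ^ 2 * π x) + (2 + G) / η * (r x ^ 2 * π x)) := by
    refine setIntegral_mono_on ((Continuous.continuousOn (by fun_prop)).integrableOn_compact hB)
      (i12.add i3) hB.measurableSet fun x hx => ?_
    have a1 : |r x| ≤ η + r x ^ 2 / η := by
      have e : η + r x ^ 2 / η - |r x| = ((|r x| - η / 2) ^ 2 + 3 / 4 * η ^ 2) / η := by
        rw [← sq_abs (r x)]; field_simp; ring
      have : 0 ≤ ((|r x| - η / 2) ^ 2 + 3 / 4 * η ^ 2) / η := by positivity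
      linarith
    have a2 : |r x| ^ 2 * (1 + ‖γ x‖ ^ 2) / η ≤ r x ^ 2 * (1 + G) / η := by
      rw [sq_abs]
      gcongr
      exact hG x hx
    calc _ ≤ (η + η * ‖γ x‖ ^ 2 + (η + r x ^ 2 / η) + r x ^ 2 * (1 + G) / η) * π x :=
          mul_le_mul_of_nonneg_right (by linarith) (hpos x).le
      _ = _ := by ring
  rw [integral_add i12 i3, integral_add i1 i2, integral_const_mul, integral_const_mul,
    integral_const_mul] at h2
  have h4 : ∫ x in B, π x ≤ 1 := by
    rw [← hπ1]
    exact setIntegral_le_integral hπi (Filter.Eventually.of_forall fun x => (hpos x).le)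
  have h5 : ∫ x in B, ‖γ x‖ ^ 2 * π x ≤ ∫ x, ‖γ x‖ ^ 2 * π x :=
    setIntegral_le_integral hγi
      (Filter.Eventually.of_forall fun x => mul_nonneg (sq_nonneg _) (hpos x).le)
  have h6 := mul_le_mul_of_nonneg_left h4 (show 0 ≤ 2 * η by positivity)
  have h7 := mul_le_mul_of_nonneg_left h5 hη.le
  linarith

theorem error_budget {A Γ G η b : ℝ} (hA : 0 < A) (hG : 0 < 2 + G) (hη : 0 < η)
    (h : η * (2 * A * (2 + Γ)) ≤ b) :
    A * (2 * η + η * Γ + (2 + G) / η * (b * η / (2 * A * (2 + G)))) ≤ b := by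
  have e : A * (2 * η + η * Γ + (2 + G) / η * (b * η / (2 * A * (2 + G)))) =
      η * (2 * A * (2 + Γ)) / 2 + b / 2 := by field_simp
  linarith

theorem setIntegral_sum_sq_le (hπ : Continuous π) (hpos : ∀ x, 0 < π x)
    {v ζ : EuclideanSpace ℝ (Fin d) → ℝ} (hv : ContDiff ℝ (⊤ : ℕ∞) v)
    (hζ : ContDiff ℝ (⊤ : ℕ∞) ζ) (hζc : HasCompactSupport ζ) {R : ℝ}
    (hζR : ∀ x, ‖x‖ ≤ R → ζ x = 1) :
    ∫ x in Metric.closedBall 0 R, (∑ i, pderiv' v i x ^ 2) * π x ≤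
      ∫ x, ζ x ^ 4 * (∑ i, pderiv' v i x ^ 2) * π x := by
  have hS : Continuous fun x => (∑ i, pderiv' v i x ^ 2) * π x :=
    (continuous_finsetSum _ fun i _ => ((contDiff_pderiv' hv i).continuous.pow 2)).mul hπ
  have hi : Integrable fun x => ζ x ^ 4 * (∑ i, pderiv' v i x ^ 2) * π x := by
    simp_rw [mul_assoc]
    refine ((hζ.continuous.pow 4).mul hS).integrable_of_hasCompactSupport ?_
    have h4 : HasCompactSupport fun x => ζ x ^ 4 :=
      hζc.comp_left (g := fun y : ℝ => y ^ 4) (by simp)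
    exact h4.mul_right
  have hi0 : ∀ x, 0 ≤ ζ x ^ 4 * (∑ i, pderiv' v i x ^ 2) * π x := fun x =>
    mul_nonneg (mul_nonneg (by positivity) (Finset.sum_nonneg fun i _ => sq_nonneg _)) (hpos x).le
  refine le_trans (le_of_eq ?_) (setIntegral_le_integral (s := Metric.closedBall 0 R) hi
    (Filter.Eventually.of_forall hi0))
  refine setIntegral_congr_fun Metric.isClosed_closedBall.measurableSet fun x hx => ?_
  simp [hζR x (mem_closedBall_zero_iff.mp hx)]

theorem exists_forall_gradient_le (hd : 1 ≤ d) (hπ : ContDiff ℝ (⊤ : ℕ∞) π) (hpos : ∀ x, 0 < π x)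
    (hπ1 : ∫ x, π x = 1) (hγ : ContDiff ℝ (⊤ : ℕ∞) γ)
    (hstat : ∀ x, ∑ i, pderiv' (fun y => π y * γ y i) i x = 0)
    {lam κ : ℝ} (hcond : ∀ (x v : EuclideanSpace ℝ (Fin d)),
      lam * ‖v‖ ^ 2 ≤ ∑ i, ∑ j, Rtensor π γ i j x * v i * v j)
    {ε K : ℝ} (hκ : 0 < κ) (hκl : κ < lam) (hε : 0 < ε) (hK : 1 ≤ K)
    {R β : ℝ} (hR : 0 < R) (hβ : 0 < β) :
    ∃ R' > 0, ∃ δ > 0, ∀ σ, |Real.log σ| ≤ 2 * K → ∀ v : EuclideanSpace ℝ (Fin d) → ℝ,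
      ContDiff ℝ (⊤ : ℕ∞) v → (∀ x, 1 / K ≤ v x) → (∀ x, v x ≤ K) →
      ∫ x in Metric.closedBall 0 R', (genL π v x - reaction κ ε σ (v x)) ^ 2 * π x ≤ δ →
      ∫ x in Metric.closedBall 0 R, (∑ i, pderiv' v i x ^ 2) * π x ≤ β := by
  have hπi : Integrable π := by
    by_contra h
    rw [integral_undef h] at hπ1
    exact zero_ne_one hπ1
  have hγi := integrable_norm_drift_sq hd hπ hpos hπi hγ hstat (hκ.trans hκl) hcond
  set Γ := ∫ x, ‖γ x‖ ^ 2 * π x with hΓ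
  have hΓ0 : 0 ≤ Γ := integral_nonneg fun x => mul_nonneg (sq_nonneg _) (hpos x).le
  obtain ⟨C, hC, hcut⟩ := exists_cutoff d
  set C₀ := 2 * κ * K ^ 3 + 2 * ε * K ^ 4 with hC₀
  have hK0 : 0 < K := by linarith
  have hC₀0 : 0 < C₀ := by positivity
  set A := 3 + 2 * C₀ + K ^ 2 * C₀ ^ 2 + 1 / (1 / K) ^ 2 + K ^ 2 with hA
  have hA0 : 0 < A := by positivity
  have hlk : 0 < lam - κ := by linarith
  set η := min (1 / (16 * K ^ 2)) ((lam - κ) * β / (2 * A * (2 + Γ))) with hη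
  have hη0 : 0 < η := by positivity
  have hηK : η * (16 * K ^ 2) ≤ 1 := by
    have : η ≤ 1 / (16 * K ^ 2) := min_le_left _ _
    rwa [le_div_iff₀ (by positivity)] at this
  have hηβ : η * (2 * A * (2 + Γ)) ≤ (lam - κ) * β := by
    have : η ≤ (lam - κ) * β / (2 * A * (2 + Γ)) := min_le_right _ _
    rwa [le_div_iff₀ (by positivity)] at this
  have hη8 : η ≤ 1 / 8 := by nlinarith [one_le_pow₀ (n := 2) hK]
  set R₁ := max R (C / η ^ 2) with hR₁
  have hR₁0 : 0 < R₁ := lt_max_of_lt_left hR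
  obtain ⟨ζ, hζ, hζc, hζ0, hζ1, hζR, hζs, hζg⟩ := hcut R₁ hR₁0
  obtain ⟨G, hG⟩ := (isCompact_closedBall (0 : EuclideanSpace ℝ (Fin d)) (2 * R₁)).exists_bound_of_continuousOn
    (f := fun x => ‖γ x‖ ^ 2) (hγ.continuous.norm.pow 2).continuousOn
  have hG' : ∀ x ∈ Metric.closedBall (0 : EuclideanSpace ℝ (Fin d)) (2 * R₁), ‖γ x‖ ^ 2 ≤ |G| :=
    fun x hx => ((le_abs_self _).trans (hG x hx)).trans (le_abs_self _)
  refine ⟨2 * R₁, by positivity, (lam - κ) * β * η / (2 * A * (2 + |G|)), by positivity,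
    fun σ hσ v hv hv1 hv2 hδ => ?_⟩
  set B := Metric.closedBall (0 : EuclideanSpace ℝ (Fin d)) (2 * R₁) with hB
  have hBc : IsCompact B := isCompact_closedBall _ _
  have hgradζ : ∀ x, √(∑ i, pderiv' ζ i x ^ 2) ≤ η ^ 2 := fun x => by
    refine (hζg x).trans ?_
    rw [div_le_iff₀ hR₁0]
    have := le_max_right R (C / η ^ 2)
    rw [div_le_iff₀ (by positivity)] at this
    linarith
  have key := cutoff_gradient_integral (q := reaction κ ε σ) (Q := reactionPrimitive κ ε σ)
    hπ hpos hγ hstat hcond hv hζ hζc (m := 1 / K) (M := K) (C₀ := C₀) (η := η) (by positivity)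
    hv1 hv2 (contDiffOn_reaction κ ε σ) (fun y hy => hasDerivAt_reactionPrimitive κ ε σ hy)
    (fun y hy => neg_deriv_reaction_add_le hε σ hy)
    (fun y hy => abs_reaction_le hκ hε hK hσ hy.1 hy.2)
    (fun y hy => abs_reactionPrimitive_le hκ hε hK hσ hy.1 hy.2) hη0 hη8 (by nlinarith)
    (by nlinarith) hζ0 hζ1 hgradζ
  set r : EuclideanSpace ℝ (Fin d) → ℝ := fun x => genL π v x - reaction κ ε σ (v x) with hr
  have hrc : Continuous r := by
    refine (contDiff_genL hπ hpos hv).continuous.sub ?_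
    exact (contDiffOn_reaction κ ε σ).continuousOn.comp_continuous hv.continuous fun x =>
      lt_of_lt_of_le (by positivity : 0 < 1 / K) (hv1 x)
  have hγc := hγ.continuous
  have hπc := hπ.continuous
  set E : EuclideanSpace ℝ (Fin d) → ℝ := fun x =>
    (η + η * ‖γ x‖ ^ 2 + |r x| + |r x| ^ 2 * (1 + ‖γ x‖ ^ 2) / η) * π x with hE
  have hEc : Continuous E := by
    have : Continuous fun x => |r x| := hrc.abs
    simp only [hE]
    fun_prop
  have hE0 : ∀ x, 0 ≤ E x := fun x => mul_nonneg (by positivity) (hpos x).le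
  have h1 : ∫ x in tsupport ζ, E x ≤ ∫ x in B, E x :=
    setIntegral_mono_set (hEc.continuousOn.integrableOn_compact hBc)
      (Filter.Eventually.of_forall hE0) hζs.eventuallyLE
  have h2 : ∫ x in B, E x ≤ 2 * η + η * Γ + (2 + |G|) / η * ∫ x in B, r x ^ 2 * π x :=
    setIntegral_error_le hπc hpos hπi hπ1 hγc hγi hrc hBc hG' hη0
  have h6 : A * ∫ x in tsupport ζ, E x ≤ (lam - κ) * β :=
    (mul_le_mul_of_nonneg_left ((h1.trans h2).trans
      (add_le_add_right (mul_le_mul_of_nonneg_left hδ (by positivity)) _)) hA0.le).trans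
      (error_budget hA0 (by positivity) hη0 hηβ)
  have h7 := setIntegral_sum_sq_le hπc hpos hv hζ hζc fun x hx => hζR x (hx.trans (le_max_left _ _))
  exact le_of_mul_le_mul_left
    ((mul_le_mul_of_nonneg_left h7 hlk.le).trans (key.trans h6)) hlk

end GradientDecay

section SmoothApproximation

variable {d : ℕ} {π : EuclideanSpace ℝ (Fin d) → ℝ}

theorem log_le_self_of_one_le {K : ℝ} (hK : 1 ≤ K) : Real.log K ≤ K := by
  have := Real.log_le_sub_one_of_pos (show 0 < K by linarith)
  linarith

theorem setIntegral_mul_density_le (hπ : Continuous π) (hpos : ∀ x, 0 < π x) {P : ℝ}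
    {B : Set (EuclideanSpace ℝ (Fin d))} (hB : MeasurableSet B) (hP : ∀ x ∈ B, π x ≤ P)
    {g : EuclideanSpace ℝ (Fin d) → ℝ} (hg : IntegrableOn g B) (hg0 : ∀ x, 0 ≤ g x) :
    IntegrableOn (fun x => g x * π x) B ∧ ∫ x in B, g x * π x ≤ P * ∫ x in B, g x := by
  have hi : IntegrableOn (fun x => g x * π x) B := by
    refine Integrable.mul_bdd (c := P) hg hπ.aestronglyMeasurable ?_
    filter_upwards [ae_restrict_mem hB] with x hx
    rw [Real.norm_eq_abs, abs_of_pos (hpos x)]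
    exact hP x hx
  refine ⟨hi, ?_⟩
  rw [← integral_const_mul]
  refine setIntegral_mono_on hi (hg.const_mul P) hB fun x hx => ?_
  rw [mul_comm]
  exact mul_le_mul_of_nonneg_right (hP x hx) (hg0 x)

variable [IsProbabilityMeasure (densityMeasure π)]

theorem integral_residual_sq_le {κ ε K s : ℝ} (hκ : 0 < κ) (hε : 0 < ε) (hK : 1 ≤ K)
    {U₀ U₁ : PairSpace (densityMeasure π)} (h₀ : IsAdmissible (densityMeasure π) s K U₀)
    (h₁ : IsAdmissible (densityMeasure π) s K U₁) {σ : ℝ} (hσ : |Real.log σ| ≤ 2 * K) :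
    Integrable (fun x => ((U₁.fst x - U₀.fst x) / s ^ 2 + reaction κ ε σ (U₀.fst x)
        - reaction κ ε σ (U₁.fst x)) ^ 2) (densityMeasure π) ∧
    ∫ x, ((U₁.fst x - U₀.fst x) / s ^ 2 + reaction κ ε σ (U₀.fst x)
        - reaction κ ε σ (U₁.fst x)) ^ 2 ∂densityMeasure π ≤
      (1 / s ^ 2 + (3 * κ * K + 4 * ε * K ^ 2)) ^ 2 * ‖U₁.fst - U₀.fst‖ ^ 2 := by
  have hK0 : 0 < 1 / K := by positivity
  have hu₀ := Lp.aestronglyMeasurable U₀.fst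
  have hu₁ := Lp.aestronglyMeasurable U₁.fst
  have hrm : AEStronglyMeasurable (fun x => (U₁.fst x - U₀.fst x) / s ^ 2
      + reaction κ ε σ (U₀.fst x) - reaction κ ε σ (U₁.fst x)) (densityMeasure π) := by
    have m0 := ((measurable_reaction κ ε σ).comp_aemeasurable hu₀.aemeasurable).aestronglyMeasurable
    have m1 := ((measurable_reaction κ ε σ).comp_aemeasurable hu₁.aemeasurable).aestronglyMeasurable
    simp only [div_eq_mul_inv]
    exact (((hu₁.sub hu₀).mul_const _).add m0).sub m1
  set L := 3 * κ * K + 4 * ε * K ^ 2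
  have hle : ∀ᵐ x ∂densityMeasure π, ((U₁.fst x - U₀.fst x) / s ^ 2 + reaction κ ε σ (U₀.fst x)
      - reaction κ ε σ (U₁.fst x)) ^ 2 ≤ (1 / s ^ 2 + L) ^ 2 * (U₁.fst - U₀.fst) x ^ 2 := by
    filter_upwards [h₀.2, h₁.2, Lp.coeFn_sub U₁.fst U₀.fst] with x a0 a1 e
    rw [e, Pi.sub_apply, ← sq_abs, ← sq_abs (U₁.fst x - U₀.fst x), ← mul_pow]
    refine pow_le_pow_left₀ (abs_nonneg _) ?_ 2
    have hl := reaction_lipschitz hκ hε hK hσ a0.1 a0.2 a1.1 a1.2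
    have ht := abs_sub ((U₁.fst x - U₀.fst x) / s ^ 2)
      (reaction κ ε σ (U₁.fst x) - reaction κ ε σ (U₀.fst x))
    rw [abs_div, abs_of_nonneg (sq_nonneg s)] at ht
    have e2 : (U₁.fst x - U₀.fst x) / s ^ 2 + reaction κ ε σ (U₀.fst x)
      - reaction κ ε σ (U₁.fst x) = (U₁.fst x - U₀.fst x) / s ^ 2 -
      (reaction κ ε σ (U₁.fst x) - reaction κ ε σ (U₀.fst x)) := by ring
    rw [e2]
    refine ht.trans ((add_le_add_right hl _).trans (le_of_eq ?_))
    ring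
  have hi : Integrable (fun x => (1 / s ^ 2 + L) ^ 2 * (U₁.fst - U₀.fst) x ^ 2)
      (densityMeasure π) :=
    ((memLp_two_iff_integrable_sq (Lp.aestronglyMeasurable _)).mp (Lp.memLp _)).const_mul _
  have hi' : Integrable (fun x => ((U₁.fst x - U₀.fst x) / s ^ 2 + reaction κ ε σ (U₀.fst x)
        - reaction κ ε σ (U₁.fst x)) ^ 2) (densityMeasure π) :=
    hi.mono' (hrm.pow 2) (by
      filter_upwards [hle] with x hx
      rwa [Real.norm_eq_abs, abs_of_nonneg (sq_nonneg _)])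
  refine ⟨hi', (integral_mono_ae hi' hi hle).trans ?_⟩
  rw [integral_const_mul, norm_sq_eq_integral]

/-- Smooth approximation of an almost stationary pair on a ball. -/
theorem exists_smooth_approximation (hπ : ContDiff ℝ (⊤ : ℕ∞) π) (hpos : ∀ x, 0 < π x)
    {κ ε K s : ℝ} (hκ : 0 < κ) (hε : 0 < ε) (hK : 1 ≤ K) (hs : 0 < s)
    {U₀ U₁ : PairSpace (densityMeasure π)} (h₀ : IsAdmissible (densityMeasure π) s K U₀)
    (h₁ : IsAdmissible (densityMeasure π) s K U₁) {σ : ℝ} (hσ : |Real.log σ| ≤ 2 * K)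
    (hU : ∀ V ∈ sobolevSpace (densityMeasure π) s,
      (∫ x, (U₁.fst x - U₀.fst x + s ^ 2 * reaction κ ε σ (U₀.fst x)) * V.fst x ∂densityMeasure π)
        + ⟪U₁.snd, V.snd⟫_ℝ = 0) (R : ℝ) {η : ℝ} (hη : 0 < η) :
    ∃ v : EuclideanSpace ℝ (Fin d) → ℝ, ContDiff ℝ (⊤ : ℕ∞) v ∧ (∀ x, 1 / K ≤ v x) ∧
      (∀ x, v x ≤ K) ∧
      ∫ x in Metric.closedBall 0 R, (genL π v x - reaction κ ε σ (v x)) ^ 2 * π x ≤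
        η + 2 * ((1 / s ^ 2 + (3 * κ * K + 4 * ε * K ^ 2)) ^ 2 * ‖U₁.fst - U₀.fst‖ ^ 2) ∧
      ∫ x in Metric.closedBall 0 R, |v x - U₁.fst x| * π x ≤ η := by
  have hK0 : 0 < K := by linarith
  have hK1 : 0 < 1 / K := by positivity
  have hac := volume_absolutelyContinuous_densityMeasure hπ.continuous hpos
  have hq := continuousOn_reaction κ ε σ (m := 1 / K) (M := K) hK1
  have hu₀ := Lp.aestronglyMeasurable U₀.fst
  have hu₁ := Lp.aestronglyMeasurable U₁.fst
  set h : EuclideanSpace ℝ (Fin d) → ℝ :=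
    fun x => (U₁.fst x - U₀.fst x) / s ^ 2 + reaction κ ε σ (U₀.fst x) with hh
  have hhm : AEStronglyMeasurable h (densityMeasure π) := by
    have m0 := ((measurable_reaction κ ε σ).comp_aemeasurable hu₀.aemeasurable).aestronglyMeasurable
    simp only [hh, div_eq_mul_inv]
    exact ((hu₁.sub hu₀).mul_const _).add m0
  set C := K / s ^ 2 + (2 * κ * K ^ 3 + 2 * ε * K ^ 4) with hC
  have hhC : ∀ᵐ x ∂densityMeasure π, |h x| ≤ C := by
    filter_upwards [h₀.2, h₁.2] with x a0 a1
    refine (abs_add_le _ _).trans (add_le_add ?_ (abs_reaction_le hκ hε hK hσ a0.1 a0.2))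
    rw [abs_div, abs_of_nonneg (sq_nonneg s)]
    gcongr
    exact abs_le.mpr ⟨by linarith [a0.2, a1.1], by linarith [a0.1, a1.2]⟩
  have hhi : Integrable h (densityMeasure π) := Integrable.of_bound hhm C hhC
  have hU' : ∀ V ∈ sobolevSpace (densityMeasure π) s,
      (∫ x, s ^ 2 * h x * V.fst x ∂densityMeasure π) + ⟪U₁.snd, V.snd⟫_ℝ = 0 := by
    intro V hV
    rw [← hU V hV]
    congr 2
    funext x
    simp only [hh]
    field_simp
  obtain ⟨c, P, hc, hP, hcP⟩ := exists_pos_bounds_on_closedBall hπ.continuous hpos R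
  set B := Metric.closedBall (0 : EuclideanSpace ℝ (Fin d)) R with hB
  have hBc : IsCompact B := isCompact_closedBall _ _
  have hloc : ∀ i, LocallyIntegrable fun x => s⁻¹ * U₁.snd x i := fun i =>
    locallyIntegrable_of_integrable_densityMeasure hπ.continuous hpos
      ((integrable_snd_densityMeasure U₁ i).const_mul _)
  have hloc2 : ∀ i, LocallyIntegrable fun x => (s⁻¹ * U₁.snd x i) ^ 2 := fun i => by
    simp only [mul_pow]
    exact locallyIntegrable_of_integrable_densityMeasure hπ.continuous hpos
      ((integrable_snd_sq_densityMeasure U₁ i).const_mul _)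
  obtain ⟨v, hv, hv1, hv2, hvr, hvu⟩ := exists_mollification hπ hpos (hu₁.mono_ac hac)
    (hac.ae_le (h₁.2.mono fun x hx => hx.1)) (hac.ae_le (h₁.2.mono fun x hx => hx.2))
    (hhm.mono_ac hac) (hac.ae_le hhC) hloc hloc2
    (fun i χ hχ hχc => weak_pderiv'_of_mem_sobolevSpace hπ hpos hs.ne' h₁.1 i hχ hχc)
    (fun χ hχ hχc => weak_equation_of_forall_mem_sobolevSpace hπ hpos hs.ne' hhi hU' hχ hχc)
    (measurable_reaction κ ε σ) hq R (η := η / (2 * P)) (by positivity)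
  refine ⟨v, hv, hv1, hv2, ?_, ?_⟩
  · set a : EuclideanSpace ℝ (Fin d) → ℝ := fun x => genL π v x - reaction κ ε σ (v x) with ha
    set b : EuclideanSpace ℝ (Fin d) → ℝ := fun x => h x - reaction κ ε σ (U₁.fst x) with hb
    have hac' : Continuous a := (contDiff_genL hπ hpos hv).continuous.sub
      (hq.comp_continuous hv.continuous fun x => ⟨hv1 x, hv2 x⟩)
    obtain ⟨hbi, hble⟩ := integral_residual_sq_le hκ hε hK h₀ h₁ hσ (s := s)
    have hbπ : Integrable fun x => b x ^ 2 * π x :=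
      (integrable_densityMeasure_iff hπ.continuous hpos).mp hbi
    rw [integral_densityMeasure hπ.continuous hpos] at hble
    have hbm : AEStronglyMeasurable b volume :=
      (hhm.sub ((measurable_reaction κ ε σ).comp_aemeasurable
        hu₁.aemeasurable).aestronglyMeasurable).mono_ac hac
    have hbb : ∀ᵐ x, |b x| ≤ C + (2 * κ * K ^ 3 + 2 * ε * K ^ 4) := by
      filter_upwards [hac.ae_le hhC, hac.ae_le h₁.2] with x b1 b2
      exact (abs_sub _ _).trans (add_le_add b1 (abs_reaction_le hκ hε hK hσ b2.1 b2.2))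
    obtain ⟨D, hD⟩ := hBc.exists_bound_of_continuousOn hac'.continuousOn
    have hab : IntegrableOn (fun x => (a x - b x) ^ 2) B := by
      refine Measure.integrableOn_of_bounded (M := (D + (C + (2 * κ * K ^ 3 + 2 * ε * K ^ 4))) ^ 2)
        hBc.measure_lt_top.ne ((hac'.aestronglyMeasurable.sub hbm).pow 2) ?_
      filter_upwards [ae_restrict_of_ae hbb, ae_restrict_mem hBc.measurableSet] with x b1 b2
      rw [Real.norm_eq_abs, abs_pow]
      exact pow_le_pow_left₀ (abs_nonneg _)
        ((abs_sub _ _).trans (add_le_add (hD x b2) b1)) 2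
    obtain ⟨i1, i2⟩ := setIntegral_mul_density_le hπ.continuous hpos hBc.measurableSet
      (fun x hx => (hcP x hx).2) hab fun x => sq_nonneg _
    have i3 : ∫ x in B, a x ^ 2 * π x ≤
        ∫ x in B, (2 * ((a x - b x) ^ 2 * π x) + 2 * (b x ^ 2 * π x)) := by
      refine setIntegral_mono (((hac'.pow 2).mul
        hπ.continuous).continuousOn.integrableOn_compact hBc)
        ((i1.const_mul 2).add (hbπ.integrableOn.const_mul 2)) fun x => ?_
      have : 0 ≤ (a x - 2 * b x) ^ 2 * π x := mul_nonneg (sq_nonneg _) (hpos x).le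
      change a x ^ 2 * π x ≤ 2 * ((a x - b x) ^ 2 * π x) + 2 * (b x ^ 2 * π x)
      linarith
    rw [integral_add (i1.const_mul 2) (hbπ.integrableOn.const_mul 2), integral_const_mul,
      integral_const_mul] at i3
    have i4 : ∫ x in B, b x ^ 2 * π x ≤ ∫ x, b x ^ 2 * π x :=
      setIntegral_le_integral hbπ
        (Filter.Eventually.of_forall fun x => mul_nonneg (sq_nonneg _) (hpos x).le)
    have i5 : P * ∫ x in B, (a x - b x) ^ 2 ≤ η / 2 :=
      (mul_le_mul_of_nonneg_left hvr hP.le).trans (le_of_eq (by field_simp))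
    linarith
  · have hvb : IntegrableOn (fun x => |v x - U₁.fst x|) B := by
      refine Measure.integrableOn_of_bounded (M := K) hBc.measure_lt_top.ne
        ((hv.continuous.aestronglyMeasurable.sub (hu₁.mono_ac hac)).norm) ?_
      filter_upwards [ae_restrict_of_ae (hac.ae_le h₁.2)] with x b1
      rw [Real.norm_eq_abs, abs_abs]
      exact abs_le.mpr ⟨by linarith [hv1 x, b1.2], by linarith [hv2 x, b1.1]⟩
    refine (setIntegral_mul_density_le hπ.continuous hpos hBc.measurableSet
      (fun x hx => (hcP x hx).2) hvb fun x => abs_nonneg _).2.trans ?_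
    refine (mul_le_mul_of_nonneg_left hvu hP.le).trans ?_
    have : P * (η / (2 * P)) = η / 2 := by field_simp
    linarith

end SmoothApproximation

section Concentration

variable {d : ℕ} {π : EuclideanSpace ℝ (Fin d) → ℝ}
  {γ : EuclideanSpace ℝ (Fin d) → EuclideanSpace ℝ (Fin d)}

theorem exists_closedBall_mass (hπ1 : ∫ x, π x = 1) {θ : ℝ} (hθ : 0 < θ) :
    ∃ R > 0, 1 - θ ≤ ∫ x in Metric.closedBall 0 R, π x := by
  have hπi : Integrable π := by
    by_contra h
    rw [integral_undef h] at hπ1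
    exact zero_ne_one hπ1
  have ht := tendsto_setIntegral_of_monotone (μ := volume) (f := π)
    (s := fun n : ℕ => Metric.closedBall (0 : EuclideanSpace ℝ (Fin d)) n)
    (fun n => Metric.isClosed_closedBall.measurableSet)
    (fun m n h => Metric.closedBall_subset_closedBall (by exact_mod_cast h))
    hπi.integrableOn
  rw [Metric.iUnion_closedBall_nat, setIntegral_univ, hπ1] at ht
  obtain ⟨n, hn, hn0⟩ := ((ht.eventually (lt_mem_nhds (show 1 - θ < 1 by linarith))).and
    (Filter.eventually_gt_atTop 0)).exists
  exact ⟨n, by exact_mod_cast hn0, hn.le⟩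

variable [IsProbabilityMeasure (densityMeasure π)]

theorem exists_forall_concentration (hd : 1 ≤ d) (hπ : ContDiff ℝ (⊤ : ℕ∞) π)
    (hpos : ∀ x, 0 < π x) (hπ1 : ∫ x, π x = 1) (hγ : ContDiff ℝ (⊤ : ℕ∞) γ)
    (hstat : ∀ x, ∑ i, pderiv' (fun y => π y * γ y i) i x = 0)
    {lam κ : ℝ} (hcond : ∀ (x v : EuclideanSpace ℝ (Fin d)),
      lam * ‖v‖ ^ 2 ≤ ∑ i, ∑ j, Rtensor π γ i j x * v i * v j)
    {ε K s : ℝ} (hκ : 0 < κ) (hκl : κ < lam) (hε : 0 < ε) (hK : 1 ≤ K) (hs : 0 < s)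
    {θ : ℝ} (hθ : 0 < θ) :
    ∃ δ > 0, ∀ U₀ U₁ : PairSpace (densityMeasure π), IsAdmissible (densityMeasure π) s K U₀ →
      IsAdmissible (densityMeasure π) s K U₁ → ‖U₁.fst - U₀.fst‖ ^ 2 ≤ δ →
      (∀ V ∈ sobolevSpace (densityMeasure π) s,
        (∫ x, (U₁.fst x - U₀.fst x + s ^ 2 * reaction κ ε (‖U₀.fst‖ ^ 2) (U₀.fst x)) * V.fst x
          ∂densityMeasure π) + ⟪U₁.snd, V.snd⟫_ℝ = 0) →
      ∃ c, 1 / K ≤ c ∧ c ≤ K ∧ ∫ x, |U₁.fst x - c| ∂densityMeasure π ≤ θ := by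
  have hK0 : 0 < K := by linarith
  have hπi : Integrable π := by
    by_contra h
    rw [integral_undef h] at hπ1
    exact zero_ne_one hπ1
  have hac := volume_absolutelyContinuous_densityMeasure hπ.continuous hpos
  obtain ⟨R, hR, hRm⟩ := exists_closedBall_mass hπ1 (show 0 < θ / (3 * K) by positivity)
  obtain ⟨β, hβ, hosc⟩ := exists_forall_weighted_oscillation_le hπ.continuous hpos hR
    (show 0 < θ / 3 by positivity)
  obtain ⟨R', hR', δ', hδ', hgrad⟩ := exists_forall_gradient_le hd hπ hpos hπ1 hγ hstat hcond
    hκ hκl hε hK hR hβ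
  set T := (1 / s ^ 2 + (3 * κ * K + 4 * ε * K ^ 2)) ^ 2 with hT
  have hT0 : 0 < T := by positivity
  refine ⟨δ' / (4 * T), by positivity, fun U₀ U₁ h₀ h₁ hδ hU => ?_⟩
  have hσ : |Real.log (‖U₀.fst‖ ^ 2)| ≤ 2 * K := by
    obtain ⟨n1, n2⟩ := norm_sq_mem_range hK h₀.2
    exact (log_sq_bounds hK n1 n2).trans (by linarith [log_le_self_of_one_le hK])
  obtain ⟨v, hv, hv1, hv2, hvr, hvu⟩ := exists_smooth_approximation hπ hpos hκ hε hK hs h₀ h₁ hσ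
    hU (max R R') (η := min (θ / 3) (δ' / 2)) (by positivity)
  have hq := continuousOn_reaction κ ε (‖U₀.fst‖ ^ 2) (m := 1 / K) (M := K) (by positivity)
  have hrc : Continuous fun x => (genL π v x - reaction κ ε (‖U₀.fst‖ ^ 2) (v x)) ^ 2 * π x :=
    (((contDiff_genL hπ hpos hv).continuous.sub
      (hq.comp_continuous hv.continuous fun x => ⟨hv1 x, hv2 x⟩)).pow 2).mul hπ.continuous
  have hBc := isCompact_closedBall (0 : EuclideanSpace ℝ (Fin d)) (max R R')
  have hg := hgrad _ hσ v hv hv1 hv2 (by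
    refine (setIntegral_mono_set (hrc.continuousOn.integrableOn_compact hBc)
      (Filter.Eventually.of_forall fun x => mul_nonneg (sq_nonneg _) (hpos x).le)
      (Metric.closedBall_subset_closedBall (le_max_right R R')).eventuallyLE).trans ?_
    refine hvr.trans ?_
    have e1 : min (θ / 3) (δ' / 2) ≤ δ' / 2 := min_le_right _ _
    have e2 : T * ‖U₁.fst - U₀.fst‖ ^ 2 ≤ δ' / 4 :=
      (mul_le_mul_of_nonneg_left hδ hT0.le).trans (le_of_eq (by field_simp))
    linarith)
  obtain ⟨y, hy⟩ := hosc v hv hg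
  refine ⟨v y, hv1 y, hv2 y, ?_⟩
  rw [integral_densityMeasure hπ.continuous hpos]
  set B := Metric.closedBall (0 : EuclideanSpace ℝ (Fin d)) R with hB
  have hBm : MeasurableSet B := Metric.isClosed_closedBall.measurableSet
  have huK : ∀ᵐ x, ∀ z, |U₁.fst x - v z| ≤ K := by
    filter_upwards [hac.ae_le h₁.2] with x b1 z
    have : 0 < 1 / K := by positivity
    exact abs_le.mpr ⟨by linarith [hv2 z, b1.1], by linarith [hv1 z, b1.2]⟩
  have hum : AEStronglyMeasurable U₁.fst volume := (Lp.aestronglyMeasurable U₁.fst).mono_ac hac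
  have hi : Integrable fun x => |U₁.fst x - v y| * π x := by
    refine hπi.bdd_mul (c := K) (hum.sub aestronglyMeasurable_const).norm ?_
    filter_upwards [huK] with x hx
    rw [Real.norm_eq_abs, abs_abs]
    exact hx y
  have hi2 : Integrable fun x => |v x - U₁.fst x| * π x := by
    refine hπi.bdd_mul (c := K) (hv.continuous.aestronglyMeasurable.sub hum).norm ?_
    filter_upwards [huK] with x hx
    rw [Real.norm_eq_abs, abs_abs, abs_sub_comm]
    exact hx x
  have hi3 : IntegrableOn (fun x => |v x - v y| * π x) B :=
    ((hv.continuous.sub continuous_const).abs.mul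
      hπ.continuous).continuousOn.integrableOn_compact (isCompact_closedBall _ _)
  have p1 : ∫ x in B, |U₁.fst x - v y| * π x ≤ θ / 3 + θ / 3 := by
    calc ∫ x in B, |U₁.fst x - v y| * π x
        ≤ ∫ x in B, (|v x - U₁.fst x| * π x + |v x - v y| * π x) := by
          refine setIntegral_mono hi.integrableOn (hi2.integrableOn.add hi3) fun x => ?_
          change |U₁.fst x - v y| * π x ≤ |v x - U₁.fst x| * π x + |v x - v y| * π x
          rw [← add_mul, abs_sub_comm (v x)]
          exact mul_le_mul_of_nonneg_right (abs_sub_le _ _ _) (hpos x).le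
      _ = (∫ x in B, |v x - U₁.fst x| * π x) + ∫ x in B, |v x - v y| * π x :=
          integral_add hi2.integrableOn hi3
      _ ≤ θ / 3 + θ / 3 := by
          refine add_le_add ?_ hy
          refine (setIntegral_mono_set hi2.integrableOn
            (Filter.Eventually.of_forall fun x => mul_nonneg (abs_nonneg _) (hpos x).le)
            (Metric.closedBall_subset_closedBall (le_max_left R R')).eventuallyLE).trans ?_
          exact hvu.trans (min_le_left _ _)
  have p2 : ∫ x in Bᶜ, |U₁.fst x - v y| * π x ≤ θ / 3 := by
    have a1 : ∫ x in Bᶜ, |U₁.fst x - v y| * π x ≤ ∫ x in Bᶜ, K * π x := by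
      refine setIntegral_mono_ae hi.integrableOn (hπi.const_mul K).integrableOn ?_
      filter_upwards [huK] with x hx
      exact mul_le_mul_of_nonneg_right (hx y) (hpos x).le
    have a2 := integral_add_compl hBm hπi
    rw [integral_const_mul] at a1
    have a3 : ∫ x in Bᶜ, π x ≤ θ / (3 * K) := by linarith
    refine (a1.trans (mul_le_mul_of_nonneg_left a3 hK0.le)).trans (le_of_eq ?_)
    field_simp
  rw [← integral_add_compl hBm hi]
  linarith

end Concentration

section EnergyNonneg

/-- Modulus of continuity constant of the tangent energy density. -/
def tangentConst (κ ε K : ℝ) : ℝ :=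
  (2 * κ * K ^ 3 + 2 * ε * K ^ 4) + κ / 2 * K + (κ * K + 3 * ε * K ^ 2) * K
    + κ / 4 * ((1 + 2 * K) * (2 * K))

theorem tangent_density_ge {κ ε K u c : ℝ} (hκ : 0 < κ) (hε : 0 < ε) (hK : 1 ≤ K)
    (hu : 1 / K ≤ u) (hu' : u ≤ K) (hc : 1 / K ≤ c) (hc' : c ≤ K) :
    -(tangentConst κ ε K * |u - c|) ≤ potential κ ε u
      + κ / 4 * (c ^ 2 * Real.log (c ^ 2) + (1 + Real.log (c ^ 2)) * (u ^ 2 - c ^ 2)) := by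
  have hK0 : 0 < K := by linarith
  have hi : 0 < 1 / K := by positivity
  have hc0 : 0 < c := hi.trans_le hc
  have hu0 : 0 < u := hi.trans_le hu
  have h1 := potential_sub_le hκ hε hK hu hu' hc hc'
  have hr := abs_reaction_le (σ := 1) hκ hε hK (by simp; linarith) hu hu'
  have hK' : |c - u| ≤ K := abs_le.mpr ⟨by linarith, by linarith⟩
  have h2 : (reaction κ ε 1 u - κ / 2 * u) * (c - u) ≤
      ((2 * κ * K ^ 3 + 2 * ε * K ^ 4) + κ / 2 * K) * |c - u| := by
    refine (le_abs_self _).trans ?_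
    rw [abs_mul]
    refine mul_le_mul_of_nonneg_right ((abs_sub _ _).trans (add_le_add hr ?_)) (abs_nonneg _)
    rw [abs_of_pos (show 0 < κ / 2 * u by positivity)]
    gcongr
  have h3 : (κ * K + 3 * ε * K ^ 2) * (c - u) ^ 2 ≤ (κ * K + 3 * ε * K ^ 2) * K * |c - u| := by
    have h0 : 0 ≤ κ * K + 3 * ε * K ^ 2 := by positivity
    have h9 : (c - u) ^ 2 ≤ K * |c - u| := by
      rw [← sq_abs (c - u), sq]
      exact mul_le_mul_of_nonneg_right hK' (abs_nonneg _)
    rw [mul_assoc (κ * K + 3 * ε * K ^ 2) K]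
    exact mul_le_mul_of_nonneg_left h9 h0
  have hl : |1 + Real.log (c ^ 2)| ≤ 1 + 2 * K := by
    refine (abs_add_le _ _).trans ?_
    rw [abs_one, Real.log_pow, abs_mul]
    have := abs_log_le hK hc hc'
    norm_num
    linarith
  have h4 : -((1 + 2 * K) * (2 * K) * |c - u|) ≤ (1 + Real.log (c ^ 2)) * (u ^ 2 - c ^ 2) := by
    refine neg_le_of_abs_le ?_
    have e : u ^ 2 - c ^ 2 = -((u + c) * (c - u)) := by ring
    rw [abs_mul, e, abs_neg, abs_mul, abs_of_pos (show 0 < u + c by linarith), ← mul_assoc]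
    gcongr
    linarith
  have h5 : 0 ≤ potential κ ε c + κ / 4 * (c ^ 2 * Real.log (c ^ 2)) := by
    have a1 := Real.log_le_sub_one_of_pos (show 0 < c ^ 4 by positivity)
    rw [Real.log_pow] at a1
    push_cast at a1
    have e : potential κ ε c + κ / 4 * (c ^ 2 * Real.log (c ^ 2))
      = ε * (c ^ 4 / 4 - Real.log c - 1 / 4) := by
      rw [Real.log_pow]; unfold potential; push_cast; ring
    rw [e]
    exact mul_nonneg hε.le (by linarith)
  have h6 := mul_le_mul_of_nonneg_left h4 (show 0 ≤ κ / 4 by positivity)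
  rw [abs_sub_comm u c]
  unfold tangentConst
  linarith

variable {d : ℕ} {μ : Measure (EuclideanSpace ℝ (Fin d))} [IsProbabilityMeasure μ]

theorem energy_ge_of_concentration {κ ε K s : ℝ} (hκ : 0 < κ) (hε : 0 < ε) (hK : 1 ≤ K)
    {U : PairSpace μ} (hU : IsAdmissible μ s K U) {c : ℝ} (hc : 1 / K ≤ c) (hc' : c ≤ K) :
    -(tangentConst κ ε K * ∫ x, |U.fst x - c| ∂μ) ≤ energy κ ε s U := by
  have hK0 : 0 < K := by linarith
  have hi : 0 < 1 / K := by positivity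
  have hc0 : 0 < c := hi.trans_le hc
  have hum := Lp.aestronglyMeasurable U.fst
  have i1 : Integrable (fun x => |U.fst x - c|) μ :=
    integrable_comp_of_continuousOn (φ := fun y => |y - c|) (by fun_prop) (by fun_prop) hum hU.2
  have i2 : Integrable (fun x => potential κ ε (U.fst x)) μ :=
    integrable_comp_of_continuousOn (measurable_potential κ ε) (continuousOn_potential κ ε hi)
      hum hU.2
  have i3 : Integrable (fun x => U.fst x ^ 2) μ :=
    integrable_comp_of_continuousOn (φ := fun y => y ^ 2) (by fun_prop) (by fun_prop) hum hU.2
  have i4 : Integrable (fun x => c ^ 2 * Real.log (c ^ 2)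
      + (1 + Real.log (c ^ 2)) * (U.fst x ^ 2 - c ^ 2)) μ :=
    (integrable_const _).add ((i3.sub (integrable_const _)).const_mul _)
  have h1 := integral_mono_ae (i1.const_mul (tangentConst κ ε K)).neg (i2.add (i4.const_mul (κ / 4)))
    (by
      filter_upwards [hU.2] with x hx
      exact tangent_density_ge hκ hε hK hx.1 hx.2 hc hc')
  have e1 : ∫ x, (potential κ ε (U.fst x) + κ / 4 * (c ^ 2 * Real.log (c ^ 2)
      + (1 + Real.log (c ^ 2)) * (U.fst x ^ 2 - c ^ 2))) ∂μ =
      (∫ x, potential κ ε (U.fst x) ∂μ) + κ / 4 * (c ^ 2 * Real.log (c ^ 2)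
      + (1 + Real.log (c ^ 2)) * (‖U.fst‖ ^ 2 - c ^ 2)) := by
    have j : Integrable (fun x => (1 + Real.log (c ^ 2)) * (U.fst x ^ 2 - c ^ 2)) μ :=
      (i3.sub (integrable_const _)).const_mul _
    rw [integral_add i2 (i4.const_mul _), integral_const_mul,
      integral_add (integrable_const _) j, integral_const_mul (1 + Real.log (c ^ 2)),
      integral_sub i3 (integrable_const _), norm_sq_eq_integral]
    simp
  have e2 : ∫ x, -(tangentConst κ ε K * |U.fst x - c|) ∂μ =
      -(tangentConst κ ε K * ∫ x, |U.fst x - c| ∂μ) := by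
    rw [integral_neg, integral_const_mul]
  have h2 : -(tangentConst κ ε K * ∫ x, |U.fst x - c| ∂μ) ≤
      (∫ x, potential κ ε (U.fst x) ∂μ) + κ / 4 * (c ^ 2 * Real.log (c ^ 2)
      + (1 + Real.log (c ^ 2)) * (‖U.fst‖ ^ 2 - c ^ 2)) :=
    (e2.symm.trans_le h1).trans_eq e1
  have hσ : 0 < ‖U.fst‖ ^ 2 := lt_of_lt_of_le (by positivity) (norm_sq_mem_range hK hU.2).1
  have h3 : c ^ 2 * Real.log (c ^ 2) + (1 + Real.log (c ^ 2)) * (‖U.fst‖ ^ 2 - c ^ 2) ≤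
      ‖U.fst‖ ^ 2 * Real.log (‖U.fst‖ ^ 2) := by
    have hc2 : 0 < c ^ 2 := by positivity
    set t := ‖U.fst‖ ^ 2
    set a := c ^ 2
    have b1 := mul_le_mul_of_nonneg_left (Real.log_le_sub_one_of_pos (div_pos hc2 hσ)) hσ.le
    rw [Real.log_div hc2.ne' hσ.ne', mul_sub, mul_sub, mul_div_cancel₀ _ hσ.ne'] at b1
    linarith
  have h4 := mul_le_mul_of_nonneg_left h3 (show 0 ≤ κ / 4 by positivity)
  have h5 : 0 ≤ 1 / (2 * s ^ 2) * ‖U.snd‖ ^ 2 := by positivity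
  unfold energy
  linarith

variable {π : EuclideanSpace ℝ (Fin d) → ℝ}
  {γ : EuclideanSpace ℝ (Fin d) → EuclideanSpace ℝ (Fin d)}
  [IsProbabilityMeasure (densityMeasure π)]

theorem energy_nonneg (hd : 1 ≤ d) (hπ : ContDiff ℝ (⊤ : ℕ∞) π)
    (hpos : ∀ x, 0 < π x) (hπ1 : ∫ x, π x = 1) (hγ : ContDiff ℝ (⊤ : ℕ∞) γ)
    (hstat : ∀ x, ∑ i, pderiv' (fun y => π y * γ y i) i x = 0)
    {lam κ : ℝ} (hcond : ∀ (x v : EuclideanSpace ℝ (Fin d)),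
      lam * ‖v‖ ^ 2 ≤ ∑ i, ∑ j, Rtensor π γ i j x * v i * v j)
    {ε K s : ℝ} (hκ : 0 < κ) (hκl : κ < lam) (hε : 0 < ε) (hK : 1 ≤ K) (hs : 0 < s)
    (hKl : 2 * κ * Real.log K ≤ ε * (K ^ 2 - 1 / K ^ 2))
    (hsL : s ^ 2 * (3 * κ * K + 4 * ε * K ^ 2) ≤ 1)
    (hsC : 1 ≤ 1 / s ^ 2 - (κ * K + 3 * ε * K ^ 2 + κ / 4 * (2 * K + 1 + 4 * K ^ 4)))
    {Φ : PairSpace (densityMeasure π)} (hΦ : IsAdmissible (densityMeasure π) s K Φ) :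
    0 ≤ energy κ ε s Φ := by
  refine le_of_forall_pos_le_add fun τ hτ => ?_
  have hK0 : 0 < K := by linarith
  have hT : 0 < tangentConst κ ε K := by unfold tangentConst; positivity
  obtain ⟨δ, hδ, hconc⟩ := exists_forall_concentration hd hπ hpos hπ1 hγ hstat hcond
    hκ hκl hε hK hs (show 0 < τ / (2 * tangentConst κ ε K) by positivity)
  obtain ⟨U₀, U₁, h₀, h₁, hE, hn, hw⟩ := exists_almost_stationary hκ hε hK hKl hs hsL hsC hΦ
    (δ := min δ (τ / 2)) (by positivity)
  obtain ⟨c, hc, hc', hθ⟩ := hconc U₀ U₁ h₀ h₁ (hn.trans (min_le_left _ _)) hw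
  have h1 := energy_ge_of_concentration hκ hε hK h₁ hc hc'
  have h2 : tangentConst κ ε K * ∫ x, |U₁.fst x - c| ∂densityMeasure π ≤ τ / 2 :=
    (mul_le_mul_of_nonneg_left hθ hT.le).trans (le_of_eq (by field_simp))
  have h3 := min_le_right δ (τ / 2)
  linarith

end EnergyNonneg

section LogSobolev

theorem exists_step_parameters {κ ε C : ℝ} (hκ : 0 < κ) (hε : 0 < ε) (hC : 0 ≤ C) :
    ∃ K s : ℝ, 1 ≤ K ∧ 0 < s ∧ Real.exp C ≤ K ∧
      2 * κ * Real.log K ≤ ε * (K ^ 2 - 1 / K ^ 2) ∧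
      s ^ 2 * (3 * κ * K + 4 * ε * K ^ 2) ≤ 1 ∧
      1 ≤ 1 / s ^ 2 - (κ * K + 3 * ε * K ^ 2 + κ / 4 * (2 * K + 1 + 4 * K ^ 4)) := by
  have hr : 0 < 2 * κ / ε := by positivity
  obtain ⟨K, hKdef⟩ : ∃ K, K = Real.exp C + 2 * κ / ε := ⟨_, rfl⟩
  have hK : 1 ≤ K := by linarith [Real.one_le_exp hC]
  have hK0 : 0 < K := by linarith
  obtain ⟨A, hA⟩ : ∃ A, A = 3 * κ * K + 4 * ε * K ^ 2 := ⟨_, rfl⟩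
  obtain ⟨B, hB⟩ : ∃ B, B = κ * K + 3 * ε * K ^ 2 + κ / 4 * (2 * K + 1 + 4 * K ^ 4) := ⟨_, rfl⟩
  have hA0 : 0 < A := by rw [hA]; positivity
  have hB0 : 0 < B := by rw [hB]; positivity
  refine ⟨K, 1 / (A + B + 1), hK, by positivity, by linarith, ?_, ?_, ?_⟩
  · have h1 : 2 * κ ≤ ε * (K + 1) := by
      have : ε * (2 * κ / ε) = 2 * κ := by field_simp
      nlinarith [Real.exp_pos C]
    have h2 := mul_le_mul_of_nonneg_left (Real.log_le_sub_one_of_pos hK0)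
      (show 0 ≤ 2 * κ by positivity)
    have h3 := mul_le_mul_of_nonneg_right h1 (show 0 ≤ K - 1 by linarith)
    have h4 : 1 / K ^ 2 ≤ 1 := by
      rw [div_le_one (by positivity)]
      exact one_le_pow₀ hK
    have h5 := mul_le_mul_of_nonneg_left h4 hε.le
    linarith
  · rw [← hA, div_pow, one_pow, div_mul_eq_mul_div, one_mul, div_le_one (by positivity)]
    nlinarith
  · rw [← hB, div_pow, one_pow, one_div_one_div]
    nlinarith

variable {d : ℕ} {π : EuclideanSpace ℝ (Fin d) → ℝ}
  {γ : EuclideanSpace ℝ (Fin d) → EuclideanSpace ℝ (Fin d)}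

theorem norm_snd_gradPair_sq {μ : Measure (EuclideanSpace ℝ (Fin d))} [IsFiniteMeasure μ]
    (s : ℝ) (ψ : testSpace d) :
    ‖(gradPair μ s ψ).snd‖ ^ 2 = s ^ 2 * ∫ x, ‖grad ψ.1 x‖ ^ 2 ∂μ := by
  rw [← real_inner_self_eq_norm_sq, L2.inner_def, ← integral_const_mul]
  refine integral_congr_ae ?_
  filter_upwards [gradPair_snd (μ := μ) s ψ] with x hx
  rw [hx, real_inner_self_eq_norm_sq, norm_smul, mul_pow, Real.norm_eq_abs, sq_abs]

/-- The logarithmic Sobolev inequality for the density `exp (2 g)`. -/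
theorem log_sobolev_exp [IsProbabilityMeasure (densityMeasure π)] (hd : 1 ≤ d)
    (hπ : ContDiff ℝ (⊤ : ℕ∞) π)
    (hpos : ∀ x, 0 < π x) (hπ1 : ∫ x, π x = 1) (hγ : ContDiff ℝ (⊤ : ℕ∞) γ)
    (hstat : ∀ x, ∑ i, pderiv' (fun y => π y * γ y i) i x = 0)
    {lam : ℝ} (hlam : 0 < lam) (hcond : ∀ (x v : EuclideanSpace ℝ (Fin d)),
      lam * ‖v‖ ^ 2 ≤ ∑ i, ∑ j, Rtensor π γ i j x * v i * v j)
    {g : EuclideanSpace ℝ (Fin d) → ℝ} (hg : g ∈ testSpace d)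
    (h1 : ∫ x, Real.exp (2 * g x) ∂densityMeasure π = 1) :
    lam * ∫ x, g x * Real.exp (2 * g x) ∂densityMeasure π ≤
      ∫ x, ‖grad g x‖ ^ 2 * Real.exp (2 * g x) ∂densityMeasure π := by
  obtain ⟨C, hC⟩ := hg.2
  have hC0 : 0 ≤ C := (abs_nonneg _).trans (hC 0).1
  have hbd : ∀ᵐ x ∂densityMeasure π, -C ≤ g x ∧ g x ≤ C :=
    Filter.Eventually.of_forall fun x => abs_le.mp (hC x).1
  have hgm : AEStronglyMeasurable g (densityMeasure π) := hg.1.continuous.aestronglyMeasurable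
  obtain ⟨A, hA⟩ : ∃ A, A = ∫ x, ‖grad g x‖ ^ 2 * Real.exp (2 * g x) ∂densityMeasure π := ⟨_, rfl⟩
  obtain ⟨B, hB⟩ : ∃ B, B = ∫ x, g x * Real.exp (2 * g x) ∂densityMeasure π := ⟨_, rfl⟩
  obtain ⟨E, hE⟩ : ∃ E, E = ∫ x, (Real.exp (g x) ^ 4 / 4 - g x - 1 / 4) ∂densityMeasure π :=
    ⟨_, rfl⟩
  have key : ∀ κ ε : ℝ, 0 < κ → κ < lam → 0 < ε → 0 ≤ A / 2 - κ / 2 * B + ε * E := by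
    intro κ ε hκ hκl hε
    obtain ⟨K, s, hK, hs, hKC, hKl, hsL, hsC⟩ := exists_step_parameters hκ hε hC0
    obtain ⟨ψ, hψ⟩ : ∃ ψ : testSpace d, ψ.1 = fun x => Real.exp (g x) :=
      ⟨⟨_, comp_mem_testSpace Real.contDiff_exp hg⟩, rfl⟩
    have hfst : (gradPair (densityMeasure π) s ψ).fst =ᵐ[densityMeasure π]
        fun x => Real.exp (g x) := by
      have := gradPair_fst (μ := densityMeasure π) s ψ
      rwa [hψ] at this
    have hadm : IsAdmissible (densityMeasure π) s K (gradPair (densityMeasure π) s ψ) := by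
      refine ⟨gradPair_mem_sobolevSpace s ψ, ?_⟩
      filter_upwards [hfst, hbd] with x hx hb
      rw [hx]
      refine ⟨?_, (Real.exp_le_exp.mpr hb.2).trans hKC⟩
      rw [div_le_iff₀ (by linarith)]
      calc (1 : ℝ) ≤ Real.exp (g x) * Real.exp C := by
            rw [← Real.exp_add]; exact Real.one_le_exp (by linarith)
        _ ≤ _ := by gcongr
    have hnn := energy_nonneg hd hπ hpos hπ1 hγ hstat hcond hκ hκl hε hK hs hKl hsL hsC hadm
    have e1 : ‖(gradPair (densityMeasure π) s ψ).fst‖ ^ 2 = 1 := by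
      rw [norm_sq_eq_integral, ← h1]
      refine integral_congr_ae ?_
      filter_upwards [hfst] with x hx
      rw [hx, ← Real.exp_nat_mul]
      simp
    have e2 : ‖(gradPair (densityMeasure π) s ψ).snd‖ ^ 2 = s ^ 2 * A := by
      rw [norm_snd_gradPair_sq, hA, hψ]
      congr 2
      ext x
      rw [grad_comp Real.contDiff_exp hg.1, Real.deriv_exp, norm_smul, mul_pow,
        Real.norm_eq_abs, sq_abs, ← Real.exp_nat_mul, mul_comm]
      simp
    have e3 : ∫ x, potential κ ε ((gradPair (densityMeasure π) s ψ).fst x) ∂densityMeasure π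
        = -(κ / 2) * B + ε * E := by
      have i1 : Integrable (fun x => g x * Real.exp (2 * g x)) (densityMeasure π) :=
        integrable_comp_of_continuousOn (φ := fun y => y * Real.exp (2 * y)) (by fun_prop)
          (by fun_prop) hgm hbd
      have i2 : Integrable (fun x => Real.exp (g x) ^ 4 / 4 - g x - 1 / 4) (densityMeasure π) :=
        integrable_comp_of_continuousOn (φ := fun y => Real.exp y ^ 4 / 4 - y - 1 / 4)
          (by fun_prop) (by fun_prop) hgm hbd
      rw [hB, hE, ← integral_const_mul, ← integral_const_mul,
        ← integral_add (i1.const_mul _) (i2.const_mul _)]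
      refine integral_congr_ae ?_
      filter_upwards [hfst] with x hx
      rw [hx, potential, Real.log_exp, show 2 * g x = g x + g x by ring, Real.exp_add]
      ring
    rw [energy, e1, e2, e3, Real.log_one] at hnn
    have e4 : 1 / (2 * s ^ 2) * (s ^ 2 * A) = A / 2 := by field_simp
    rw [e4] at hnn
    linarith
  have hA0 : 0 ≤ A := hA ▸ integral_nonneg fun x => by positivity
  rw [← hA, ← hB]
  by_contra! hlt
  have hB0 : 0 < B := pos_of_mul_pos_right (hA0.trans_lt hlt) hlam.le
  have hAB : A / B < lam := (div_lt_iff₀ hB0).mpr hlt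
  have hAB0 : 0 ≤ A / B := by positivity
  have hκ : (A / B + lam) / 2 * B = (A + lam * B) / 2 := by field_simp
  obtain ⟨η, hη, hη'⟩ : ∃ η > 0, η * E < (lam * B - A) / 4 := by
    have h : 0 < (lam * B - A) / 4 := by linarith
    refine ⟨(lam * B - A) / 4 / (|E| + 1), by positivity, ?_⟩
    rw [div_mul_eq_mul_div, div_lt_iff₀ (by positivity)]
    exact mul_lt_mul_of_pos_left (by linarith [le_abs_self E]) h
  have := key ((A / B + lam) / 2) η (by linarith) (by linarith) hη
  linarith

end LogSobolev

/-- Corollary 2.3: log-Sobolev inequality for non-reversible dynamics. Under the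
tensor condition `ℜ ⪰ λ I`, the probability density `p = π e^f / ∫ π e^f`
satisfies `D_KL(p‖π) ≤ (1/(2λ)) I(p‖π)`. -/
theorem log_sobolev_nonreversible
    (d : ℕ) (hd : 1 ≤ d)
    (π : EuclideanSpace ℝ (Fin d) → ℝ) (hπ : ContDiff ℝ (⊤ : ℕ∞) π)
    (hπpos : ∀ x, 0 < π x) (hπprob : ∫ x, π x = 1)
    (γ : EuclideanSpace ℝ (Fin d) → EuclideanSpace ℝ (Fin d))
    (hγ : ContDiff ℝ (⊤ : ℕ∞) γ)
    (hstat : ∀ x, ∑ i, pderiv' (fun y => π y * γ y i) i x = 0)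
    (lam : ℝ) (hlam : 0 < lam)
    (hcond : ∀ (x v : EuclideanSpace ℝ (Fin d)),
      lam * ‖v‖ ^ 2 ≤ ∑ i, ∑ j, Rtensor π γ i j x * v i * v j)
    (f : EuclideanSpace ℝ (Fin d) → ℝ) (hf : ContDiff ℝ (⊤ : ℕ∞) f)
    (hfc : HasCompactSupport f) :
    (∫ x, (π x * Real.exp (f x) / ∫ y, π y * Real.exp (f y)) *
        Real.log ((π x * Real.exp (f x) / ∫ y, π y * Real.exp (f y)) / π x)) ≤
      (1 / (2 * lam)) *
        ∫ x, Gamma1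
            (fun z => Real.log ((π z * Real.exp (f z) / ∫ y, π y * Real.exp (f y)) / π z))
            (fun z => Real.log ((π z * Real.exp (f z) / ∫ y, π y * Real.exp (f y)) / π z))
            x * (π x * Real.exp (f x) / ∫ y, π y * Real.exp (f y)) := by
  have hπi : Integrable π := by
    by_contra h
    rw [integral_undef h] at hπprob
    exact zero_ne_one hπprob
  have hprob := isProbabilityMeasure_densityMeasure hπpos hπi hπprob
  have hftest := mem_testSpace_of_hasCompactSupport hf hfc
  have hexpi : Integrable (fun x => Real.exp (f x)) (densityMeasure π) :=
    (memLp_of_mem_testSpace (comp_mem_testSpace Real.contDiff_exp hftest)).integrable (by norm_num)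
  obtain ⟨Z, hZ⟩ : ∃ Z, Z = ∫ y, π y * Real.exp (f y) := ⟨_, rfl⟩
  have hZ' : ∫ x, Real.exp (f x) ∂densityMeasure π = Z := by
    rw [integral_densityMeasure hπ.continuous hπpos, hZ]
    simp only [mul_comm]
  have hZ0 : 0 < Z := hZ' ▸ integral_exp_pos hexpi
  set g : EuclideanSpace ℝ (Fin d) → ℝ := fun x => (f x - Real.log Z) / 2 with hgdef
  have hg : g ∈ testSpace d :=
    comp_mem_testSpace (T := fun y => (y - Real.log Z) / 2) (by fun_prop) hftest
  have hexp : ∀ x, Real.exp (2 * g x) = Real.exp (f x) / Z := fun x => by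
    rw [show 2 * g x = f x - Real.log Z by simp only [hgdef]; ring, Real.exp_sub,
      Real.exp_log hZ0]
  have h1 : ∫ x, Real.exp (2 * g x) ∂densityMeasure π = 1 := by
    simp only [hexp]
    rw [integral_div, hZ', div_self hZ0.ne']
  have hlog : ∀ x, Real.log (π x * Real.exp (f x) / Z / π x) = 2 * g x := fun x => by
    rw [← Real.log_exp (2 * g x), hexp]
    congr 1
    field_simp [(hπpos x).ne']
  have key := log_sobolev_exp hd hπ hπpos hπprob hγ hstat hlam hcond hg h1
  rw [integral_densityMeasure hπ.continuous hπpos,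
    integral_densityMeasure hπ.continuous hπpos] at key
  rw [← hZ]
  simp only [hlog]
  have e1 : ∫ x, π x * Real.exp (f x) / Z * (2 * g x) =
      2 * ∫ x, g x * Real.exp (2 * g x) * π x := by
    rw [← integral_const_mul]
    congr 1
    ext x
    rw [hexp]
    ring
  have e2 : ∫ x, Gamma1 (fun z => 2 * g z) (fun z => 2 * g z) x * (π x * Real.exp (f x) / Z) =
      4 * ∫ x, ‖grad g x‖ ^ 2 * Real.exp (2 * g x) * π x := by
    rw [← integral_const_mul]
    congr 1
    ext x
    have hD : ∀ i, pderiv' (fun z => 2 * g z) i x = 2 * pderiv' g i x := fun i =>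
      pderiv'_const_mul (hg.1.differentiable (by simp) x) 2 i
    have hG : Gamma1 (fun z => 2 * g z) (fun z => 2 * g z) x = 4 * ‖grad g x‖ ^ 2 := by
      rw [norm_grad_sq, Finset.mul_sum]
      refine Finset.sum_congr rfl fun i _ => ?_
      rw [hD]
      ring
    rw [hG, hexp]
    ring
  rw [e1, e2, div_mul_eq_mul_div, one_mul, le_div_iff₀ (by positivity)]
  linarith

end
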